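/- arXiv:1103.4093 — 3 statements merged into one kernel-verified Lean document; each statement's English description precedes it below -/
import Mathlib

section
/- Let B be a finitely generated group, let U be a nontrivial element of B, and let G = ⟨t, B ; rel(B), t⁻¹Ut = U⟩ be the rank one extension of centralizers of B over U (the HNN extension of B with both associated subgroups equal to the cyclic subgroup ⟨U⟩ and associated isomorphism the identity). If B/N_B(U) is infinite, where N_B(U) is the normal closure of U in B, then G satisfies the strong generic free group property with respect to every finite generating set of G. -/
open Filter Set

/-- The ball of radius `m` in a group with respect to a set `S`: the elements expressible as
a product of at most `m` elements of `S ∪ S⁻¹`. -/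
def wordBall {G : Type*} [Group G] (S : Set G) (m : ℕ) : Set G :=
  {g | ∃ l : List G, l.length ≤ m ∧ (∀ x ∈ l, x ∈ S ∨ x⁻¹ ∈ S) ∧ l.prod = g}

/-- A tuple `(g₁, …, gₙ)` is a free basis tuple if the induced homomorphism from the free
group of rank `n` sending the `i`-th free generator to `gᵢ` is injective. -/
def IsFreeBasisTuple {G : Type*} [Group G] {n : ℕ} (x : Fin n → G) : Prop :=
  Function.Injective (FreeGroup.lift x)

/-- A group has the strong generic free group property with respect to a generating set `S`
if for every `n ≥ 1` the proportion of free basis `n`-tuples in the ball of radius `m`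
tends to `1` as `m → ∞`. -/
def StrongGenericFreeGroupProperty {G : Type*} [Group G] (S : Set G) : Prop :=
  ∀ n : ℕ, 1 ≤ n →
    Filter.Tendsto
      (fun m : ℕ =>
        ({x : Fin n → G | (∀ i, x i ∈ wordBall S m) ∧ IsFreeBasisTuple x}.ncard : ℝ) /
          ((wordBall S m).ncard : ℝ) ^ n)
      Filter.atTop (nhds 1)

/-- A group has the strong generic free group property with respect to every finite
generating set. -/
def HasStrongGenericFreeGroupProperty (G : Type*) [Group G] : Prop :=
  ∀ S : Set G, S.Finite → Subgroup.closure S = ⊤ → StrongGenericFreeGroupProperty S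

/-- An integral Lyndon length function on a group, presented by the length `len` together with
the nonnegative-integer-valued Gromov product `com` of two elements, satisfying the ultrametric
inequality. -/
structure LyndonLength (G : Type*) [Group G] where
  /-- The length of an element. -/
  len : G → ℕ
  /-- The length of the common terminal part of two elements. -/
  com : G → G → ℕ
  len_one : len 1 = 0
  len_mul_inv : ∀ a b, len (a * b⁻¹) + 2 * com a b = len a + len b
  min_com_le : ∀ a b d, min (com a b) (com b d) ≤ com a d

namespace List

/-- The length of the longest common prefix of two lists. -/
def commonPrefixLength {α : Type*} [DecidableEq α] : List α → List α → ℕ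
  | a :: l, b :: m => if a = b then commonPrefixLength l m + 1 else 0
  | _, _ => 0

theorem exists_eq_append_commonPrefixLength {α : Type*} [DecidableEq α] (l m : List α) :
    ∃ p l' m' : List α, l = p ++ l' ∧ m = p ++ m' ∧ p.length = commonPrefixLength l m ∧
      ∀ a ∈ l'.head?, ∀ b ∈ m'.head?, a ≠ b := by
  induction l generalizing m with
  | nil => exact ⟨[], [], m, by simp [commonPrefixLength]⟩
  | cons a l ih =>
    cases m with
    | nil => exact ⟨[], a :: l, [], by simp [commonPrefixLength]⟩
    | cons b m =>
      by_cases hab : a = b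
      · subst hab
        obtain ⟨p, l', m', rfl, rfl, hp, h⟩ := ih m
        exact ⟨a :: p, l', m', by simp, by simp, by simp [commonPrefixLength, hp], h⟩
      · exact ⟨[], a :: l, b :: m, by simp, by simp, by simp [commonPrefixLength, hab],
          by simpa using hab⟩

theorem min_commonPrefixLength_le {α : Type*} [DecidableEq α] (l m n : List α) :
    min (commonPrefixLength l m) (commonPrefixLength m n) ≤ commonPrefixLength l n := by
  induction l generalizing m n with
  | nil => simp [commonPrefixLength]
  | cons a l ih =>
    cases m with
    | nil => simp [commonPrefixLength]
    | cons b m =>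
      cases n with
      | nil => simp [commonPrefixLength]
      | cons c n =>
        have := ih m n
        simp only [commonPrefixLength]
        split_ifs <;> first | omega | (exfalso; simp_all)

end List

namespace HNNExtension

open NormalWord

variable {B : Type*} [Group B] {A C : Subgroup B} {φ : A ≃* C}

/-- The product in the HNN extension of a list of syllables. -/
def sylProd (φ : A ≃* C) (l : List (ℤˣ × B)) : HNNExtension B A C φ :=
  (l.map fun x => t ^ (x.1 : ℤ) * of x.2).prod

theorem exists_reducedWord_mul_inv (d : TransversalPair B A C) (h₁ h₂ : B)
    (l₁ l₂ : List (ℤˣ × B))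
    (c₁ : l₁.IsChain fun a b => a.2 ∈ toSubgroup A C a.1 → a.1 = b.1)
    (c₂ : l₂.IsChain fun a b => a.2 ∈ toSubgroup A C a.1 → a.1 = b.1)
    (m₁ : ∀ x ∈ l₁, x.2 ∈ d.set x.1) (m₂ : ∀ x ∈ l₂, x.2 ∈ d.set x.1)
    (hne : ∀ x ∈ l₁.getLast?, ∀ y ∈ l₂.getLast?, x ≠ y) :
    ∃ w : ReducedWord B A C, w.prod φ = of h₁ * sylProd φ l₁ * (of h₂ * sylProd φ l₂)⁻¹ ∧
      w.toList.length = l₁.length + l₂.length ∧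
      ∀ x ∈ w.toList.getLast?,
        (l₂ = [] ∧ ∃ k, (x.1, k) ∈ l₁.getLast? ∧ x.2 = k * h₂⁻¹) ∨
        (∃ y ∈ l₂.head?, x.1 = -y.1 ∧ x.2 = h₂⁻¹) := by
  induction l₂ generalizing h₂ with
  | nil =>
    rcases l₁.eq_nil_or_concat' with rfl | ⟨l, ⟨u, k⟩, rfl⟩
    · exact ⟨⟨h₁ * h₂⁻¹, [], List.isChain_nil⟩, by simp [ReducedWord.prod, sylProd], by simp,
        by simp⟩
    · refine ⟨⟨h₁, l ++ [(u, k * h₂⁻¹)], ?_⟩, by simp [ReducedWord.prod, sylProd, mul_assoc],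
        by simp, by simp⟩
      rw [List.isChain_append] at c₁ ⊢
      simpa using c₁
  | cons y l₂ ih =>
    obtain ⟨u, g⟩ := y
    obtain ⟨w, hw, hlen, hlast⟩ := ih g (List.isChain_cons.1 c₂).2
      (fun x hx => m₂ x (List.mem_cons_of_mem _ hx))
      (by
        intro x hx y hy
        refine hne x hx y ?_
        cases l₂ with
        | nil => simp at hy
        | cons z l => simpa [List.getLast?_cons_cons] using hy)
    have hchain : (w.toList ++ [(-u, h₂⁻¹)]).IsChain
        fun a b => a.2 ∈ toSubgroup A C a.1 → a.1 = b.1 := by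
      rw [List.isChain_append]
      refine ⟨w.chain, by simp, ?_⟩
      intro x hx y hy hmem
      simp only [List.head?_cons, Option.mem_def, Option.some.injEq] at hy
      subst hy
      obtain ⟨v, z⟩ := x
      rcases hlast _ hx with ⟨rfl, k, hk, hz⟩ | ⟨y, hy, hv, hz⟩
      · simp only at hk hz hmem ⊢
        by_contra hvu
        have hvu' : v = u := by
          rcases Int.units_eq_one_or v with rfl | rfl <;>
            rcases Int.units_eq_one_or u with rfl | rfl <;> simp_all
        subst hvu'
        have hkg : k ≠ g := by
          have := hne _ hk (v, g) (by simp)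
          simpa using this
        have hkm : k ∈ d.set v := m₁ (v, k) (List.mem_of_mem_getLast? hk)
        have hgm : g ∈ d.set v := m₂ (v, g) (by simp)
        have := (d.compl v).1 (a₁ := (⟨1, one_mem _⟩, ⟨k, hkm⟩))
          (a₂ := (⟨z, hmem⟩, ⟨g, hgm⟩)) (by simp [hz])
        simp only [Prod.mk.injEq, Subtype.mk.injEq] at this
        exact hkg this.2
      · simp only at hv hz hmem ⊢
        subst hv hz
        have h1 := (List.isChain_cons.1 c₂).1 y hy
        simp only at h1
        by_contra hne'
        have huy : y.1 ≠ u := fun h => hne' (by rw [h])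
        have hyu : -y.1 = u := by
          rcases Int.units_eq_one_or y.1 with h | h <;>
            rcases Int.units_eq_one_or u with rfl | rfl <;> simp_all
        rw [hyu] at hmem
        exact huy (h1 (by simpa using hmem)).symm
    refine ⟨⟨w.head, w.toList ++ [(-u, h₂⁻¹)], hchain⟩, ?_, by simp [hlen]; omega, ?_⟩
    · have : (ReducedWord.prod φ ⟨w.head, w.toList ++ [(-u, h₂⁻¹)], hchain⟩) =
          w.prod φ * (t ^ ((-u : ℤˣ) : ℤ) * of h₂⁻¹) := by
        simp [ReducedWord.prod, mul_assoc]
      rw [this, hw]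
      simp [sylProd, mul_assoc]
    · intro x hx
      right
      simp only [List.getLast?_append, List.getLast?_singleton, Option.some_or, Option.mem_def,
        Option.some.injEq] at hx
      subst hx
      exact ⟨(u, g), by simp⟩

noncomputable def normalForm (φ : A ≃* C) (d : TransversalPair B A C)
    (g : HNNExtension B A C φ) : NormalWord d :=
  NormalWord.equiv φ d g

theorem prod_normalForm (d : TransversalPair B A C) (g : HNNExtension B A C φ) :
    (normalForm φ d g).prod φ = g :=
  (NormalWord.equiv φ d).symm_apply_apply g

theorem length_eq_of_prod_eq (d : TransversalPair B A C) {g : HNNExtension B A C φ}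
    (w : ReducedWord B A C) (hw : w.prod φ = g) :
    (normalForm φ d g).toList.length = w.toList.length := by
  have h := (ReducedWord.map_fst_eq_and_of_prod_eq φ
    (w₁ := (normalForm φ d g).toReducedWord) (w₂ := w) (by rw [prod_normalForm, hw])).1
  simpa using congrArg List.length h

open Classical in
/-- The number of occurrences of the stable letter in a normal form, as a Lyndon length on an
HNN extension. -/
noncomputable def stableLength (φ : A ≃* C) (d : TransversalPair B A C) :
    LyndonLength (HNNExtension B A C φ) where
  len g := (normalForm φ d g).toList.length
  com a b := List.commonPrefixLength (normalForm φ d a).toList.reverse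
    (normalForm φ d b).toList.reverse
  len_one := by
    rw [length_eq_of_prod_eq d (ReducedWord.empty B A C) (by simp [ReducedWord.prod])]
    rfl
  len_mul_inv a b := by
    obtain ⟨p, l, m, hl, hm, hp, hne⟩ := List.exists_eq_append_commonPrefixLength
      (normalForm φ d a).toList.reverse (normalForm φ d b).toList.reverse
    rw [← hp]
    have hl' : (normalForm φ d a).toList = l.reverse ++ p.reverse := by
      rw [← List.reverse_append, ← hl, List.reverse_reverse]
    have hm' : (normalForm φ d b).toList = m.reverse ++ p.reverse := by
      rw [← List.reverse_append, ← hm, List.reverse_reverse]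
    have ca := (normalForm φ d a).chain
    have cb := (normalForm φ d b).chain
    rw [hl', List.isChain_append] at ca
    rw [hm', List.isChain_append] at cb
    obtain ⟨w, hw, hlen, -⟩ := exists_reducedWord_mul_inv (φ := φ) d (normalForm φ d a).head
      (normalForm φ d b).head l.reverse m.reverse ca.1 cb.1
      (fun x hx => (normalForm φ d a).mem_set x.1 x.2 (by rw [hl']; simp at hx; simp [hx]))
      (fun x hx => (normalForm φ d b).mem_set x.1 x.2 (by rw [hm']; simp at hx; simp [hx]))
      (by simpa [List.getLast?_reverse] using hne)
    have hab : w.prod φ = a * b⁻¹ := by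
      conv_rhs => rw [← prod_normalForm d a, ← prod_normalForm d b]
      rw [hw, ReducedWord.prod, ReducedWord.prod, hl', hm']
      simp [sylProd, mul_assoc]
    rw [length_eq_of_prod_eq d w hab, hlen, hl', hm']
    simp
    ring
  min_com_le a b e := List.min_commonPrefixLength_le _ _ _

theorem stableLength_len_eq (d : TransversalPair B A C) {g : HNNExtension B A C φ}
    (w : ReducedWord B A C) (hw : w.prod φ = g) :
    (stableLength φ d).len g = w.toList.length :=
  length_eq_of_prod_eq d w hw

theorem stableLength_len_of (d : TransversalPair B A C) (b : B) :
    (stableLength φ d).len (of b) = 0 :=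
  stableLength_len_eq d ⟨b, [], List.isChain_nil⟩ (by simp [ReducedWord.prod])

theorem stableLength_len_t (d : TransversalPair B A C) : (stableLength φ d).len t = 1 :=
  stableLength_len_eq d ⟨1, [(1, 1)], by simp⟩ (by simp [ReducedWord.prod])

theorem stableLength_len_t_mul_of_mul_t (d : TransversalPair B A C) (b : B) :
    (stableLength φ d).len (t * of b * t) = 2 :=
  stableLength_len_eq d ⟨1, [(1, b), (1, 1)], by simp⟩ (by simp [ReducedWord.prod, mul_assoc])

theorem mem_range_of_stableLength_len_eq_zero (d : TransversalPair B A C)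
    {g : HNNExtension B A C φ} (h : (stableLength φ d).len g = 0) : ∃ b, of b = g := by
  refine ⟨(normalForm φ d g).head, ?_⟩
  have h' : (normalForm φ d g).toList = [] := List.length_eq_zero_iff.1 h
  conv_rhs => rw [← prod_normalForm d g, ReducedWord.prod, h']
  simp

theorem mem_of_stableLength_t_mul_of_mul_inv_t (d : TransversalPair B A C) {b : B}
    (h : (stableLength φ d).len (t * of b * t⁻¹) = 0) : b ∈ A := by
  by_contra hb
  have := stableLength_len_eq d (g := (t * of b * t⁻¹ : HNNExtension B A C φ))
    (⟨1, [(1, b), (-1, 1)], by simp [hb]⟩ : ReducedWord B A C)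
    (by simp [ReducedWord.prod, mul_assoc])
  simp [h] at this

theorem mem_of_stableLength_inv_t_mul_of_mul_t (d : TransversalPair B A C) {b : B}
    (h : (stableLength φ d).len (t⁻¹ * of b * t) = 0) : b ∈ C := by
  by_contra hb
  have := stableLength_len_eq d (g := (t⁻¹ * of b * t : HNNExtension B A C φ))
    (⟨1, [(-1, b), (1, 1)], by simp [hb]⟩ : ReducedWord B A C)
    (by simp [ReducedWord.prod, mul_assoc])
  simp [h] at this

end HNNExtension

namespace LyndonLength

variable {G : Type*} [Group G] (ℒ : LyndonLength G)

theorem com_self (a : G) : ℒ.com a a = ℒ.len a := by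
  have := ℒ.len_mul_inv a a
  rw [mul_inv_cancel, ℒ.len_one] at this
  omega

theorem len_inv (a : G) : ℒ.len a⁻¹ = ℒ.len a := by
  have h₁ := ℒ.len_mul_inv 1 a
  have h₂ := ℒ.len_mul_inv 1 a⁻¹
  simp only [one_mul, inv_inv, ℒ.len_one] at h₁ h₂
  omega

theorem com_comm (a b : G) : ℒ.com a b = ℒ.com b a := by
  have h₁ := ℒ.len_mul_inv a b
  have h₂ := ℒ.len_mul_inv b a
  have h₃ := ℒ.len_inv (a * b⁻¹)
  simp only [mul_inv_rev, inv_inv] at h₃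
  omega

theorem com_le_left (a b : G) : ℒ.com a b ≤ ℒ.len a := by
  have h₁ := ℒ.min_com_le a b a
  rw [ℒ.com_self, ℒ.com_comm b a, min_self] at h₁
  exact h₁

theorem com_le_right (a b : G) : ℒ.com a b ≤ ℒ.len b := by
  rw [ℒ.com_comm]; exact ℒ.com_le_left b a

theorem len_mul (a b : G) : ℒ.len (a * b) + 2 * ℒ.com a b⁻¹ = ℒ.len a + ℒ.len b := by
  have := ℒ.len_mul_inv a b⁻¹
  rwa [inv_inv, ℒ.len_inv] at this

theorem len_mul_le (a b : G) : ℒ.len (a * b) ≤ ℒ.len a + ℒ.len b := by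
  have := ℒ.len_mul a b
  omega

theorem len_mul_of_len_eq_zero (a : G) {b : G} (hb : ℒ.len b = 0) : ℒ.len (a * b) = ℒ.len a := by
  have h₁ := ℒ.len_mul a b
  have h₂ := ℒ.com_le_right a b⁻¹
  rw [ℒ.len_inv] at h₂
  omega

theorem len_mul_of_len_eq_zero_left {a : G} (b : G) (ha : ℒ.len a = 0) :
    ℒ.len (a * b) = ℒ.len b := by
  have h₁ := ℒ.len_mul a b
  have h₂ := ℒ.com_le_left a b⁻¹
  omega

theorem le_com_trans {n : ℕ} {a b c : G} (h₁ : n ≤ ℒ.com a b) (h₂ : n ≤ ℒ.com b c) :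
    n ≤ ℒ.com a c :=
  (le_min h₁ h₂).trans (ℒ.min_com_le a b c)

theorem com_mul_self_of_len_mul {a b : G} (h : ℒ.len (a * b) = ℒ.len a + ℒ.len b) :
    ℒ.com (a * b) b = ℒ.len b := by
  have := ℒ.len_mul_inv (a * b) b
  rw [mul_inv_cancel_right] at this
  omega

/-- Two elements of length one which do not cancel against each other may be inserted between
two elements with which they do not cancel. -/
theorem len_mul_mul_mul {p a b s : G} (ha : ℒ.len a = 1) (hb : ℒ.len b = 1)
    (hpa : ℒ.com p a⁻¹ = 0) (hab : ℒ.com a b⁻¹ = 0) (hbs : ℒ.com b s⁻¹ = 0) :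
    ℒ.len (p * (a * b) * s) = ℒ.len p + 2 + ℒ.len s := by
  have h₁ := ℒ.len_mul p a
  have h₂ := ℒ.len_mul b s
  have h₃ := ℒ.len_mul (p * a) (b * s)
  have h₄ := ℒ.com_mul_self_of_len_mul (a := p) (b := a) (by omega)
  have h₅ : ℒ.com (s⁻¹ * b⁻¹) b⁻¹ = ℒ.len b⁻¹ := by
    apply ℒ.com_mul_self_of_len_mul
    rw [← mul_inv_rev, ℒ.len_inv, ℒ.len_inv, ℒ.len_inv]
    omega
  rw [ℒ.len_inv] at h₅
  have h₆ : ℒ.com (p * a) (b * s)⁻¹ = 0 := by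
    by_contra h
    have h₇ : 1 ≤ ℒ.com a (b * s)⁻¹ :=
      ℒ.le_com_trans (by rw [ℒ.com_comm, h₄, ha]) (Nat.one_le_iff_ne_zero.2 h)
    have h₈ : 1 ≤ ℒ.com a b⁻¹ := ℒ.le_com_trans h₇ (by rw [mul_inv_rev, h₅, hb])
    omega
  have : p * (a * b) * s = p * a * (b * s) := by group
  rw [this]
  omega

/-- If `h` occurs without cancellation in two factorizations of an element at the same place, then
the terminal parts differ by an element of length zero whose conjugate by `h` has length zero. -/
theorem len_eq_zero_of_mul_mul_eq {p p' h s s' : G} (e : p * h * s = p' * h * s')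
    (h₁ : ℒ.len (p * h * s) = ℒ.len p + ℒ.len h + ℒ.len s)
    (h₂ : ℒ.len (p' * h * s') = ℒ.len p' + ℒ.len h + ℒ.len s') (hs : ℒ.len s = ℒ.len s') :
    ℒ.len (s' * s⁻¹) = 0 ∧ ℒ.len (h * (s' * s⁻¹) * h⁻¹) = 0 := by
  have key : ∀ p s : G, ℒ.len (p * h * s) = ℒ.len p + ℒ.len h + ℒ.len s →
      ℒ.com (p * h * s) s = ℒ.len s ∧ ℒ.com (p * h * s) (h * s) = ℒ.len h + ℒ.len s ∧
        ℒ.len (h * s) = ℒ.len h + ℒ.len s := by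
    intro p s h₁
    have a₁ := ℒ.len_mul_le p h
    have a₂ := ℒ.len_mul_le (p * h) s
    have a₃ := ℒ.len_mul_le h s
    have a₄ := ℒ.len_mul_le p (h * s)
    rw [← mul_assoc] at a₄
    refine ⟨ℒ.com_mul_self_of_len_mul (by omega), ?_, by omega⟩
    have := ℒ.com_mul_self_of_len_mul (a := p) (b := h * s) (by rw [← mul_assoc]; omega)
    rw [← mul_assoc] at this
    omega
  obtain ⟨a₁, a₂, a₃⟩ := key p s h₁
  obtain ⟨b₁, b₂, b₃⟩ := key p' s' h₂
  rw [← e] at b₁ b₂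
  constructor
  · have := ℒ.le_com_trans (n := ℒ.len s) (a := s') (b := p * h * s) (c := s)
      (by rw [ℒ.com_comm]; omega) (by omega)
    have := ℒ.len_mul_inv s' s
    omega
  · have := ℒ.le_com_trans (n := ℒ.len h + ℒ.len s) (a := h * s') (b := p * h * s) (c := h * s)
      (by rw [ℒ.com_comm]; omega) (by omega)
    have := ℒ.len_mul_inv (h * s') (h * s)
    have e' : h * (s' * s⁻¹) * h⁻¹ = h * s' * (h * s)⁻¹ := by group
    rw [e']
    omega

end LyndonLength

/-- A family of elements, of length two, which can be inserted without cancellation at any place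
of a product and recovered, up to the choice of a factorization modulo the subgroups `E j`, from
its position in the result. -/
structure MarkerSystem {G : Type*} [Group G] (ℒ : LyndonLength G) (ι : Type*) where
  /-- The markers. -/
  h : ι → G
  /-- The subgroups by which a marker can slide. -/
  E : ι → Subgroup G
  len_h : ∀ j, ℒ.len (h j) = 2
  commute : ∀ j, ∀ e ∈ E j, Commute e (h j)
  exists_insert : ∀ p s : G, ∃ j, ℒ.len (p * h j * s) = ℒ.len p + 2 + ℒ.len s ∧
    ℒ.len (p * h j * p⁻¹) = 2 * ℒ.len p + 2
  mem_of_eq : ∀ j, ∀ e : G, ℒ.len e = 0 → ℒ.len (h j * e * (h j)⁻¹) = 0 → e ∈ E j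

namespace HNNExtension

open NormalWord

variable {B : Type*} [Group B] {E : Subgroup B}

/-- The conjugate of `t b t b⁻¹` by `q`. -/
def mark (E : Subgroup B) (b q : B) : HNNExtension B E E (MulEquiv.refl E) :=
  (of q * t) * (of b * t * of (b⁻¹ * q⁻¹))

theorem commute_t_of (e : B) (he : e ∈ E) :
    Commute (t : HNNExtension B E E (MulEquiv.refl E)) (of e) :=
  t_mul_of (φ := MulEquiv.refl E) ⟨e, he⟩

theorem exists_not_and_not_and_not {P Q R : Fin 4 → Prop}
    (hP : ∀ i j, P i → P j → i = j) (hQ : ∀ i j, Q i → Q j → i = j)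
    (hR : ∀ i j, R i → R j → i = j) : ∃ j, ¬ P j ∧ ¬ Q j ∧ ¬ R j := by
  classical
  by_contra! h
  have hsub : (Finset.univ : Finset (Fin 4)) ⊆
      Finset.univ.filter P ∪ Finset.univ.filter Q ∪ Finset.univ.filter R := by
    intro j _
    simp only [Finset.mem_union, Finset.mem_filter, Finset.mem_univ, true_and]
    have := h j
    tauto
  have h₁ := Finset.card_le_card hsub
  have h₂ : (Finset.univ.filter P).card ≤ 1 :=
    Finset.card_le_one.2 (by simpa using fun i hi j hj => hP i j hi hj)
  have h₃ : (Finset.univ.filter Q).card ≤ 1 :=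
    Finset.card_le_one.2 (by simpa using fun i hi j hj => hQ i j hi hj)
  have h₄ : (Finset.univ.filter R).card ≤ 1 :=
    Finset.card_le_one.2 (by simpa using fun i hi j hj => hR i j hi hj)
  have h₅ := Finset.card_union_le (Finset.univ.filter P ∪ Finset.univ.filter Q)
    (Finset.univ.filter R)
  have h₆ := Finset.card_union_le (Finset.univ.filter P) (Finset.univ.filter Q)
  simp only [Finset.card_univ, Fintype.card_fin] at h₁
  omega

variable (d : TransversalPair B E E)

local notation "𝓛" => stableLength (MulEquiv.refl E) d

theorem mem_of_len_conj_t_mul_of_mul_t {b g : B}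
    (h : (𝓛).len (t * of b * t * of g * (t * of b * t)⁻¹) = 0) :
    g ∈ E ∧ b * g * b⁻¹ ∈ E := by
  set ℒ := stableLength (MulEquiv.refl E) d with hℒ
  have l0 : ∀ b : B, ℒ.len (of b) = 0 := stableLength_len_of d
  have lt : ℒ.len t = 1 := stableLength_len_t d
  have ltt : ℒ.len (t * of b * t) = 2 := stableLength_len_t_mul_of_mul_t d b
  have lY := ℒ.len_mul_inv (t * of b * t * of g) (t * of b * t)
  have h₁ := ℒ.com_mul_self_of_len_mul (a := t * of b) (b := t)
    (by rw [ltt, ℒ.len_mul_of_len_eq_zero _ (l0 b), lt])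
  have h₂ := ℒ.com_mul_self_of_len_mul (a := t * of b) (b := t * of g)
    (by rw [← mul_assoc, ℒ.len_mul_of_len_eq_zero _ (l0 g), ltt,
      ℒ.len_mul_of_len_eq_zero _ (l0 b), ℒ.len_mul_of_len_eq_zero _ (l0 g), lt])
  rw [← mul_assoc, ℒ.len_mul_of_len_eq_zero _ (l0 g), lt] at h₂
  rw [h, ℒ.len_mul_of_len_eq_zero _ (l0 g), ltt] at lY
  have h₃ : 1 ≤ ℒ.com (t * of g) t :=
    ℒ.le_com_trans (b := t * of b * t * of g) (by rw [ℒ.com_comm, h₂])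
      (ℒ.le_com_trans (b := t * of b * t) (by omega) (by rw [h₁, lt]))
  have h₄ := ℒ.len_mul_inv (t * of g) t
  rw [ℒ.len_mul_of_len_eq_zero _ (l0 g), lt] at h₄
  have hg : g ∈ E := mem_of_stableLength_t_mul_of_mul_inv_t (φ := MulEquiv.refl E) d
    (show ℒ.len _ = 0 by omega)
  refine ⟨hg, mem_of_stableLength_t_mul_of_mul_inv_t (φ := MulEquiv.refl E) d ?_⟩
  rw [← h, hℒ]
  congr 1
  have hc : t * of g * t⁻¹ = (of g : HNNExtension B E E (MulEquiv.refl E)) := by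
    rw [(commute_t_of g hg).eq, mul_inv_cancel_right]
  calc t * of (b * g * b⁻¹) * t⁻¹ = t * of b * of g * (of b)⁻¹ * t⁻¹ := by simp [mul_assoc]
    _ = t * of b * (t * of g * t⁻¹) * (of b)⁻¹ * t⁻¹ := by rw [hc]
    _ = _ := by simp [mul_assoc]

/-- The marker system of a HNN extension with identical associated subgroups contained in a
normal subgroup of index at least four. -/
noncomputable def markerSystem (b : B) (N : Subgroup B) [N.Normal] (hE : E ≤ N) (q : Fin 4 → B)
    (hq : ∀ i j, (q i)⁻¹ * q j ∈ N → i = j) : MarkerSystem (𝓛) (Fin 4) where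
  h j := mark E b (q j)
  E j := ((E ⊓ E.map (MulAut.conj b).toMonoidHom).map (MulAut.conj (q j)).toMonoidHom).map of
  len_h j := by
    have : mark E b (q j) = of (q j) * (t * of b * t * of (b⁻¹ * (q j)⁻¹)) := by
      simp [mark, mul_assoc]
    rw [this, (𝓛).len_mul_of_len_eq_zero_left _ (stableLength_len_of d _),
      (𝓛).len_mul_of_len_eq_zero _ (stableLength_len_of d _), stableLength_len_t_mul_of_mul_t]
  commute j e he := by
    obtain ⟨_, ⟨f, ⟨hf, g, hg, rfl⟩, rfl⟩, rfl⟩ := he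
    have h₁ : (t : HNNExtension B E E (MulEquiv.refl E)) * (of b * of g * (of b)⁻¹) =
        (of b * of g * (of b)⁻¹) * t := by simpa [mul_assoc] using (commute_t_of _ hf).eq
    have h₂ : (t : HNNExtension B E E (MulEquiv.refl E)) * of g = of g * t := commute_t_of _ hg
    simp only [Commute, SemiconjBy, mark, MulEquiv.coe_toMonoidHom, MulAut.conj_apply, map_mul,
      map_inv]
    calc _ = of (q j) * ((of b * of g * (of b)⁻¹) * t) * of b * t * (of b)⁻¹ * (of (q j))⁻¹ := by
          group
      _ = of (q j) * t * of b * (of g * t) * (of b)⁻¹ * (of (q j))⁻¹ := by rw [← h₁]; group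
      _ = _ := by rw [← h₂]; group
  exists_insert p s := by
    have l0 : ∀ b : B, (𝓛).len (of b) = 0 := stableLength_len_of d
    have hleft : ∀ (p : HNNExtension B E E (MulEquiv.refl E)) (i j : Fin 4),
        1 ≤ (𝓛).com p (of (q i) * t)⁻¹ → 1 ≤ (𝓛).com p (of (q j) * t)⁻¹ → i = j := by
      intro p i j hi hj
      have h₁ := (𝓛).le_com_trans (by rwa [(𝓛).com_comm] at hi) hj
      have h₂ := (𝓛).len_mul_inv (of (q i) * t)⁻¹ (of (q j) * t)⁻¹
      rw [(𝓛).len_inv, (𝓛).len_inv, (𝓛).len_mul_of_len_eq_zero_left _ (l0 _),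
        (𝓛).len_mul_of_len_eq_zero_left _ (l0 _), stableLength_len_t] at h₂
      refine hq i j (hE (mem_of_stableLength_inv_t_mul_of_mul_t (φ := MulEquiv.refl E) d ?_))
      have : (of (q i) * t)⁻¹ * (of (q j) * t)⁻¹⁻¹ =
          (t⁻¹ * of ((q i)⁻¹ * q j) * t : HNNExtension B E E (MulEquiv.refl E)) := by
        simp [mul_assoc]
      rw [this] at h₂
      omega
    have hright : ∀ (s : HNNExtension B E E (MulEquiv.refl E)) (i j : Fin 4),
        1 ≤ (𝓛).com (of b * t * of (b⁻¹ * (q i)⁻¹)) s →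
        1 ≤ (𝓛).com (of b * t * of (b⁻¹ * (q j)⁻¹)) s → i = j := by
      intro s i j hi hj
      have h₁ := (𝓛).le_com_trans hi (by rwa [(𝓛).com_comm] at hj)
      have h₂ := (𝓛).len_mul_inv (of b * t * of (b⁻¹ * (q i)⁻¹)) (of b * t * of (b⁻¹ * (q j)⁻¹))
      rw [(𝓛).len_mul_of_len_eq_zero _ (l0 _), (𝓛).len_mul_of_len_eq_zero _ (l0 _),
        (𝓛).len_mul_of_len_eq_zero_left _ (l0 _), stableLength_len_t] at h₂
      have h₃ : b⁻¹ * ((q i)⁻¹ * q j) * b ∈ E := by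
        refine mem_of_stableLength_t_mul_of_mul_inv_t (φ := MulEquiv.refl E) d ?_
        have : of b * t * of (b⁻¹ * (q i)⁻¹) * (of b * t * of (b⁻¹ * (q j)⁻¹))⁻¹ =
            (of b * (t * of (b⁻¹ * ((q i)⁻¹ * q j) * b) * t⁻¹ * of b⁻¹) :
              HNNExtension B E E (MulEquiv.refl E)) := by
          simp [mul_assoc]
        rw [this, (𝓛).len_mul_of_len_eq_zero_left _ (l0 _),
          (𝓛).len_mul_of_len_eq_zero _ (l0 _)] at h₂
        omega
      refine hq i j ?_
      have := Subgroup.Normal.conj_mem ‹N.Normal› _ (hE h₃) b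
      convert this using 1
      group
    have hone : ∀ {n : ℕ}, ¬ 1 ≤ n → n = 0 := by intro n hn; omega
    obtain ⟨j, h₁, h₂, h₃⟩ := exists_not_and_not_and_not (hleft p) (hright s⁻¹) (hright p⁻¹⁻¹)
    have la : (𝓛).len (of (q j) * t) = 1 := by
      rw [(𝓛).len_mul_of_len_eq_zero_left _ (l0 _), stableLength_len_t]
    have lb : (𝓛).len (of b * t * of (b⁻¹ * (q j)⁻¹)) = 1 := by
      rw [(𝓛).len_mul_of_len_eq_zero _ (l0 _), (𝓛).len_mul_of_len_eq_zero_left _ (l0 _),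
        stableLength_len_t]
    have hab : (𝓛).com (of (q j) * t) (of b * t * of (b⁻¹ * (q j)⁻¹))⁻¹ = 0 := by
      have h₂ := (𝓛).len_mul (of (q j) * t) (of b * t * of (b⁻¹ * (q j)⁻¹))
      have : of (q j) * t * (of b * t * of (b⁻¹ * (q j)⁻¹)) =
          (of (q j) * (t * of b * t * of (b⁻¹ * (q j)⁻¹)) :
              HNNExtension B E E (MulEquiv.refl E)) := by
        simp [mul_assoc]
      rw [this, (𝓛).len_mul_of_len_eq_zero_left _ (l0 _),
        (𝓛).len_mul_of_len_eq_zero _ (l0 _), stableLength_len_t_mul_of_mul_t, la, lb] at h₂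
      omega
    refine ⟨j, (𝓛).len_mul_mul_mul la lb (hone h₁) hab (hone h₂), ?_⟩
    have := (𝓛).len_mul_mul_mul (p := p) (s := p⁻¹) la lb (hone h₁) hab (hone h₃)
    rw [(𝓛).len_inv] at this
    rw [mark, this]
    ring
  mem_of_eq j e he hh := by
    obtain ⟨e', rfl⟩ := mem_range_of_stableLength_len_eq_zero (φ := MulEquiv.refl E) d he
    have h₁ : mark E b (q j) * of e' * (mark E b (q j))⁻¹ =
        of (q j) * (t * of b * t * of (b⁻¹ * ((q j)⁻¹ * e' * q j) * b) * (t * of b * t)⁻¹ *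
          of (q j)⁻¹) := by
      simp [mark, mul_assoc]
    rw [h₁, (𝓛).len_mul_of_len_eq_zero_left _ (stableLength_len_of d _),
        (𝓛).len_mul_of_len_eq_zero _ (stableLength_len_of d _)] at hh
    obtain ⟨h₂, h₃⟩ := mem_of_len_conj_t_mul_of_mul_t d hh
    refine ⟨e', ⟨(q j)⁻¹ * e' * q j, ⟨?_, b⁻¹ * ((q j)⁻¹ * e' * q j) * b, h₂, ?_⟩, ?_⟩, rfl⟩
    · have h₄ : b * (b⁻¹ * ((q j)⁻¹ * e' * q j) * b) * b⁻¹ = (q j)⁻¹ * e' * q j := by group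
      exact h₄ ▸ h₃
    · simp [mul_assoc]
    · simp [mul_assoc]

end HNNExtension

section WordBall

open scoped Pointwise

variable {G : Type*} [Group G] {S : Set G}

theorem one_mem_wordBall (S : Set G) (m : ℕ) : (1 : G) ∈ wordBall S m :=
  ⟨[], by simp, by simp, rfl⟩

theorem wordBall_mono {m n : ℕ} (h : m ≤ n) : wordBall S m ⊆ wordBall S n := by
  rintro g ⟨l, hl, hS, rfl⟩
  exact ⟨l, hl.trans h, hS, rfl⟩

theorem mul_mem_wordBall {m n : ℕ} {g h : G} (hg : g ∈ wordBall S m) (hh : h ∈ wordBall S n) :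
    g * h ∈ wordBall S (m + n) := by
  obtain ⟨l, hl, hS, rfl⟩ := hg
  obtain ⟨l', hl', hS', rfl⟩ := hh
  refine ⟨l ++ l', by simp; omega, ?_, by simp⟩
  intro x hx
  rcases List.mem_append.1 hx with hx | hx
  exacts [hS x hx, hS' x hx]

theorem inv_mem_wordBall {m : ℕ} {g : G} (hg : g ∈ wordBall S m) : g⁻¹ ∈ wordBall S m := by
  obtain ⟨l, hl, hS, rfl⟩ := hg
  refine ⟨(l.map fun x => x⁻¹).reverse, by simpa using hl, ?_, by rw [List.prod_inv_reverse]⟩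
  intro x hx
  simp only [List.mem_reverse, List.mem_map] at hx
  obtain ⟨y, hy, rfl⟩ := hx
  rw [inv_inv]
  exact (hS y hy).symm

theorem wordBall_zero : wordBall S 0 = {1} := by
  ext g
  constructor
  · rintro ⟨l, hl, -, rfl⟩
    simp [List.length_eq_zero_iff.1 (Nat.le_zero.1 hl)]
  · rintro rfl
    exact one_mem_wordBall S 0

/-- The letters: the generators and their inverses. -/
def letters (S : Set G) : Set G := {x | x ∈ S ∨ x⁻¹ ∈ S}

theorem finite_letters (hS : S.Finite) : (letters S).Finite :=
  (hS.union hS.inv).subset fun _ hx => hx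

theorem mem_wordBall_succ {m : ℕ} {g : G} (hg : g ∈ wordBall S (m + 1)) :
    g ∈ wordBall S m ∨ ∃ x ∈ letters S, x⁻¹ * g ∈ wordBall S m := by
  obtain ⟨l, hl, hS, rfl⟩ := hg
  cases l with
  | nil => exact Or.inl (one_mem_wordBall S m)
  | cons x l =>
    refine Or.inr ⟨x, hS x (by simp), l, by simpa using hl, fun y hy => hS y (by simp [hy]), ?_⟩
    simp

theorem letters_subset_wordBall : letters S ⊆ wordBall S 1 := fun x hx =>
  ⟨[x], by simp, by simpa [letters] using hx, by simp⟩

theorem finite_wordBall (hS : S.Finite) (m : ℕ) : (wordBall S m).Finite := by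
  induction m with
  | zero => rw [wordBall_zero]; exact Set.finite_singleton 1
  | succ m ih =>
    refine (ih.union ((finite_letters hS).mul ih)).subset fun g hg => ?_
    rcases mem_wordBall_succ hg with h | ⟨x, hx, h⟩
    · exact Or.inl h
    · exact Or.inr ⟨x, hx, _, h, by simp⟩

theorem wordBall_add_subset (m n : ℕ) : wordBall S (m + n) ⊆ wordBall S m * wordBall S n := by
  induction m with
  | zero =>
    intro g hg
    rw [zero_add] at hg
    exact ⟨1, one_mem_wordBall S 0, g, hg, one_mul g⟩
  | succ m ih =>
    intro g hg
    rw [Nat.add_right_comm] at hg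
    rcases mem_wordBall_succ hg with h | ⟨x, hx, h⟩
    · obtain ⟨a, ha, b, hb, rfl⟩ := ih h
      exact ⟨a, wordBall_mono (Nat.le_succ m) ha, b, hb, rfl⟩
    · obtain ⟨a, ha, b, hb, hab⟩ := ih h
      refine ⟨x * a, ?_, b, hb, ?_⟩
      · rw [add_comm]
        exact mul_mem_wordBall (letters_subset_wordBall hx) ha
      · simp only at hab ⊢
        rw [mul_assoc, hab, mul_inv_cancel_left]

theorem ncard_wordBall_add_le (hS : S.Finite) (m n : ℕ) :
    (wordBall S (m + n)).ncard ≤ (wordBall S m).ncard * (wordBall S n).ncard :=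
  (Set.ncard_le_ncard (wordBall_add_subset m n)
    ((finite_wordBall hS m).mul (finite_wordBall hS n))).trans
    Set.natCard_mul_le

theorem exists_mem_wordBall (hS : Subgroup.closure S = ⊤) (g : G) : ∃ m, g ∈ wordBall S m := by
  have hg : g ∈ Subgroup.closure S := by simp [hS]
  induction hg using Subgroup.closure_induction with
  | mem x hx => exact ⟨1, letters_subset_wordBall (Or.inl hx)⟩
  | one => exact ⟨0, one_mem_wordBall S 0⟩
  | mul x y _ _ hx hy =>
    obtain ⟨m, hm⟩ := hx
    obtain ⟨n, hn⟩ := hy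
    exact ⟨m + n, mul_mem_wordBall hm hn⟩
  | inv x _ hx =>
    obtain ⟨m, hm⟩ := hx
    exact ⟨m, inv_mem_wordBall hm⟩

/-- An element of the ball is reached by a geodesic path from the identity. -/
theorem exists_path_of_mem_wordBall {m : ℕ} {x : G} (hx : x ∈ wordBall S m) :
    ∃ (r : ℕ) (s : ℕ → G), r ≤ m ∧ s 0 = 1 ∧ s r = x ∧
      (∀ i < r, s (i + 1) * (s i)⁻¹ ∈ letters S) ∧ Set.InjOn s (Set.Iic r) ∧
      ∀ i ≤ r, s i ∈ wordBall S i ∧ x * (s i)⁻¹ ∈ wordBall S (r - i) := by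
  classical
  have hex : ∃ r, x ∈ wordBall S r := ⟨m, hx⟩
  have hmin : ∀ k, x ∈ wordBall S k → Nat.find hex ≤ k := fun k hk => Nat.find_min' hex hk
  obtain ⟨l, hl, hS, hlx⟩ := Nat.find_spec hex
  have hlen : l.length = Nat.find hex :=
    le_antisymm hl (hmin _ ⟨l, le_rfl, hS, hlx⟩)
  have hparts : ∀ i ≤ l.length, (l.drop (l.length - i)).prod ∈ wordBall S i ∧
      x * ((l.drop (l.length - i)).prod)⁻¹ ∈ wordBall S (l.length - i) := by
    intro i hi
    refine ⟨⟨_, by simp; omega, fun y hy => hS y (List.mem_of_mem_drop hy), rfl⟩,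
      ⟨l.take (l.length - i), by simp, fun y hy => hS y (List.mem_of_mem_take hy), ?_⟩⟩
    rw [eq_mul_inv_iff_mul_eq, List.prod_take_mul_prod_drop, hlx]
  refine ⟨l.length, fun i => (l.drop (l.length - i)).prod, hlen ▸ hmin _ hx, by simp, by simp [hlx],
    ?_, ?_, hparts⟩
  · intro i hi
    have h₁ : l.length - i = l.length - (i + 1) + 1 := by omega
    have h₂ : l.length - (i + 1) < l.length := by omega
    simp only
    rw [h₁, List.drop_eq_getElem_cons h₂]
    rw [List.prod_cons, mul_inv_cancel_right]
    exact hS _ (List.getElem_mem h₂)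
  · have hlt : ∀ i j, i ≤ l.length → j ≤ l.length → (l.drop (l.length - i)).prod =
        (l.drop (l.length - j)).prod → j ≤ i := by
      intro i j hi hj hij
      have h₁ := mul_mem_wordBall (hparts j hj).2 (hparts i hi).1
      rw [hij, inv_mul_cancel_right] at h₁
      have := hmin _ h₁
      omega
    intro i hi j hj hij
    exact le_antisymm (hlt j i hj hi hij.symm) (hlt i j hi hj hij)

end WordBall

theorem Finset.exists_separated_or_cover {α : Type*} (r : α → α → Prop) (hr : ∀ a, r a a)
    (hs : ∀ a b, r a b → r b a) (P : Finset α) (K : ℕ) :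
    (∃ R ⊆ P, R.card = K ∧ ∀ a ∈ R, ∀ b ∈ R, r a b → a = b) ∨
      ∃ R ⊆ P, R.card < K ∧ ∀ a ∈ P, ∃ b ∈ R, r b a := by
  classical
  induction K with
  | zero => exact Or.inl ⟨∅, by simp⟩
  | succ K ih =>
    rcases ih with ⟨R, hRP, hRK, hR⟩ | ⟨R, hRP, hRK, hR⟩
    · by_cases h : ∀ a ∈ P, ∃ b ∈ R, r b a
      · exact Or.inr ⟨R, hRP, by omega, h⟩
      · push Not at h
        obtain ⟨a, haP, ha⟩ := h
        have haR : a ∉ R := fun haR => ha a haR (hr a)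
        refine Or.inl ⟨insert a R, Finset.insert_subset haP hRP, by
          rw [Finset.card_insert_of_notMem haR, hRK], ?_⟩
        intro b hb c hc hbc
        rcases Finset.mem_insert.1 hb with rfl | hb' <;>
          rcases Finset.mem_insert.1 hc with rfl | hc'
        · rfl
        · exact absurd (hs _ _ hbc) (ha c hc')
        · exact absurd hbc (ha b hb')
        · exact hR b hb' c hc' hbc
    · exact Or.inr ⟨R, hRP, by omega, hR⟩

namespace MarkerSystem

open scoped Pointwise

variable {G : Type*} [Group G] {ℒ : LyndonLength G} {ι : Type*} (M : MarkerSystem ℒ ι)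

/-- `x` has, in the ball of radius `m`, at least `K` splittings at which markers can be inserted
with distinct results. -/
def IsRich (S : Set G) (K m : ℕ) (x : G) : Prop :=
  ∃ R : Finset G, R.card = K ∧
    (∀ s ∈ R, ∃ a b, a + b ≤ m ∧ x * s⁻¹ ∈ wordBall S a ∧ s ∈ wordBall S b) ∧
    ∀ s ∈ R, ∀ s' ∈ R, ∀ j, s' * s⁻¹ ∈ M.E j → s = s'

theorem nonempty_index (M : MarkerSystem ℒ ι) : Nonempty ι := ⟨(M.exists_insert 1 1).choose⟩

/-- A poor element has a geodesic path covered by few cosets of the subgroups `E j`. -/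
theorem exists_cover_of_not_isRich {S : Set G} {K m : ℕ} {x : G} (hx : x ∈ wordBall S m)
    (hK : ¬ M.IsRich S K m x) :
    ∃ (r : ℕ) (s : ℕ → G), r ≤ m ∧ s 0 = 1 ∧ s r = x ∧
      (∀ i < r, s (i + 1) * (s i)⁻¹ ∈ letters S) ∧ Set.InjOn s (Set.Iic r) ∧
      x ∈ wordBall S r ∧
      ∃ R : Finset G, R.card < K ∧ ∀ i ≤ r, ∃ a ∈ R, ∃ j, s i * a⁻¹ ∈ M.E j := by
  classical
  obtain ⟨r, s, hr, h0, hrx, hstep, hinj, hsplit⟩ := exists_path_of_mem_wordBall hx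
  refine ⟨r, s, hr, h0, hrx, hstep, hinj, hrx ▸ (hsplit r le_rfl).1, ?_⟩
  obtain ⟨j₀⟩ := M.nonempty_index
  rcases Finset.exists_separated_or_cover (fun a b => ∃ j, b * a⁻¹ ∈ M.E j)
    (fun a => ⟨j₀, by simp⟩)
    (fun a b ⟨j, hj⟩ => ⟨j, by simpa using inv_mem hj⟩)
    ((Finset.range (r + 1)).image s) K with ⟨R, hRP, hRK, hR⟩ | ⟨R, hRP, hRK, hR⟩
  · refine absurd ⟨R, hRK, fun a ha => ?_, fun a ha b hb j hj => hR a ha b hb ⟨j, hj⟩⟩ hK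
    obtain ⟨i, hi, rfl⟩ := Finset.mem_image.1 (hRP ha)
    have hir : i ≤ r := by simpa [Nat.lt_succ_iff] using hi
    exact ⟨r - i, i, by omega, (hsplit i hir).2, (hsplit i hir).1⟩
  · refine ⟨R, hRK, fun i hi => hR (s i) (Finset.mem_image_of_mem s ?_)⟩
    simpa [Nat.lt_succ_iff] using hi

/-- If the markers can slide only by finitely many elements, the poor elements are bounded in
number. -/
theorem exists_ncard_not_isRich_le_of_finite [Finite ι] {S : Set G} (hS : S.Finite)
    (hfin : ∀ j, (M.E j : Set G).Finite) (K : ℕ) :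
    ∃ C : ℕ, ∀ m, {x ∈ wordBall S m | ¬ M.IsRich S K m x}.ncard ≤ C * (m + 1) := by
  classical
  have hE : (⋃ j, (M.E j : Set G)).Finite := Set.finite_iUnion hfin
  set D := hE.toFinset with hD
  refine ⟨(wordBall S (K * D.card)).ncard, fun m => ?_⟩
  refine (Set.ncard_le_ncard ?_ (finite_wordBall hS _)).trans (Nat.le_mul_of_pos_right _ (by omega))
  rintro x ⟨hx, hK⟩
  obtain ⟨r, s, hr, h0, hrx, hstep, hinj, hxr, R, hRK, hR⟩ := M.exists_cover_of_not_isRich hx hK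
  refine wordBall_mono ?_ hxr
  have hsub : (Finset.range (r + 1)).image s ⊆ (R ×ˢ D).image fun p => p.2 * p.1 := by
    intro y hy
    obtain ⟨i, hi, rfl⟩ := Finset.mem_image.1 hy
    obtain ⟨a, ha, j, hj⟩ := hR i (by simpa [Nat.lt_succ_iff] using hi)
    refine Finset.mem_image.2 ⟨(a, s i * a⁻¹), ?_, by simp⟩
    simp only [Finset.mem_product, ha, true_and, hD, Set.Finite.mem_toFinset, Set.mem_iUnion]
    exact ⟨j, hj⟩
  have h₁ := (Finset.card_le_card hsub).trans Finset.card_image_le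
  rw [Finset.card_image_of_injOn (by
      intro i hi j hj hij
      exact hinj (by simpa [Nat.lt_succ_iff] using hi) (by simpa [Nat.lt_succ_iff] using hj) hij),
    Finset.card_range, Finset.card_product] at h₁
  have h₂ : R.card * D.card ≤ K * D.card := Nat.mul_le_mul_right _ hRK.le
  omega

/-- The elements reached by a bounded number of letters and slides. -/
def reach (S : Set G) : ℕ → Set G
  | 0 => {1}
  | n + 1 => ⋃ j, (M.E j : Set G) * ((insert 1 (letters S)) * reach S n)

theorem reach_mono (S : Set G) {m n : ℕ} (h : m ≤ n) : M.reach S m ⊆ M.reach S n := by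
  obtain ⟨j⟩ := M.nonempty_index
  refine monotone_nat_of_le_succ (f := M.reach S) (fun n x hx => ?_) h
  exact Set.mem_iUnion.2 ⟨j, 1, one_mem _, x, ⟨1, by simp, x, hx, by simp⟩, by simp⟩

theorem slide_mem_reach {S : Set G} {n : ℕ} {j : ι} {e x : G} (he : e ∈ M.E j)
    (hx : x ∈ M.reach S n) : e * x ∈ M.reach S (n + 1) :=
  Set.mem_iUnion.2 ⟨j, e, he, x, ⟨1, by simp, x, hx, by simp⟩, by simp⟩

theorem letter_mem_reach {S : Set G} {n : ℕ} {a x : G} (ha : a ∈ letters S)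
    (hx : x ∈ M.reach S n) : a * x ∈ M.reach S (n + 1) := by
  obtain ⟨j⟩ := M.nonempty_index
  exact Set.mem_iUnion.2 ⟨j, 1, one_mem _, a * x, ⟨a, by simp [ha], x, hx, by simp⟩, by simp⟩

theorem path_mem_reach {S : Set G} (R : Finset G) (k : ℕ) (hk : R.card ≤ k) (r n : ℕ)
    (s : ℕ → G) (h0 : s 0 ∈ M.reach S n) (hstep : ∀ i < r, s (i + 1) * (s i)⁻¹ ∈ letters S)
    (hR : ∀ i ≤ r, ∃ a ∈ R, ∃ j, s i * a⁻¹ ∈ M.E j) : s r ∈ M.reach S (n + 3 * k) := by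
  classical
  induction k generalizing R r n s with
  | zero =>
    obtain ⟨a, ha, -⟩ := hR 0 (Nat.zero_le _)
    rw [Finset.card_eq_zero.1 (Nat.le_zero.1 hk)] at ha
    simp at ha
  | succ k ih =>
    obtain ⟨a, ha, j₀, hj₀⟩ := hR 0 (Nat.zero_le _)
    let p : ℕ → Prop := fun i => ∃ j, s i * a⁻¹ ∈ M.E j
    obtain ⟨i, hir, ⟨j, hj⟩, hlast⟩ : ∃ i ≤ r, p i ∧ ∀ i', i < i' → i' ≤ r → ¬ p i' := by
      refine ⟨Nat.findGreatest p r, Nat.findGreatest_le r, ?_, fun i' h₁ h₂ =>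
        Nat.findGreatest_is_greatest h₁ h₂⟩
      exact Nat.findGreatest_spec (P := p) (Nat.zero_le r) ⟨j₀, hj₀⟩
    have hi : s i ∈ M.reach S (n + 1 + 1) := by
      have := M.slide_mem_reach hj (M.slide_mem_reach (inv_mem hj₀) h0)
      simpa [mul_assoc] using this
    rcases hir.eq_or_lt with rfl | hlt
    · exact M.reach_mono S (by omega) hi
    · have h₁ : s (i + 1) ∈ M.reach S (n + 3) := by
        simpa using M.letter_mem_reach (hstep i hlt) hi
      have := ih (R.erase a) (by rw [Finset.card_erase_of_mem ha]; omega) (r - (i + 1)) (n + 3)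
        (fun l => s (i + 1 + l)) h₁ (fun l hl => hstep (i + 1 + l) (by omega)) (fun l hl => by
          obtain ⟨b, hb, j', hj'⟩ := hR (i + 1 + l) (by omega)
          refine ⟨b, Finset.mem_erase.2 ⟨?_, hb⟩, j', hj'⟩
          rintro rfl
          exact hlast (i + 1 + l) (by omega) (by omega) ⟨j', hj'⟩)
      rw [show i + 1 + (r - (i + 1)) = r by omega] at this
      exact M.reach_mono S (by omega) this

/-- The sets covered by finitely many left cosets of the cyclic subgroup generated by `u`. -/
def IsThin (u : G) (Y : Set G) : Prop :=
  ∃ F : Set G, F.Finite ∧ Y ⊆ F * (Subgroup.zpowers u : Set G)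

theorem IsThin.left_mul {u : G} {Y : Set G} (hY : IsThin u Y) (g : G) :
    IsThin u ({g} * Y) := by
  obtain ⟨F, hF, hFY⟩ := hY
  refine ⟨{g} * F, (Set.finite_singleton g).mul hF, ?_⟩
  rw [mul_assoc]
  exact Set.mul_subset_mul_left hFY

theorem IsThin.iUnion {κ : Type*} [Finite κ] {u : G} {Y : κ → Set G}
    (hY : ∀ i, IsThin u (Y i)) : IsThin u (⋃ i, Y i) := by
  choose F hF hFY using hY
  refine ⟨⋃ i, F i, Set.finite_iUnion hF, ?_⟩
  rw [Set.iUnion_mul]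
  exact Set.iUnion_mono hFY

theorem IsThin.finite_mul {u : G} {Y : Set G} (hY : IsThin u Y) {A : Set G}
    (hA : A.Finite) : IsThin u (A * Y) := by
  have := hA.to_subtype
  rw [← Set.iUnion_of_singleton_coe A, Set.iUnion_mul]
  exact IsThin.iUnion fun a => hY.left_mul a

theorem IsThin.zpowers_mul {u : G} {Y : Set G} (hY : IsThin u Y)
    (hu : ∀ g, IsThin u ((Subgroup.zpowers u : Set G) * {g})) :
    IsThin u ((Subgroup.zpowers u : Set G) * Y) := by
  obtain ⟨F, hF, hFY⟩ := hY
  have := hF.to_subtype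
  obtain ⟨F', hF', hFY'⟩ := IsThin.iUnion (κ := F) (u := u) fun g => hu g
  refine ⟨F', hF', (Set.mul_subset_mul_left hFY).trans ?_⟩
  rw [← mul_assoc, show (Subgroup.zpowers u : Set G) * F =
    ⋃ g : F, (Subgroup.zpowers u : Set G) * {(g : G)} by
      rw [← Set.mul_iUnion, Set.iUnion_of_singleton_coe]]
  refine (Set.mul_subset_mul_right hFY').trans ?_
  rw [mul_assoc, coe_mul_coe]

theorem isThin_reach [Finite ι] {S : Set G} (hS : S.Finite) {u : G}
    (hu : ∀ g, IsThin u ((Subgroup.zpowers u : Set G) * {g}))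
    (hE : ∀ j, ∃ c, ∀ e ∈ M.E j, c⁻¹ * e * c ∈ Subgroup.zpowers u) (n : ℕ) :
    IsThin u (M.reach S n) := by
  induction n with
  | zero => exact ⟨{1}, Set.finite_singleton 1, fun x hx => ⟨x, hx, 1, one_mem _, by simp⟩⟩
  | succ n ih =>
    refine IsThin.iUnion fun j => ?_
    obtain ⟨c, hc⟩ := hE j
    have h₁ := (((ih.finite_mul ((finite_letters hS).insert 1)).left_mul c⁻¹).zpowers_mul
      hu).left_mul c
    obtain ⟨F, hF, hFY⟩ := h₁
    refine ⟨F, hF, Set.Subset.trans ?_ hFY⟩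
    rintro _ ⟨e, he, y, hy, rfl⟩
    exact ⟨c, rfl, _, ⟨_, hc e he, _, ⟨c⁻¹, rfl, y, hy, rfl⟩, rfl⟩, by simp [mul_assoc]⟩

/-- If the markers slide by elements of conjugates of a cyclic subgroup whose double cosets consist
of finitely many cosets, the number of poor elements grows at most linearly. -/
theorem exists_ncard_not_isRich_le_of_zpowers [Finite ι] {S : Set G} (hS : S.Finite) {u : G}
    (hu : ∀ g, ∃ F : Set G, F.Finite ∧
      (Subgroup.zpowers u : Set G) * {g} ⊆ F * (Subgroup.zpowers u : Set G))
    (hE : ∀ j, ∃ c, ∀ e ∈ M.E j, c⁻¹ * e * c ∈ Subgroup.zpowers u) (K : ℕ) :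
    ∃ C : ℕ, ∀ m, {x ∈ wordBall S m | ¬ M.IsRich S K m x}.ncard ≤ C * (m + 1) := by
  classical
  obtain ⟨F₀, hF₀, hF₀Y⟩ := M.isThin_reach hS hu hE (3 * K)
  obtain ⟨F, h1F, hFY⟩ : ∃ F : Finset G, 1 ∈ F ∧
      M.reach S (3 * K) ⊆ (F : Set G) * (Subgroup.zpowers u : Set G) := by
    refine ⟨insert 1 hF₀.toFinset, by simp, hF₀Y.trans (Set.mul_subset_mul_right ?_)⟩
    intro x hx
    simp [hx]
  have hc : ∀ p : G × G, ∃ c : ℕ, p.1 * p.2 ∈ (F : Set G) * (Subgroup.zpowers u : Set G) →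
      ∃ f ∈ F, ∃ k : ℤ, k.natAbs ≤ c ∧ p.1 * p.2 = f * u ^ k := by
    intro p
    by_cases hp : p.1 * p.2 ∈ (F : Set G) * (Subgroup.zpowers u : Set G)
    · obtain ⟨f, hf, _, ⟨k, rfl⟩, h⟩ := hp
      exact ⟨k.natAbs, fun _ => ⟨f, hf, k, le_rfl, h.symm⟩⟩
    · exact ⟨0, fun h => absurd h hp⟩
  choose c hc using hc
  set c₀ := ((finite_letters hS).toFinset ×ˢ F).sup c with hc₀
  refine ⟨F.card * (2 * c₀ + 1), fun m => ?_⟩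
  have hsub : {x ∈ wordBall S m | ¬ M.IsRich S K m x} ⊆
      ((F ×ˢ Finset.Icc (-(c₀ * m : ℕ) : ℤ) (c₀ * m : ℕ)).image fun p => p.1 * u ^ p.2 :
        Finset G) := by
    rintro x ⟨hx, hK⟩
    obtain ⟨r, s, hr, h0, hrx, hstep, -, -, R, hRK, hR⟩ := M.exists_cover_of_not_isRich hx hK
    have hs : ∀ i ≤ r, s i ∈ (F : Set G) * (Subgroup.zpowers u : Set G) := by
      intro i hi
      refine hFY ?_
      have := M.path_mem_reach R K hRK.le i 0 s (by rw [h0]; rfl)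
        (fun l hl => hstep l (by omega)) (fun l hl => hR l (by omega))
      simpa using this
    have hs' : ∀ i ≤ r, ∃ f ∈ F, ∃ k : ℤ, k.natAbs ≤ c₀ * i ∧ s i = f * u ^ k := by
      intro i hi
      induction i with
      | zero => exact ⟨1, h1F, 0, by simp, by simp [h0]⟩
      | succ i ih =>
        obtain ⟨f, hf, k, hk, hfk⟩ := ih (by omega)
        obtain ⟨f₁, hf₁, z, hz, hfz⟩ := hs (i + 1) hi
        have hmem : s (i + 1) * (s i)⁻¹ * f ∈ (F : Set G) * (Subgroup.zpowers u : Set G) := by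
          refine ⟨f₁, hf₁, z * u ^ (-k), mul_mem hz (Subgroup.zpow_mem _
            (Subgroup.mem_zpowers u) _), ?_⟩
          simp only at hfz ⊢
          rw [← mul_assoc, hfz, hfk]
          group
        obtain ⟨f', hf', k', hk', h'⟩ := hc (s (i + 1) * (s i)⁻¹, f) hmem
        refine ⟨f', hf', k' + k, ?_, ?_⟩
        · have h₂ : c (s (i + 1) * (s i)⁻¹, f) ≤ c₀ :=
            Finset.le_sup (f := c) (Finset.mem_product.2
              ⟨by simpa using hstep i (by omega), hf⟩)
          have h₃ := Int.natAbs_add_le k' k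
          rw [mul_add, mul_one]
          omega
        · rw [zpow_add, ← mul_assoc, ← h', mul_assoc, ← hfk]
          simp
    obtain ⟨f, hf, k, hk, hfk⟩ := hs' r le_rfl
    have hk' : k.natAbs ≤ c₀ * m := hk.trans (Nat.mul_le_mul_left _ hr)
    simp only [Finset.coe_image, Set.mem_image, Finset.mem_coe, Finset.mem_product, Finset.mem_Icc]
    exact ⟨(f, k), ⟨hf, by simp only; omega, by simp only; omega⟩, by rw [← hrx, hfk]⟩
  refine (Set.ncard_le_ncard hsub (Finset.finite_toSet _)).trans ?_
  rw [Set.ncard_coe_finset]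
  refine Finset.card_image_le.trans ?_
  rw [Finset.card_product, Int.card_Icc, mul_assoc]
  refine Nat.mul_le_mul_left _ ?_
  have : ((c₀ * m : ℕ) + 1 - -(c₀ * m : ℕ) : ℤ).toNat = 2 * (c₀ * m) + 1 := by omega
  rw [this]
  nlinarith

end MarkerSystem

namespace MarkerSystem

variable {G : Type*} [Group G] {ℒ : LyndonLength G} {ι : Type*} (M : MarkerSystem ℒ ι)

/-- Insertion of markers into sufficiently many places of each element of a set, such that the
place of the marker is determined by the result up to few choices, shows that the set is small. -/
theorem card_mul_le_of_insert [Fintype ι] {S : Set G} (hS : S.Finite) {H : ℕ}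
    (hH : ∀ j, M.h j ∈ wordBall S H) {m K V : ℕ} (X : Finset G) (D : G → Finset ℕ)
    (hD : ∀ g, (D g).card ≤ V)
    (hX : ∀ x ∈ X, ∃ R : Finset G, K ≤ R.card ∧
      (∀ s ∈ R, ∃ a b, a + b ≤ m ∧ x * s⁻¹ ∈ wordBall S a ∧ s ∈ wordBall S b) ∧
      (∀ s ∈ R, ∀ s' ∈ R, ∀ j, ℒ.len s = ℒ.len s' → s' * s⁻¹ ∈ M.E j → s = s') ∧
      ∀ s ∈ R, ∃ j, ℒ.len (x * s⁻¹ * M.h j * s) = ℒ.len (x * s⁻¹) + 2 + ℒ.len s ∧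
        ℒ.len s ∈ D (x * s⁻¹ * M.h j * s)) :
    K * X.card ≤ V * Fintype.card ι * (wordBall S (m + H)).ncard := by
  classical
  have hX' : ∀ x, ∃ R : Finset G, x ∈ X → K ≤ R.card ∧
      (∀ s ∈ R, ∃ a b, a + b ≤ m ∧ x * s⁻¹ ∈ wordBall S a ∧ s ∈ wordBall S b) ∧
      (∀ s ∈ R, ∀ s' ∈ R, ∀ j, ℒ.len s = ℒ.len s' → s' * s⁻¹ ∈ M.E j → s = s') ∧
      ∀ s ∈ R, ∃ j, ℒ.len (x * s⁻¹ * M.h j * s) = ℒ.len (x * s⁻¹) + 2 + ℒ.len s ∧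
        ℒ.len s ∈ D (x * s⁻¹ * M.h j * s) := by
    intro x
    by_cases hx : x ∈ X
    · obtain ⟨R, hR⟩ := hX x hx
      exact ⟨R, fun _ => hR⟩
    · exact ⟨∅, fun h => absurd h hx⟩
  choose R hR using hX'
  have hj : ∀ x s, ∃ j, x ∈ X → s ∈ R x →
      ℒ.len (x * s⁻¹ * M.h j * s) = ℒ.len (x * s⁻¹) + 2 + ℒ.len s ∧
        ℒ.len s ∈ D (x * s⁻¹ * M.h j * s) := by
    intro x s
    by_cases h : x ∈ X ∧ s ∈ R x
    · obtain ⟨j, hj⟩ := (hR x h.1).2.2.2 s h.2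
      exact ⟨j, fun _ _ => hj⟩
    · obtain ⟨j⟩ := M.nonempty_index
      exact ⟨j, fun h₁ h₂ => absurd ⟨h₁, h₂⟩ h⟩
  choose j hj using hj
  set T := (finite_wordBall hS (m + H)).toFinset with hT
  have h₁ : K * X.card ≤ (X.sigma R).card := by
    rw [Finset.card_sigma, mul_comm, ← smul_eq_mul]
    exact Finset.card_nsmul_le_sum _ _ _ fun x hx => (hR x hx).1
  have h₂ : (T.sigma fun g => (Finset.univ : Finset ι) ×ˢ D g).card ≤
      V * Fintype.card ι * (wordBall S (m + H)).ncard := by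
    rw [Finset.card_sigma, Set.ncard_eq_toFinset_card _ (finite_wordBall hS (m + H)), mul_comm,
      ← smul_eq_mul]
    refine Finset.sum_le_card_nsmul _ _ _ fun g _ => ?_
    rw [Finset.card_product, mul_comm, Finset.card_univ]
    exact Nat.mul_le_mul_right _ (hD g)
  refine h₁.trans (le_trans ?_ h₂)
  refine Finset.card_le_card_of_injOn
    (fun p => ⟨p.1 * p.2⁻¹ * M.h (j p.1 p.2) * p.2, (j p.1 p.2, ℒ.len p.2)⟩) ?_ ?_
  · rintro ⟨x, s⟩ hxs
    simp only [Finset.coe_sigma, Set.mem_sigma_iff, Finset.mem_coe] at hxs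
    obtain ⟨hx, hs⟩ := hxs
    simp only [Finset.coe_sigma, Set.mem_sigma_iff, Finset.mem_coe, Finset.mem_product,
      Finset.mem_univ, true_and]
    refine ⟨?_, (hj x s hx hs).2⟩
    obtain ⟨a, b, hab, ha, hb⟩ := (hR x hx).2.1 s hs
    rw [hT, Set.Finite.mem_toFinset]
    exact wordBall_mono (by omega) (mul_mem_wordBall (mul_mem_wordBall ha (hH (j x s))) hb)
  · rintro ⟨x, s⟩ hxs ⟨x', s'⟩ hxs' h
    simp only [Finset.coe_sigma, Set.mem_sigma_iff, Finset.mem_coe] at hxs hxs'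
    simp only [Sigma.mk.injEq, heq_eq_eq, Prod.mk.injEq] at h
    obtain ⟨hp, hjj, hl⟩ := h
    have a₁ := (hj x s hxs.1 hxs.2).1
    have a₂ := (hj x' s' hxs'.1 hxs'.2).1
    rw [← hjj] at a₂ hp
    have key := ℒ.len_eq_zero_of_mul_mul_eq hp (by rw [a₁, M.len_h]) (by rw [a₂, M.len_h]) hl
    have hE := M.mem_of_eq (j x s) _ key.1 key.2
    have hc := (M.commute _ _ hE).eq
    have hxx : x = x' := by
      have e₁ : x * s⁻¹ * M.h (j x s) = x' * s'⁻¹ * (s' * s⁻¹) * M.h (j x s) := by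
        rw [mul_assoc (x' * s'⁻¹), hc, ← mul_assoc, ← mul_assoc (_ * _) s' s⁻¹, ← hp]
        simp
      have e₂ := mul_right_cancel e₁
      simpa using congrArg (· * s) e₂
    subst hxx
    obtain rfl := (hR x hxs.1).2.2.1 s hxs.2 s' hxs'.2 _ hl hE
    rfl

/-- Few elements with many splittings are short. -/
theorem card_mul_le_of_len_le [Fintype ι] {S : Set G} (hS : S.Finite) {H : ℕ}
    (hH : ∀ j, M.h j ∈ wordBall S H) {m K L : ℕ} (X : Finset G)
    (hX : ∀ x ∈ X, M.IsRich S K m x ∧ ℒ.len x ≤ L) :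
    K * X.card ≤ (L + 1) * Fintype.card ι * (wordBall S (m + H)).ncard := by
  refine M.card_mul_le_of_insert hS hH X
    (fun g => Finset.Icc ((ℒ.len g - 2 - L + 1) / 2) ((ℒ.len g - 2 - L + 1) / 2 + L))
    (fun g => by rw [Nat.card_Icc]; omega) fun x hx => ?_
  obtain ⟨⟨R, hRK, hRs, hR⟩, hxL⟩ := hX x hx
  refine ⟨R, hRK.ge, hRs, fun s hs s' hs' j _ h => hR s hs s' hs' j h, fun s hs => ?_⟩
  obtain ⟨j, hj, -⟩ := M.exists_insert (x * s⁻¹) s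
  refine ⟨j, hj, ?_⟩
  have h₁ := ℒ.len_mul_inv x s
  have h₂ := ℒ.com_le_left x s
  have h₃ := ℒ.com_le_right x s
  rw [hj, Finset.mem_Icc]
  omega

/-- On the path to an element, every common part with the element occurs up to the maximal length
of a letter. -/
theorem _root_.LyndonLength.exists_split (ℒ : LyndonLength G) {S : Set G} {A : ℕ}
    (hA : ∀ a ∈ letters S, ℒ.len a ≤ A) {m : ℕ} {x : G} (hx : x ∈ wordBall S m) {d : ℕ}
    (hd : 0 < d) (hdx : d ≤ ℒ.len x) :
    ∃ s, (∃ a b, a + b ≤ m ∧ x * s⁻¹ ∈ wordBall S a ∧ s ∈ wordBall S b) ∧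
      d ≤ ℒ.com x s ∧ ℒ.len s < d + A := by
  classical
  obtain ⟨r, s, hr, h0, hrx, hstep, -, hsplit⟩ := exists_path_of_mem_wordBall hx
  have hex : ∃ i, d ≤ ℒ.com x (s i) := ⟨r, by rwa [hrx, ℒ.com_self]⟩
  have hle : Nat.find hex ≤ r := Nat.find_min' hex (by rwa [hrx, ℒ.com_self])
  have hi := Nat.find_spec hex
  cases hn : Nat.find hex with
  | zero =>
    rw [hn, h0] at hi
    have := ℒ.com_le_right x 1
    rw [ℒ.len_one] at this
    omega
  | succ i =>
    rw [hn] at hi hle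
    have hlt : ¬ d ≤ ℒ.com x (s i) := Nat.find_min hex (by omega)
    refine ⟨s (i + 1), ⟨r - (i + 1), i + 1, by omega, (hsplit _ hle).2, (hsplit _ hle).1⟩, hi, ?_⟩
    have h₁ := ℒ.len_mul_inv (s (i + 1)) (s i)
    have h₂ := hA _ (hstep i (by omega))
    have h₃ : ¬ d ≤ ℒ.com (s (i + 1)) (s i) := fun h => hlt (ℒ.le_com_trans hi h)
    have h₄ := ℒ.len_mul_le (s (i + 1) * (s i)⁻¹) (s i)
    rw [inv_mul_cancel_right] at h₄
    omega

theorem com_insert {p s : G} {j : ι} (h₁ : ℒ.len (p * M.h j * s) = ℒ.len p + 2 + ℒ.len s)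
    (h₂ : ℒ.len (p * M.h j * p⁻¹) = 2 * ℒ.len p + 2) :
    ℒ.com (p * M.h j * s) (p * s) = ℒ.com (p * s) s := by
  have h₃ := ℒ.len_mul_inv (p * M.h j * s) (p * s)
  have h₄ := ℒ.len_mul_inv (p * s) s
  have e₁ : p * M.h j * s * (p * s)⁻¹ = p * M.h j * p⁻¹ := by group
  rw [e₁] at h₃
  rw [mul_inv_cancel_right] at h₄
  omega

/-- The long elements sharing half of their length with an element recoverable after the insertion
of a marker are few. -/
theorem card_mul_le_of_le_com [Fintype ι] {S : Set G} (hS : S.Finite) {H : ℕ}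
    (hH : ∀ j, M.h j ∈ wordBall S H) {A : ℕ} (hA : ∀ a ∈ letters S, ℒ.len a ≤ A) {m K : ℕ}
    (X : Finset G) (Y : G → G) (hXm : ∀ x ∈ X, x ∈ wordBall S m)
    (hXK : ∀ x ∈ X, 2 * (1 + K * A) < ℒ.len x)
    (hY : ∀ p s j, p * s ∈ X → 2 * ℒ.len s < ℒ.len (p * s) →
      ℒ.len (p * M.h j * s) = ℒ.len p + 2 + ℒ.len s →
      ℒ.len (p * s) ≤ 2 * ℒ.com (p * s) (Y (p * M.h j * s))) :
    K * X.card ≤ A * Fintype.card ι * (wordBall S (m + H)).ncard := by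
  classical
  refine M.card_mul_le_of_insert hS hH X
    (fun g => Finset.Ico (ℒ.com g (Y g)) (ℒ.com g (Y g) + A)) (fun g => by simp) fun x hx => ?_
  have hxK := hXK x hx
  have hk : ∀ k : Fin K, 1 + (k : ℕ) * A + A ≤ 1 + K * A := by
    intro k
    have := Nat.mul_le_mul_right A (Nat.succ_le_iff.2 k.2)
    rw [Nat.succ_mul] at this
    omega
  choose s hsplit hcom hlen using fun k : Fin K =>
    ℒ.exists_split hA (hXm x hx) (d := 1 + k * A) (by omega) (by have := hk k; omega)
  have hle : ∀ k, ℒ.com x (s k) ≤ ℒ.len (s k) := fun k => ℒ.com_le_right _ _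
  have hlt : ∀ k l : Fin K, ℒ.len (s k) = ℒ.len (s l) → k ≤ l := by
    intro k l hkl
    by_contra! hlk
    have h₁ := Nat.mul_le_mul_right A (Nat.succ_le_iff.2 hlk)
    have h₂ := hle k
    have h₃ := hcom k
    have h₄ := hlen l
    rw [Nat.succ_mul] at h₁
    omega
  have hinj : ∀ k l : Fin K, ℒ.len (s k) = ℒ.len (s l) → k = l := fun k l h =>
    le_antisymm (hlt k l h) (hlt l k h.symm)
  refine ⟨Finset.univ.image s, ?_, ?_, ?_, ?_⟩
  · rw [Finset.card_image_of_injective _ fun k l h => hinj k l (by rw [h])]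
    simp
  · intro a ha
    obtain ⟨k, -, rfl⟩ := Finset.mem_image.1 ha
    exact hsplit k
  · intro a ha b hb j hab _
    obtain ⟨k, -, rfl⟩ := Finset.mem_image.1 ha
    obtain ⟨l, -, rfl⟩ := Finset.mem_image.1 hb
    rw [hinj k l hab]
  · intro a ha
    obtain ⟨k, -, rfl⟩ := Finset.mem_image.1 ha
    obtain ⟨j, hj, hj'⟩ := M.exists_insert (x * (s k)⁻¹) (s k)
    refine ⟨j, hj, ?_⟩
    have hx' : x * (s k)⁻¹ * s k = x := inv_mul_cancel_right x (s k)
    have h₁ := M.com_insert hj hj'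
    have hshort : 2 * ℒ.len (s k) < ℒ.len x := by
      have := hk k
      have := hlen k
      omega
    have h₂ := hY (x * (s k)⁻¹) (s k) j (by rwa [hx']) (by rwa [hx']) hj
    rw [hx'] at h₁ h₂
    set x' := x * (s k)⁻¹ * M.h j * s k
    have h₃ := hle k
    have h₄ := hcom k
    have h₅ := hlen k
    have h₆ : ℒ.com x' x ≤ ℒ.com x' (Y x') := ℒ.le_com_trans (b := x) le_rfl (by omega)
    have h₇ : ¬ ℒ.com x' x + 1 ≤ ℒ.com x' (Y x') := fun h => by
      have := ℒ.le_com_trans (c := x) h (by rw [ℒ.com_comm (Y x') x]; omega)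
      omega
    rw [Finset.mem_Ico]
    omega

theorem len_le_two_mul_com_inv {p s : G} {j : ι} (hp : ℒ.len (p * s) ≤ 2 * ℒ.com (p * s) (p * s)⁻¹)
    (hs : 2 * ℒ.len s < ℒ.len (p * s))
    (h : ℒ.len (p * M.h j * s) = ℒ.len p + 2 + ℒ.len s) :
    ℒ.len (p * s) ≤ 2 * ℒ.com (p * s) (p * M.h j * s)⁻¹ := by
  have h₁ := ℒ.len_mul_inv (p * M.h j * s)⁻¹ (p * s)⁻¹
  have e : (p * M.h j * s)⁻¹ * (p * s)⁻¹⁻¹ = s⁻¹ * (M.h j)⁻¹ * s := by group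
  have h₂ := ℒ.len_mul_le (s⁻¹ * (M.h j)⁻¹) s
  have h₃ := ℒ.len_mul_le s⁻¹ (M.h j)⁻¹
  have h₄ := ℒ.len_mul_le p s
  rw [ℒ.len_inv, ℒ.len_inv, M.len_h] at h₃
  rw [e, ℒ.len_inv, ℒ.len_inv] at h₁
  have h₅ : (ℒ.len (p * s) + 1) / 2 ≤ ℒ.com (p * s) (p * M.h j * s)⁻¹ :=
    ℒ.le_com_trans (b := (p * s)⁻¹) (by omega) (by rw [ℒ.com_comm]; omega)
  omega

/-- For every `η > 0` there is a length such that, up to the proportion `η`, elements of large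
balls are longer, and the elements which are longer do not cancel half of their length against a
given element, or themselves. -/
theorem exists_len_forall_ncard_le [Fintype ι] {S : Set G} (hS : S.Finite)
    (hgen : Subgroup.closure S = ⊤)
    (hpoor : ∀ K, ∃ C : ℕ, ∀ m, {x ∈ wordBall S m | ¬ M.IsRich S K m x}.ncard ≤ C * (m + 1))
    (hgrowth : ∀ (C : ℕ) (η : ℝ), 0 < η →
      ∀ᶠ m : ℕ in atTop, (C * (m + 1) : ℝ) ≤ η * (wordBall S m).ncard)
    (η : ℝ) (hη : 0 < η) :
    ∃ L : ℕ,
      (∀ m y, ({x ∈ wordBall S m | L < ℒ.len x ∧ ℒ.len x ≤ 2 * ℒ.com x y}.ncard : ℝ) ≤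
        η * (wordBall S m).ncard) ∧
      (∀ m, ({x ∈ wordBall S m | L < ℒ.len x ∧ ℒ.len x ≤ 2 * ℒ.com x x⁻¹}.ncard : ℝ) ≤
        η * (wordBall S m).ncard) ∧
      ∀ᶠ m : ℕ in atTop, ({x ∈ wordBall S m | ℒ.len x ≤ L}.ncard : ℝ) ≤
        η * (wordBall S m).ncard := by
  classical
  obtain ⟨H, hH⟩ : ∃ H, ∀ j, M.h j ∈ wordBall S H := by
    choose n hn using fun j => exists_mem_wordBall hgen (M.h j)
    exact ⟨Finset.univ.sup n, fun j => wordBall_mono (Finset.le_sup (Finset.mem_univ j)) (hn j)⟩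
  obtain ⟨A, hA⟩ : ∃ A, ∀ a ∈ letters S, ℒ.len a ≤ A := by
    refine ⟨(finite_letters hS).toFinset.sup ℒ.len, fun a ha => Finset.le_sup (by simpa using ha)⟩
  have hfin : ∀ (m : ℕ) (p : G → Prop), {x ∈ wordBall S m | p x}.Finite := fun m p =>
    (finite_wordBall hS m).subset (Set.sep_subset _ _)
  have hbound : ∀ (V : ℕ) (η : ℝ), 0 < η → ∃ K : ℕ, ∀ (m n : ℕ),
      K * n ≤ V * Fintype.card ι * (wordBall S (m + H)).ncard →
      (n : ℝ) ≤ η * (wordBall S m).ncard := by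
    intro V η hη
    obtain ⟨K, hK⟩ := exists_nat_gt ((V * Fintype.card ι * (wordBall S H).ncard : ℝ) / η)
    refine ⟨K, fun m n h => ?_⟩
    have h₁ : K * n ≤ V * Fintype.card ι * ((wordBall S m).ncard * (wordBall S H).ncard) :=
      h.trans (Nat.mul_le_mul_left _ (ncard_wordBall_add_le hS m H))
    have h₂ : (K * n : ℝ) ≤ V * Fintype.card ι * ((wordBall S m).ncard * (wordBall S H).ncard) := by
      exact_mod_cast h₁
    rw [div_lt_iff₀ hη] at hK
    have hK0 : (0 : ℝ) < K := by
      by_contra! h0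
      have : (0 : ℝ) ≤ V * Fintype.card ι * (wordBall S H).ncard := by positivity
      nlinarith
    have h₃ : (V * Fintype.card ι * (wordBall S H).ncard : ℝ) * (wordBall S m).ncard ≤
        K * η * (wordBall S m).ncard := mul_le_mul_of_nonneg_right hK.le (by positivity)
    refine le_of_mul_le_mul_left ?_ hK0
    linarith
  obtain ⟨K, hK⟩ := hbound A η hη
  have key : ∀ (m : ℕ) (q : G → G) (Y : G → G),
      (∀ p s j, 2 * ℒ.len s < ℒ.len (p * s) →
        ℒ.len (p * M.h j * s) = ℒ.len p + 2 + ℒ.len s →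
        ℒ.len (p * s) ≤ 2 * ℒ.com (p * s) (q (p * s)) →
        ℒ.len (p * s) ≤ 2 * ℒ.com (p * s) (Y (p * M.h j * s))) →
      ({x ∈ wordBall S m | 2 * (1 + K * A) < ℒ.len x ∧ ℒ.len x ≤ 2 * ℒ.com x (q x)}.ncard : ℝ) ≤
        η * (wordBall S m).ncard := by
    intro m q Y hY
    refine hK m _ ?_
    rw [Set.ncard_eq_toFinset_card _ (hfin m _)]
    refine M.card_mul_le_of_le_com hS hH hA _ Y (fun x hx => ?_) (fun x hx => ?_)
      fun p s j hx h₁ h₂ => ?_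
    · exact ((Set.Finite.mem_toFinset _).1 hx).1
    · exact ((Set.Finite.mem_toFinset _).1 hx).2.1
    · exact hY p s j h₁ h₂ ((Set.Finite.mem_toFinset _).1 hx).2.2
  refine ⟨2 * (1 + K * A), fun m y => key m (fun _ => y) (fun _ => y) fun p s j _ _ h => h,
    fun m => key m (fun x => x⁻¹) (fun x => x⁻¹) fun p s j h₁ h₂ h₃ =>
      M.len_le_two_mul_com_inv h₃ h₁ h₂, ?_⟩
  obtain ⟨K', hK'⟩ := hbound (2 * (1 + K * A) + 1) (η / 2) (by positivity)
  obtain ⟨C, hC⟩ := hpoor K'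
  filter_upwards [hgrowth C (η / 2) (by positivity)] with m hm
  have h₁ : {x ∈ wordBall S m | ℒ.len x ≤ 2 * (1 + K * A)} ⊆
      {x ∈ wordBall S m | ¬ M.IsRich S K' m x} ∪
        {x ∈ wordBall S m | M.IsRich S K' m x ∧ ℒ.len x ≤ 2 * (1 + K * A)} := by
    rintro x ⟨hx, hxL⟩
    by_cases hr : M.IsRich S K' m x
    · exact Or.inr ⟨hx, hr, hxL⟩
    · exact Or.inl ⟨hx, hr⟩
  have h₂ := (Set.ncard_le_ncard h₁ ((hfin m _).union (hfin m _))).trans (Set.ncard_union_le _ _)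
  have h₃ : ({x ∈ wordBall S m | M.IsRich S K' m x ∧ ℒ.len x ≤ 2 * (1 + K * A)}.ncard : ℝ) ≤
      η / 2 * (wordBall S m).ncard := by
    refine hK' m _ ?_
    rw [Set.ncard_eq_toFinset_card _ (hfin m _)]
    exact M.card_mul_le_of_len_le hS hH _ fun x hx => ((Set.Finite.mem_toFinset _).1 hx).2
  have h₄ : ({x ∈ wordBall S m | ¬ M.IsRich S K' m x}.ncard : ℝ) ≤ C * (m + 1) := by
    exact_mod_cast hC m
  have h₅ : ({x ∈ wordBall S m | ℒ.len x ≤ 2 * (1 + K * A)}.ncard : ℝ) ≤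
      {x ∈ wordBall S m | ¬ M.IsRich S K' m x}.ncard +
        {x ∈ wordBall S m | M.IsRich S K' m x ∧ ℒ.len x ≤ 2 * (1 + K * A)}.ncard := by
    exact_mod_cast h₂
  linarith

end MarkerSystem

namespace LyndonLength

variable {G : Type*} [Group G] (ℒ : LyndonLength G)

/-- The value of a letter `(i, ε)` of a free group at a tuple. -/
def letterVal {ι : Type*} (x : ι → G) (p : ι × Bool) : G := cond p.2 (x p.1) (x p.1)⁻¹

theorem letterVal_not {ι : Type*} (x : ι → G) (p : ι × Bool) :
    letterVal x (p.1, !p.2) = (letterVal x p)⁻¹ := by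
  rcases p with ⟨i, _ | _⟩ <;> simp [letterVal]

/-- Tuples whose letters cancel less than half of their lengths are free. -/
theorem injective_lift {ι : Type*} (x : ι → G)
    (h : ∀ p q : ι × Bool, p ≠ q →
      2 * ℒ.com (letterVal x p) (letterVal x q) < ℒ.len (letterVal x p)) :
    Function.Injective (FreeGroup.lift x) := by
  have key : ∀ (l : List (ι × Bool)) (p : ι × Bool), FreeGroup.IsReduced (p :: l) →
      0 < ℒ.len ((p :: l).map (letterVal x)).prod ∧
      ℒ.len (letterVal x p) <
        2 * ℒ.com ((p :: l).map (letterVal x)).prod⁻¹ (letterVal x p)⁻¹ := by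
    intro l
    induction l with
    | nil =>
      intro p _
      have := h p (p.1, !p.2) (by rcases p with ⟨i, _ | _⟩ <;> simp)
      simp only [List.map_cons, List.map_nil, List.prod_cons, List.prod_nil, mul_one, ℒ.com_self,
        ℒ.len_inv]
      omega
    | cons q l ih =>
      intro p hp
      rw [FreeGroup.IsReduced, List.isChain_cons_cons] at hp
      obtain ⟨h₁, h₂⟩ := ih q hp.2
      rw [List.map_cons, List.prod_cons]
      set u := ((q :: l).map (letterVal x)).prod
      have hpq : p ≠ (q.1, !q.2) := by
        rintro rfl
        have := hp.1 rfl
        simp at this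
      have h₃ := h p _ hpq
      have h₄ := h _ p hpq.symm
      rw [letterVal_not, ℒ.len_inv] at h₄
      rw [letterVal_not] at h₃
      have h₅ := ℒ.com_comm (letterVal x q)⁻¹ (letterVal x p)
      have h₆ := ℒ.min_com_le (letterVal x p) u⁻¹ (letterVal x q)⁻¹
      have h₇ := ℒ.len_mul (letterVal x p) u
      have h₈ := ℒ.len_mul_inv (letterVal x p * u)⁻¹ (letterVal x p)⁻¹
      have e : (letterVal x p * u)⁻¹ * (letterVal x p)⁻¹⁻¹ = u⁻¹ := by group
      rw [e, ℒ.len_inv, ℒ.len_inv, ℒ.len_inv] at h₈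
      omega
  classical
  rw [injective_iff_map_eq_one]
  intro g hg
  rw [← FreeGroup.toWord_eq_nil_iff]
  cases hw : g.toWord with
  | nil => rfl
  | cons p l =>
    have h₁ := (key l p (hw ▸ FreeGroup.isReduced_toWord)).1
    rw [← FreeGroup.mk_toWord (x := g), hw, FreeGroup.lift_mk] at hg
    have : ((p :: l).map (letterVal x)).prod = 1 := hg
    rw [this, ℒ.len_one] at h₁
    omega

end LyndonLength

/-- If a property of tuples in a finite set holds with proportion at most `η` along every line
in the `i`-th direction, then it holds with proportion at most `η`. -/
theorem Finset.card_filter_piFinset_le_of_update {ι α : Type*} [Fintype ι] [DecidableEq ι]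
    [DecidableEq α] (W : Finset α) (hW : W.Nonempty) (P : (ι → α) → Prop) [DecidablePred P] (i : ι)
    (η : ℝ)
    (h : ∀ x ∈ Fintype.piFinset fun _ : ι => W,
      ((W.filter fun a => P (Function.update x i a)).card : ℝ) ≤ η * W.card) :
    (((Fintype.piFinset fun _ : ι => W).filter P).card : ℝ) ≤
      η * (W.card : ℝ) ^ Fintype.card ι := by
  set T := Fintype.piFinset fun _ : ι => W with hT
  have hTc : T.card = W.card ^ Fintype.card ι := by simp [hT]
  have h₁ : ((T.filter P) ×ˢ W).card ≤
      (T.sigma fun x => W.filter fun a => P (Function.update x i a)).card := by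
    refine Finset.card_le_card_of_injOn
      (fun z => ⟨Function.update z.1 i z.2, z.1 i⟩) ?_ ?_
    · rintro ⟨x, a⟩ hz
      simp only [Finset.coe_product, Set.mem_prod, Finset.mem_coe, Finset.mem_filter, hT,
        Fintype.mem_piFinset] at hz
      simp only [Finset.coe_sigma, Set.mem_sigma_iff, Finset.mem_coe, Finset.mem_filter, hT,
        Fintype.mem_piFinset, Function.update_idem, Function.update_eq_self]
      refine ⟨fun j => ?_, hz.1.1 i, hz.1.2⟩
      by_cases hj : j = i
      · subst hj; simpa using hz.2
      · simpa [hj] using hz.1.1 j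
    · rintro ⟨x, a⟩ - ⟨y, b⟩ - hxy
      simp only [Sigma.mk.injEq, heq_eq_eq] at hxy
      obtain ⟨hu, hi⟩ := hxy
      have hab : a = b := by simpa using congrFun hu i
      refine Prod.ext (funext fun j => ?_) hab
      by_cases hj : j = i
      · subst hj; exact hi
      · simpa [hj] using congrFun hu j
  rw [Finset.card_product, Finset.card_sigma] at h₁
  have h₂ : ((T.filter P).card * W.card : ℝ) ≤ T.card * (η * W.card) := by
    calc ((T.filter P).card * W.card : ℝ) ≤
        ∑ x ∈ T, ((W.filter fun a => P (Function.update x i a)).card : ℝ) := by exact_mod_cast h₁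
      _ ≤ ∑ x ∈ T, η * W.card := Finset.sum_le_sum h
      _ = _ := by rw [Finset.sum_const, nsmul_eq_mul]
  have hW0 : (0 : ℝ) < W.card := by exact_mod_cast hW.card_pos
  rw [hTc] at h₂
  push_cast at h₂
  refine le_of_mul_le_mul_right ?_ hW0
  linarith

namespace LyndonLength

variable {G : Type*} [Group G] (ℒ : LyndonLength G)

/-- A Lyndon length for which long elements and few cancellations are generic yields the strong
generic free group property. -/
theorem strongGenericFreeGroupProperty {S : Set G} (hS : S.Finite)
    (h : ∀ η : ℝ, 0 < η → ∃ L : ℕ,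
      (∀ m y, ({x ∈ wordBall S m | L < ℒ.len x ∧ ℒ.len x ≤ 2 * ℒ.com x y}.ncard : ℝ) ≤
        η * (wordBall S m).ncard) ∧
      (∀ m, ({x ∈ wordBall S m | L < ℒ.len x ∧ ℒ.len x ≤ 2 * ℒ.com x x⁻¹}.ncard : ℝ) ≤
        η * (wordBall S m).ncard) ∧
      ∀ᶠ m : ℕ in atTop, ({x ∈ wordBall S m | ℒ.len x ≤ L}.ncard : ℝ) ≤
        η * (wordBall S m).ncard) :
    StrongGenericFreeGroupProperty S := by
  classical
  intro n hn
  rw [Metric.tendsto_nhds]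
  intro ε hε
  have hn0 : (0 : ℝ) < n := by exact_mod_cast hn
  obtain ⟨L, hy, hinv, hshort⟩ := h (ε / (2 * (n * (2 + 4 * n)))) (by positivity)
  set η := ε / (2 * (n * (2 + 4 * n))) with hη
  filter_upwards [hshort] with m hm
  set W := (finite_wordBall hS m).toFinset with hW
  have hmem : ∀ a, a ∈ W ↔ a ∈ wordBall S m := fun a => Set.Finite.mem_toFinset _
  have hWne : W.Nonempty := ⟨1, (hmem 1).2 (one_mem_wordBall S m)⟩
  have hWcard : (wordBall S m).ncard = W.card := Set.ncard_eq_toFinset_card _ _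
  have hcard : ∀ (p : G → Prop) [DecidablePred p],
      {x ∈ wordBall S m | p x}.ncard = (W.filter p).card := fun p _ => by
    rw [← Set.ncard_coe_finset]
    congr 1
    ext a
    simp [hmem]
  simp only [hcard, hWcard] at hm hy hinv
  replace hy := fun y => by simpa only [hcard, hWcard, ← hW] using hy m y
  replace hinv := by simpa only [hcard, hWcard, ← hW] using hinv m
  have hy' : ∀ y, ((W.filter fun a => L < ℒ.len a ∧ ℒ.len a ≤ 2 * ℒ.com a⁻¹ y).card : ℝ) ≤
      η * W.card := by
    intro y
    refine le_trans ?_ (hy y)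
    norm_cast
    refine Finset.card_le_card_of_injOn (·⁻¹) (fun a ha => ?_) (inv_injective.injOn)
    simp only [Finset.coe_filter, Set.mem_ofPred_eq, hmem, ℒ.len_inv] at ha ⊢
    exact ⟨inv_mem_wordBall ha.1, ha.2⟩
  set T := Fintype.piFinset fun _ : Fin n => W with hT
  let bad (i : Fin n) (x : Fin n → G) : Prop :=
    ℒ.len (x i) ≤ L ∨ (L < ℒ.len (x i) ∧ ℒ.len (x i) ≤ 2 * ℒ.com (x i) (x i)⁻¹) ∨
      ∃ p : Fin n × Bool, p.1 ≠ i ∧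
        ((L < ℒ.len (x i) ∧ ℒ.len (x i) ≤ 2 * ℒ.com (x i) (letterVal x p)) ∨
          (L < ℒ.len (x i) ∧ ℒ.len (x i) ≤ 2 * ℒ.com (x i)⁻¹ (letterVal x p)))
  have hbad : ∀ i, ((T.filter (bad i)).card : ℝ) ≤ (2 + 4 * n) * η * (W.card : ℝ) ^ n := by
    intro i
    have := Finset.card_filter_piFinset_le_of_update W hWne (bad i) i ((2 + 4 * n) * η) ?_
    · simpa using this
    intro x _
    have hsub : (W.filter fun a => bad i (Function.update x i a)) ⊆
        W.filter (fun a => ℒ.len a ≤ L) ∪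
        (W.filter (fun a => L < ℒ.len a ∧ ℒ.len a ≤ 2 * ℒ.com a a⁻¹) ∪
        Finset.univ.biUnion fun p : Fin n × Bool =>
          W.filter (fun a => L < ℒ.len a ∧ ℒ.len a ≤ 2 * ℒ.com a (letterVal x p)) ∪
          W.filter (fun a => L < ℒ.len a ∧ ℒ.len a ≤ 2 * ℒ.com a⁻¹ (letterVal x p))) := by
      intro a ha
      rw [Finset.mem_filter] at ha
      obtain ⟨haW, ha⟩ := ha
      simp only [bad, Function.update_self] at ha
      simp only [Finset.mem_union, Finset.mem_filter, Finset.mem_biUnion, Finset.mem_univ,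
        true_and, haW]
      refine ha.imp id (Or.imp id ?_)
      rintro ⟨p, hp, h⟩
      refine ⟨p, ?_⟩
      have : letterVal (Function.update x i a) p = letterVal x p := by
        simp [letterVal, Function.update_of_ne hp]
      rwa [this] at h
    have h₁ := (Finset.card_le_card hsub).trans ((Finset.card_union_le _ _).trans
      (Nat.add_le_add_left ((Finset.card_union_le _ _).trans
        (Nat.add_le_add_left Finset.card_biUnion_le _)) _))
    have h₂ : ∑ p : Fin n × Bool,
        (((W.filter (fun a => L < ℒ.len a ∧ ℒ.len a ≤ 2 * ℒ.com a (letterVal x p)) ∪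
          W.filter (fun a => L < ℒ.len a ∧ ℒ.len a ≤ 2 * ℒ.com a⁻¹ (letterVal x p))).card : ℕ) : ℝ)
          ≤ ∑ p : Fin n × Bool, (2 * (η * W.card)) := by
      refine Finset.sum_le_sum fun p _ => ?_
      have h₃ := hy (letterVal x p)
      have h₄ := hy' (letterVal x p)
      have h₅ := Finset.card_union_le
        (W.filter (fun a => L < ℒ.len a ∧ ℒ.len a ≤ 2 * ℒ.com a (letterVal x p)))
        (W.filter (fun a => L < ℒ.len a ∧ ℒ.len a ≤ 2 * ℒ.com a⁻¹ (letterVal x p)))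
      have h₆ := (Nat.cast_le (α := ℝ)).2 h₅
      push_cast at h₆
      linarith
    rw [Finset.sum_const, nsmul_eq_mul] at h₂
    simp only [Finset.card_univ, Fintype.card_prod, Fintype.card_fin, Fintype.card_bool] at h₂
    have h₇ := (Nat.cast_le (α := ℝ)).2 h₁
    push_cast at h₇ h₂
    linarith
  have hfree : ∀ x ∈ T, ¬ IsFreeBasisTuple x → ∃ i, bad i x := by
    intro x _ hx
    by_contra! hb
    refine hx (ℒ.injective_lift x fun p q hpq => ?_)
    by_contra! hc
    refine hb p.1 ?_
    by_cases hL : ℒ.len (x p.1) ≤ L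
    · exact Or.inl hL
    push Not at hL
    refine Or.inr ?_
    obtain ⟨i, a⟩ := p
    obtain ⟨j, b⟩ := q
    by_cases hij : j = i
    · subst hij
      refine Or.inl ⟨hL, ?_⟩
      have hcomm := ℒ.com_comm (x j)⁻¹ (x j)
      cases a <;> cases b <;> simp_all [letterVal, ℒ.len_inv]
    · refine Or.inr ⟨(j, b), hij, ?_⟩
      cases a
      · exact Or.inr ⟨hL, by simpa [letterVal, ℒ.len_inv] using hc⟩
      · exact Or.inl ⟨hL, by simpa [letterVal] using hc⟩
  have hset : {x : Fin n → G | (∀ i, x i ∈ wordBall S m) ∧ IsFreeBasisTuple x}.ncard =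
      (T.filter fun x => IsFreeBasisTuple x).card := by
    rw [← Set.ncard_coe_finset]
    congr 1
    ext x
    simp [hT, hmem]
  have htotal : (T.filter fun x => IsFreeBasisTuple x).card +
      (T.filter fun x => ¬ IsFreeBasisTuple x).card = W.card ^ n := by
    rw [Finset.card_filter_add_card_filter_not, hT]
    simp
  have hnot : ((T.filter fun x => ¬ IsFreeBasisTuple x).card : ℝ) ≤
      n * ((2 + 4 * n) * η * (W.card : ℝ) ^ n) := by
    have h₁ : (T.filter fun x => ¬ IsFreeBasisTuple x) ⊆
        Finset.univ.biUnion fun i => T.filter (bad i) := by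
      intro x hx
      rw [Finset.mem_filter] at hx
      obtain ⟨i, hi⟩ := hfree x hx.1 hx.2
      exact Finset.mem_biUnion.2 ⟨i, Finset.mem_univ _, Finset.mem_filter.2 ⟨hx.1, hi⟩⟩
    have h₂ := (Nat.cast_le (α := ℝ)).2 ((Finset.card_le_card h₁).trans Finset.card_biUnion_le)
    refine h₂.trans ?_
    push_cast
    refine (Finset.sum_le_sum fun i _ => hbad i).trans ?_
    simp
  have hWpos : (0 : ℝ) < (W.card : ℝ) ^ n := by
    have : (0 : ℝ) < W.card := by exact_mod_cast hWne.card_pos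
    positivity
  have htotal' : ((T.filter fun x => IsFreeBasisTuple x).card : ℝ) +
      (T.filter fun x => ¬ IsFreeBasisTuple x).card = (W.card : ℝ) ^ n := by exact_mod_cast htotal
  have hηε : n * ((2 + 4 * n) * η * (W.card : ℝ) ^ n) = ε / 2 * (W.card : ℝ) ^ n := by
    rw [hη]
    field_simp
  rw [hset, hWcard, Real.dist_eq, div_sub_one hWpos.ne', abs_div, abs_of_pos hWpos,
    div_lt_iff₀ hWpos, ← htotal', abs_sub_comm, add_sub_cancel_left, Nat.abs_cast, htotal']
  rw [hηε] at hnot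
  nlinarith

end LyndonLength

namespace SemiconjBy

variable {G : Type*} [Group G] {u : G}

open scoped Pointwise in
/-- If `g` commensurates a cyclic subgroup then the double coset of `g` consists of finitely many
cosets. -/
theorem exists_finite_zpowers_mul_subset {g : G} {k l : ℤ} (hk : k ≠ 0)
    (h : SemiconjBy g (u ^ l) (u ^ k)) : ∃ F : Set G, F.Finite ∧
      (Subgroup.zpowers u : Set G) * {g} ⊆ F * (Subgroup.zpowers u : Set G) := by
  refine ⟨(fun r : ℤ => u ^ r * g) '' Set.Icc 0 |k|, (Set.finite_Icc _ _).image _, ?_⟩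
  rintro _ ⟨_, ⟨n, rfl⟩, g', hg', rfl⟩
  obtain rfl : g = g' := hg'.symm
  refine ⟨u ^ (n % k) * g, ⟨n % k, ⟨Int.emod_nonneg n hk, (Int.emod_lt_abs n hk).le⟩, rfl⟩,
    (u ^ l) ^ (n / k), ⟨l * (n / k), zpow_mul u l (n / k)⟩, ?_⟩
  change u ^ (n % k) * g * (u ^ l) ^ (n / k) = u ^ n * g
  rw [mul_assoc, (h.zpow_right (n / k)).eq, ← mul_assoc, ← zpow_mul, ← zpow_add,
    Int.emod_add_mul_ediv]

end SemiconjBy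

namespace LyndonLength

variable {G : Type*} [Group G] (ℒ : LyndonLength G)

theorem len_pow {a : G} (ha : ℒ.len a = 1) (haa : ℒ.len (a * a) = 2) (k : ℕ) :
    ℒ.len (a ^ k) = k := by
  have h₁ := ℒ.len_mul a a
  suffices ∀ k, ℒ.len (a ^ k) = k ∧ ℒ.len (a ^ (k + 1)) = k + 1 from (this k).1
  intro k
  induction k with
  | zero => simp [ℒ.len_one, ha]
  | succ k ih =>
    refine ⟨ih.2, ?_⟩
    have h₂ := ℒ.com_mul_self_of_len_mul (a := a ^ k) (b := a) (by rw [← pow_succ, ih.1, ih.2, ha])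
    rw [← pow_succ] at h₂
    have h₃ := ℒ.len_mul (a ^ (k + 1)) a
    rw [← pow_succ] at h₃
    have h₄ : ¬ 1 ≤ ℒ.com (a ^ (k + 1)) a⁻¹ := fun h => by
      have := ℒ.le_com_trans (c := a⁻¹) (show 1 ≤ ℒ.com a (a ^ (k + 1)) by
        rw [ℒ.com_comm, h₂, ha]) h
      omega
    omega

/-- Powers of a suitable element of length one do not commute with an element of length zero. -/
theorem not_commute_pow {a b : G} (ha : ℒ.len a = 1) (haa : ℒ.len (a * a) = 2)
    (hb : ℒ.len b = 0) (hab : ℒ.len (a * b * a⁻¹) ≠ 0) (k : ℕ) :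
    ¬ Commute (a ^ (k + 1)) b := by
  intro h
  have hab1 : ℒ.len (a * b) = 1 := by rw [ℒ.len_mul_of_len_eq_zero _ hb, ha]
  have h₁ : ℒ.com (a ^ k) (a * b)⁻¹ = 0 := by
    have h₂ := ℒ.len_mul (a ^ k) (a * b)
    rw [← mul_assoc, ← pow_succ, ℒ.len_mul_of_len_eq_zero _ hb, ℒ.len_pow ha haa,
      ℒ.len_pow ha haa, hab1] at h₂
    omega
  have h₂ : ℒ.com (a * b) a⁻¹⁻¹ = 0 := by
    have h₃ := ℒ.len_mul (a * b) a⁻¹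
    rw [ℒ.len_inv, hab1, ha] at h₃
    omega
  have h₃ : ℒ.com a⁻¹ (a ^ k)⁻¹⁻¹ = 0 := by
    have h₄ := ℒ.len_mul (a ^ k) a
    rw [← pow_succ, ℒ.len_pow ha haa, ℒ.len_pow ha haa, ha, ℒ.com_comm] at h₄
    rw [inv_inv]
    omega
  have h₄ := ℒ.len_mul_mul_mul hab1 (by rw [ℒ.len_inv, ha]) h₁ h₂ h₃
  have e : a ^ k * (a * b * a⁻¹) * (a ^ k)⁻¹ = b := by
    calc _ = a ^ (k + 1) * b * (a ^ (k + 1))⁻¹ := by rw [pow_succ]; group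
      _ = b := by rw [h.eq, mul_inv_cancel_right]
  rw [e, hb] at h₄
  omega

end LyndonLength

/-- A group generated by a finite set has more than linear growth if no positive power of `a`
commutes with `b`, while a homomorphism to the integers maps `a` to `1` and `b` to `0`. -/
theorem eventually_le_ncard_wordBall {G : Type*} [Group G] {S : Set G} (hS : S.Finite)
    (hgen : Subgroup.closure S = ⊤) {a b : G} (hab : ∀ k : ℕ, ¬ Commute (a ^ (k + 1)) b)
    (f : G →* Multiplicative ℤ) (ha : f a = Multiplicative.ofAdd 1) (hb : f b = 1)
    (C : ℕ) (η : ℝ) (hη : 0 < η) :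
    ∀ᶠ m : ℕ in atTop, (C * (m + 1) : ℝ) ≤ η * (wordBall S m).ncard := by
  obtain ⟨ℓ₁, h₁⟩ := exists_mem_wordBall hgen a
  obtain ⟨ℓ₂, h₂⟩ := exists_mem_wordBall hgen b
  set ℓ := ℓ₁ + ℓ₂ + 1 with hℓ
  replace h₁ : a ∈ wordBall S ℓ := wordBall_mono (by omega) h₁
  replace h₂ : b ∈ wordBall S ℓ := wordBall_mono (by omega) h₂
  have hpow : ∀ i : ℕ, a ^ i ∈ wordBall S (i * ℓ) := by
    intro i
    induction i with
    | zero => simpa using one_mem_wordBall S 0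
    | succ i ih => rw [pow_succ, Nat.succ_mul]; exact mul_mem_wordBall ih h₁
  have hinj : ∀ i j i' j' : ℕ, a ^ i * b * a ^ j = a ^ i' * b * a ^ j' →
      i ≤ i' → i = i' ∧ j = j' := by
    intro i j i' j' h hi
    have hf := congrArg (fun g => Multiplicative.toAdd (f g)) h
    simp only [map_mul, map_pow, ha, hb, mul_one, ← ofAdd_nsmul, ← ofAdd_add, toAdd_ofAdd] at hf
    simp only [nsmul_eq_mul, mul_one] at hf
    have hij : i + j = i' + j' := by exact_mod_cast hf
    obtain ⟨k, rfl⟩ := Nat.exists_eq_add_of_le hi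
    obtain rfl : j = k + j' := by omega
    cases k with
    | zero => simp
    | succ k =>
      refine absurd ?_ (hab k)
      have h' : a ^ i * (b * a ^ (k + 1)) * a ^ j' = a ^ i * (a ^ (k + 1) * b) * a ^ j' := by
        simpa only [pow_add _ i, pow_add _ (k + 1), mul_assoc] using h
      exact (mul_left_cancel (mul_right_cancel h')).symm
  have hcard : ∀ n m : ℕ, (2 * n + 1) * ℓ ≤ m → n * n ≤ (wordBall S m).ncard := by
    intro n m hm
    have hsub : ∀ p : Fin n × Fin n, a ^ (p.1 : ℕ) * b * a ^ (p.2 : ℕ) ∈ wordBall S m := by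
      intro p
      refine wordBall_mono (le_trans ?_ hm)
        (mul_mem_wordBall (mul_mem_wordBall (hpow _) h₂) (hpow _))
      rw [← Nat.succ_mul, ← Nat.add_mul]
      exact Nat.mul_le_mul_right _ (by omega)
    have hi : Function.Injective fun p : Fin n × Fin n => a ^ (p.1 : ℕ) * b * a ^ (p.2 : ℕ) := by
      rintro ⟨i, j⟩ ⟨i', j'⟩ h
      rcases le_total (i : ℕ) i' with hle | hle
      · obtain ⟨h₁, h₂⟩ := hinj _ _ _ _ h hle
        exact Prod.ext (Fin.ext h₁) (Fin.ext h₂)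
      · obtain ⟨h₁, h₂⟩ := hinj _ _ _ _ h.symm hle
        exact Prod.ext (Fin.ext h₁.symm) (Fin.ext h₂.symm)
    have := Set.ncard_le_ncard (Set.range_subset_iff.2 hsub) (finite_wordBall hS m)
    rwa [← Set.image_univ, Set.ncard_image_of_injective _ hi, Set.ncard_univ,
      Nat.card_eq_fintype_card, Fintype.card_prod, Fintype.card_fin] at this
  obtain ⟨D, hD⟩ := exists_nat_gt (C * (5 * ℓ) / η)
  rw [div_lt_iff₀ hη] at hD
  filter_upwards [eventually_ge_atTop ((2 * (D + 1) + 1) * ℓ)] with m hm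
  obtain ⟨n, hn, hmn⟩ : ∃ n, (2 * n + 1) * ℓ ≤ m ∧ m < (2 * n + 3) * ℓ ∧ D + 1 ≤ n := by
    have hℓ0 : 0 < 2 * ℓ := by omega
    have hmℓ : ℓ ≤ m := le_trans (Nat.le_mul_of_pos_left _ (by omega)) hm
    have e₁ := Nat.div_add_mod (m - ℓ) (2 * ℓ)
    have e₂ := Nat.mod_lt (m - ℓ) hℓ0
    refine ⟨(m - ℓ) / (2 * ℓ), ?_, ?_, ?_⟩
    · generalize (m - ℓ) / (2 * ℓ) = n at *
      have : (2 * n + 1) * ℓ = 2 * ℓ * n + ℓ := by ring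
      omega
    · generalize (m - ℓ) / (2 * ℓ) = n at *
      have : (2 * n + 3) * ℓ = 2 * ℓ * n + 3 * ℓ := by ring
      omega
    · rw [Nat.le_div_iff_mul_le hℓ0]
      have : (2 * (D + 1) + 1) * ℓ = (D + 1) * (2 * ℓ) + ℓ := by ring
      omega
  have hb₁ : ((n * n : ℕ) : ℝ) ≤ (wordBall S m).ncard := by exact_mod_cast hcard n m hn
  have hb₂ : m + 1 ≤ 5 * ℓ * n := by
    have : 3 * ℓ ≤ 3 * ℓ * n := Nat.le_mul_of_pos_right _ (by omega)
    have : (2 * n + 3) * ℓ = 2 * ℓ * n + 3 * ℓ := by ring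
    have : 5 * ℓ * n = 2 * ℓ * n + 3 * ℓ * n := by ring
    omega
  have hb₃ : ((m : ℝ) + 1) ≤ 5 * ℓ * n := by exact_mod_cast hb₂
  have hb₄ : (D : ℝ) ≤ n := by exact_mod_cast (by omega : D ≤ n)
  have hn0 : (0 : ℝ) ≤ n := by positivity
  calc (C * (m + 1) : ℝ) ≤ C * (5 * ℓ * n) := by gcongr
    _ = C * (5 * ℓ) * n := by ring
    _ ≤ (n * η) * n := by
      refine mul_le_mul_of_nonneg_right (hD.le.trans ?_) hn0
      gcongr
    _ = η * ((n * n : ℕ) : ℝ) := by push_cast; ring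
    _ ≤ _ := by gcongr

namespace HNNExtension

open NormalWord

variable {B : Type*} [Group B]

/-- If infinitely many powers of `U` are conjugate, by every element, to powers of `U`, then every
element of the extension of centralizers commensurates `⟨U⟩`. -/
theorem exists_semiconjBy_zpow {U : B}
    (h : ∀ b, ((Subgroup.zpowers U ⊓
      (Subgroup.zpowers U).map (MulAut.conj b).toMonoidHom : Subgroup B) : Set B).Infinite)
    (g : HNNExtension B (Subgroup.zpowers U) (Subgroup.zpowers U)
      (MulEquiv.refl (Subgroup.zpowers U))) :
    ∃ k l : ℤ, k ≠ 0 ∧ l ≠ 0 ∧ SemiconjBy g ((of U) ^ l) ((of U) ^ k) := by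
  induction g using HNNExtension.induction_on with
  | of b =>
    obtain ⟨f, ⟨hf, f', hf', hff'⟩, h1⟩ := (h b).exists_notMem_finite (Set.finite_singleton 1)
    obtain ⟨k, rfl⟩ := hf
    obtain ⟨l, rfl⟩ := hf'
    simp only [MulEquiv.coe_toMonoidHom, MulAut.conj_apply] at hff'
    simp only [Set.mem_singleton_iff] at h1
    refine ⟨k, l, ?_, ?_, ?_⟩
    · rintro rfl
      simp at h1
    · rintro rfl
      simp at hff'
      exact h1 hff'.symm
    · rw [SemiconjBy, ← map_zpow, ← map_zpow, ← map_mul, ← map_mul, ← hff']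
      simp
  | t =>
    exact ⟨1, 1, one_ne_zero, one_ne_zero,
      (Commute.zpow_right (commute_t_of U (Subgroup.mem_zpowers U)) 1)⟩
  | mul x y hx hy =>
    obtain ⟨k, l, hk, hl, h₁⟩ := hx
    obtain ⟨k', l', hk', hl', h₂⟩ := hy
    refine ⟨k * k', l' * l, mul_ne_zero hk hk', mul_ne_zero hl' hl, ?_⟩
    have h₃ := h₁.zpow_right k'
    have h₄ := h₂.zpow_right l
    rw [← zpow_mul, ← zpow_mul] at h₃ h₄
    rw [mul_comm k' l] at h₄
    exact h₃.mul_left h₄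
  | inv x hx =>
    obtain ⟨k, l, hk, hl, h₁⟩ := hx
    exact ⟨l, k, hl, hk, h₁.inv_symm_left⟩

theorem exists_markerSystem {U : B} (h : Infinite (B ⧸ Subgroup.normalClosure {U}))
    (d : TransversalPair B (Subgroup.zpowers U) (Subgroup.zpowers U))
    {S : Set (HNNExtension B (Subgroup.zpowers U) (Subgroup.zpowers U)
      (MulEquiv.refl (Subgroup.zpowers U)))} (hS : S.Finite) :
    ∃ M : MarkerSystem (stableLength (MulEquiv.refl (Subgroup.zpowers U)) d) (Fin 4),
      ∀ K, ∃ C : ℕ, ∀ m, {x ∈ wordBall S m | ¬ M.IsRich S K m x}.ncard ≤ C * (m + 1) := by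
  set N := Subgroup.normalClosure {U} with hN
  have hEN : Subgroup.zpowers U ≤ N := by
    rw [Subgroup.zpowers_le]
    exact Subgroup.subset_normalClosure rfl
  obtain ⟨q, hq⟩ : ∃ q : Fin 4 → B, ∀ i j, (q i)⁻¹ * q j ∈ N → i = j := by
    refine ⟨fun i => (Infinite.natEmbedding (B ⧸ N) i).out, fun i j hij => ?_⟩
    rw [← QuotientGroup.eq, QuotientGroup.out_eq', QuotientGroup.out_eq'] at hij
    exact Fin.ext ((Infinite.natEmbedding (B ⧸ N)).injective hij)
  by_cases hcase : ∃ b, ((Subgroup.zpowers U ⊓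
      (Subgroup.zpowers U).map (MulAut.conj b).toMonoidHom : Subgroup B) : Set B).Finite
  · obtain ⟨b, hb⟩ := hcase
    exact ⟨markerSystem d b N hEN q hq,
      (markerSystem d b N hEN q hq).exists_ncard_not_isRich_le_of_finite hS
        fun j => (hb.image _).image _⟩
  · push Not at hcase
    refine ⟨markerSystem d 1 N hEN q hq,
      (markerSystem d 1 N hEN q hq).exists_ncard_not_isRich_le_of_zpowers hS (u := of U)
        (fun g => ?_) fun j => ⟨of (q j), ?_⟩⟩
    · obtain ⟨k, l, hk, -, hg⟩ := exists_semiconjBy_zpow hcase g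
      exact hg.exists_finite_zpowers_mul_subset hk
    · rintro _ ⟨_, ⟨f, ⟨⟨n, rfl⟩, -⟩, rfl⟩, rfl⟩
      refine ⟨n, ?_⟩
      simp [mul_assoc]

end HNNExtension

theorem exists_notMem_zpowers {B : Type*} [Group B] {U : B}
    (h : Infinite (B ⧸ Subgroup.normalClosure {U})) : ∃ b, b ∉ Subgroup.zpowers U := by
  obtain ⟨x, y, hxy⟩ := exists_pair_ne (B ⧸ Subgroup.normalClosure {U})
  refine ⟨x.out⁻¹ * y.out, fun hb => hxy ?_⟩
  have := Subgroup.zpowers_le.2 (Subgroup.subset_normalClosure (Set.mem_singleton U)) hb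
  rwa [← QuotientGroup.eq, QuotientGroup.out_eq', QuotientGroup.out_eq'] at this

/-- Let `B` be a finitely generated group, `U` a nontrivial element of `B`, and let
`G = ⟨t, B ; rel(B), t⁻¹Ut = U⟩` be the rank one extension of centralizers of `B` over `U`,
i.e. the HNN extension of `B` with both associated subgroups equal to `⟨U⟩` and associated
isomorphism the identity. If `B` modulo the normal closure of `U` is infinite, then `G`
satisfies the strong generic free group property with respect to every finite generating
set. -/
theorem extensionOfCentralizers_hasStrongGenericFreeGroupProperty
    {B : Type*} [Group B] [Group.FG B] (U : B) (hU : U ≠ 1)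
    (h : Infinite (B ⧸ Subgroup.normalClosure {U})) :
    HasStrongGenericFreeGroupProperty
      (HNNExtension B (Subgroup.zpowers U) (Subgroup.zpowers U)
        (MulEquiv.refl (Subgroup.zpowers U))) := by
  intro S hS hgen
  obtain ⟨d⟩ := HNNExtension.NormalWord.TransversalPair.nonempty B (Subgroup.zpowers U)
    (Subgroup.zpowers U)
  obtain ⟨M, hM⟩ := HNNExtension.exists_markerSystem h d hS
  obtain ⟨b, hb⟩ := exists_notMem_zpowers h
  let f : HNNExtension B (Subgroup.zpowers U) (Subgroup.zpowers U)
      (MulEquiv.refl (Subgroup.zpowers U)) →* Multiplicative ℤ :=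
    HNNExtension.lift 1 (Multiplicative.ofAdd 1) fun _ => rfl
  have htt : (HNNExtension.stableLength (MulEquiv.refl (Subgroup.zpowers U)) d).len
      (HNNExtension.t * HNNExtension.t) = 2 := by
    have := HNNExtension.stableLength_len_t_mul_of_mul_t (φ := MulEquiv.refl _) d 1
    rwa [map_one, mul_one] at this
  have hcomm (k : ℕ) : ¬ Commute (HNNExtension.t ^ (k + 1)) (HNNExtension.of b) :=
    LyndonLength.not_commute_pow _ (HNNExtension.stableLength_len_t d) htt
      (HNNExtension.stableLength_len_of d b)
      (fun h => hb (HNNExtension.mem_of_stableLength_t_mul_of_mul_inv_t d h)) k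
  exact LyndonLength.strongGenericFreeGroupProperty _ hS (M.exists_len_forall_ncard_le hS hgen hM
    (eventually_le_ncard_wordBall hS hgen hcomm f (HNNExtension.lift_t _ _ _)
      (HNNExtension.lift_of _ _ _ b)))
end

section
/- Let G = A ∗ B be a nontrivial free product of finitely generated groups (i.e., both A and B are nontrivial). If at least one of the factors A, B has order greater than 2, then G satisfies the generic free group property with respect to every finite generating set of G. -/
open Filter Set

/-- A group has the generic free group property with respect to a generating set `S` if for
every `n ≥ 1` the proportion of `n`-tuples in the ball of radius `m` generating a free
subgroup tends to `1` as `m → ∞`. -/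
def GenericFreeGroupProperty {G : Type*} [Group G] (S : Set G) : Prop :=
  ∀ n : ℕ, 1 ≤ n →
    Filter.Tendsto
      (fun m : ℕ =>
        ({x : Fin n → G | (∀ i, x i ∈ wordBall S m) ∧
            IsFreeGroup (Subgroup.closure (Set.range x))}.ncard : ℝ) /
          ((wordBall S m).ncard : ℝ) ^ n)
      Filter.atTop (nhds 1)

namespace FreeProductGeneric

open Monoid

section NormalForm

variable {ι : Type*} {M : ι → Type*} [∀ i, Group (M i)]

/-- A list of syllables is reduced if its entries are nontrivial and neighbouring entries come
from different factors. -/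
def IsReduced (l : List (Σ i, M i)) : Prop :=
  (∀ x ∈ l, x.2 ≠ 1) ∧ l.IsChain fun x y => x.1 ≠ y.1

/-- The product in the free product of a list of syllables. -/
def evalList (l : List (Σ i, M i)) : CoprodI M :=
  (l.map fun x => CoprodI.of x.2).prod

open Classical in
/-- The normal form of an element of a free product. -/
noncomputable def nf (g : CoprodI M) : List (Σ i, M i) :=
  (CoprodI.Word.equiv g).toList

theorem isReduced_nf (g : CoprodI M) : IsReduced (nf g) := by
  classical exact ⟨(CoprodI.Word.equiv g).ne_one, (CoprodI.Word.equiv g).chain_ne⟩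

theorem evalList_nf (g : CoprodI M) : evalList (nf g) = g := by
  classical exact CoprodI.Word.equiv.symm_apply_apply g

theorem nf_evalList {l : List (Σ i, M i)} (hl : IsReduced l) : nf (evalList l) = l := by
  classical
  exact congrArg CoprodI.Word.toList (CoprodI.Word.equiv.apply_symm_apply ⟨l, hl.1, hl.2⟩)

theorem nf_injective : Function.Injective (nf : CoprodI M → _) := fun g h hgh => by
  rw [← evalList_nf g, hgh, evalList_nf]

theorem evalList_append (l l' : List (Σ i, M i)) :
    evalList (l ++ l') = evalList l * evalList l' := by
  simp [evalList]

@[simp]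
theorem nf_one : nf (1 : CoprodI M) = [] :=
  nf_evalList (l := []) ⟨by simp, by simp⟩

theorem nf_eq_nil {g : CoprodI M} : nf g = [] ↔ g = 1 :=
  ⟨fun h => nf_injective (h.trans nf_one.symm), fun h => h ▸ nf_one⟩

/-- The product `g * h` is reduced as written: the last syllable of `g` and the first syllable of
`h` come from different factors. -/
def Compatible (g h : CoprodI M) : Prop :=
  ∀ x ∈ (nf g).getLast?, ∀ y ∈ (nf h).head?, x.1 ≠ y.1

theorem nf_mul {g h : CoprodI M} (H : Compatible g h) : nf (g * h) = nf g ++ nf h := by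
  have : IsReduced (nf g ++ nf h) := by
    refine ⟨fun x hx => ?_, List.isChain_append.2 ⟨(isReduced_nf g).2, (isReduced_nf h).2, H⟩⟩
    rcases List.mem_append.1 hx with hx | hx
    exacts [(isReduced_nf g).1 x hx, (isReduced_nf h).1 x hx]
  rw [← nf_evalList this, evalList_append, evalList_nf, evalList_nf]

theorem exists_mul_of_nf_eq_append {x : CoprodI M} {l l' : List (Σ i, M i)}
    (hx : nf x = l ++ l') :
    ∃ p q, nf p = l ∧ nf q = l' ∧ p * q = x ∧ Compatible p q := by
  obtain ⟨h1, h2⟩ := hx ▸ isReduced_nf x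
  obtain ⟨hc, hc', hcc⟩ := List.isChain_append.1 h2
  have hp : nf (evalList l) = l := nf_evalList ⟨fun y hy => h1 y (by simp [hy]), hc⟩
  have hq : nf (evalList l') = l' := nf_evalList ⟨fun y hy => h1 y (by simp [hy]), hc'⟩
  refine ⟨_, _, hp, hq, ?_, ?_⟩
  · rw [← evalList_append, ← hx, evalList_nf]
  · unfold Compatible
    rw [hp, hq]
    exact hcc

theorem nf_inv (g : CoprodI M) :
    nf g⁻¹ = ((nf g).map fun x => (⟨x.1, x.2⁻¹⟩ : Σ i, M i)).reverse := by
  have hr : IsReduced ((nf g).map fun x => (⟨x.1, x.2⁻¹⟩ : Σ i, M i)).reverse := by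
    refine ⟨?_, ?_⟩
    · intro x hx
      obtain ⟨y, hy, rfl⟩ := List.mem_map.1 (List.mem_reverse.1 hx)
      simpa using (isReduced_nf g).1 y hy
    · rw [List.isChain_reverse, List.isChain_map]
      exact (isReduced_nf g).2.imp fun _ _ h => h.symm
  have he : evalList ((nf g).map fun x => (⟨x.1, x.2⁻¹⟩ : Σ i, M i)).reverse = g⁻¹ := by
    conv_rhs => rw [← evalList_nf g]
    simp [evalList, List.prod_inv_reverse, Function.comp_def]
  rw [← he, nf_evalList hr]

theorem length_nf_inv (g : CoprodI M) : (nf g⁻¹).length = (nf g).length := by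
  simp [nf_inv]

theorem Compatible.inv {g h : CoprodI M} (H : Compatible g h) : Compatible h⁻¹ g⁻¹ := by
  intro x hx y hy
  simp only [nf_inv, List.getLast?_reverse, List.head?_reverse, List.head?_map,
    List.getLast?_map, Option.mem_def, Option.map_eq_some_iff] at hx hy
  obtain ⟨a, ha, rfl⟩ := hx
  obtain ⟨b, hb, rfl⟩ := hy
  exact (H b hb a ha).symm

theorem compatible_of_prefix {p q q' : CoprodI M} (hq : nf q ≠ [])
    (h : nf q <+: nf q') : Compatible p q' ↔ Compatible p q := by
  obtain ⟨t, ht⟩ := h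
  unfold Compatible
  rw [← ht, List.head?_append_of_ne_nil _ hq]

theorem nf_of {i : ι} {a : M i} (ha : a ≠ 1) : nf (CoprodI.of a) = [⟨i, a⟩] := by
  have : IsReduced [(⟨i, a⟩ : Σ i, M i)] := ⟨by simpa using ha, by simp⟩
  simpa [evalList] using nf_evalList this

/-- If `x` does not start with `p ≠ 1`, then the syllables of `p` are not cancelled completely in
`p⁻¹ * x`, which therefore starts in the factor in which `p` ends. -/
theorem head_inv_mul_of_not_prefix {p x : CoprodI M} (hp : nf p ≠ [])
    (hx : ¬ nf p <+: nf x) :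
    ∃ y ∈ (nf (p⁻¹ * x)).head?, ∃ z ∈ (nf p).getLast?, y.1 = z.1 := by
  induction hn : (nf p).length generalizing p x with
  | zero => simp_all
  | succ n ih =>
    obtain ⟨⟨i, a⟩, l, hl⟩ := List.exists_cons_of_ne_nil hp
    obtain ⟨s, p', hs, hp', rfl, hc⟩ :=
      exists_mul_of_nf_eq_append (x := p) (l := [⟨i, a⟩]) (l' := l) (by simpa using hl)
    have ha : a ≠ 1 := (isReduced_nf s).1 ⟨i, a⟩ (by simp [hs])
    have hsa : s = CoprodI.of a := nf_injective (by rw [hs, nf_of ha])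
    have hinv : nf s⁻¹ = [⟨i, a⁻¹⟩] := by simp [nf_inv, hs]
    by_cases hl0 : l = []
    · subst hl0
      obtain rfl : p' = 1 := nf_eq_nil.1 hp'
      rw [mul_one] at *
      rw [hs]
      by_cases hcx : Compatible s⁻¹ x
      · rw [nf_mul hcx, hinv]
        simp
      · unfold Compatible at hcx
        rw [hinv] at hcx
        simp only [List.getLast?_singleton, Option.mem_def, Option.some.injEq, forall_eq',
          not_forall, not_not, exists_prop] at hcx
        obtain ⟨⟨j, b⟩, hb, hij⟩ := hcx
        dsimp at hij
        subst hij
        obtain ⟨r, hr⟩ : ∃ r, nf x = [⟨i, b⟩] ++ r := by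
          cases hxx : nf x <;> simp_all
        obtain ⟨t, x', ht, hx', rfl, hc'⟩ := exists_mul_of_nf_eq_append hr
        have hb1 : b ≠ 1 := (isReduced_nf t).1 ⟨i, b⟩ (by simp [ht])
        have htb : t = CoprodI.of b := nf_injective (by rw [ht, nf_of hb1])
        have hab : a⁻¹ * b ≠ 1 := by
          intro h
          apply hx
          rw [hs, hr, inv_mul_eq_one.1 h]
          simp
        have hcc : Compatible (CoprodI.of (a⁻¹ * b)) x' := by
          unfold Compatible at hc' ⊢
          rw [nf_of hab]
          rw [ht] at hc'
          simpa using hc'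
        have : s⁻¹ * (t * x') = CoprodI.of (a⁻¹ * b) * x' := by
          rw [hsa, htb, map_mul, map_inv, mul_assoc]
        rw [this, nf_mul hcc, nf_of hab]
        simp
    · have hnp : ¬ nf p' <+: nf (s⁻¹ * x) := by
        intro hpre
        apply hx
        have hc2 : Compatible s (s⁻¹ * x) :=
          (compatible_of_prefix (by rwa [hp']) hpre).2 hc
        have := nf_mul hc2
        rw [mul_inv_cancel_left] at this
        rw [this, nf_mul hc, List.prefix_append_right_inj]
        exact hpre
      have := ih (p := p') (x := s⁻¹ * x) (by rwa [hp']) hnp (by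
        rw [hl] at hn; simpa [hp'] using hn)
      rw [nf_mul hc, mul_inv_rev, mul_assoc]
      rwa [List.getLast?_append_of_ne_nil _ (by rwa [hp'])]

/-- If `x` does not start with `p`, then anything that can be followed by `p⁻¹` can be followed by
`p⁻¹ * x`. -/
theorem compatible_inv_mul {p r x : CoprodI M} (hp : nf p ≠ []) (hx : ¬ nf p <+: nf x)
    (hr : Compatible r p⁻¹) : Compatible r (p⁻¹ * x) := by
  obtain ⟨y, hy, z, hz, hyz⟩ := head_inv_mul_of_not_prefix hp hx
  intro a ha b hb
  obtain rfl : y = b := Option.mem_unique hy hb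
  rw [hyz]
  refine hr a ha ⟨z.1, z.2⁻¹⟩ ?_
  simp only [nf_inv, List.head?_reverse, List.getLast?_map, Option.mem_def,
    Option.map_eq_some_iff]
  exact ⟨z, hz, rfl⟩

/-- The element spelled by the first `k` syllables of the normal form of `g`. -/
noncomputable def pre (k : ℕ) (g : CoprodI M) : CoprodI M :=
  evalList ((nf g).take k)

theorem nf_pre (k : ℕ) (g : CoprodI M) : nf (pre k g) = (nf g).take k :=
  nf_evalList ⟨fun x hx => (isReduced_nf g).1 x (List.mem_of_mem_take hx),
    (isReduced_nf g).2.take k⟩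

theorem pre_eq_iff {k : ℕ} {g h : CoprodI M} : pre k g = h ↔ (nf g).take k = nf h := by
  rw [← nf_injective.eq_iff, nf_pre]

theorem pre_mul {k : ℕ} {p q : CoprodI M} (H : Compatible p q) (hk : k ≤ (nf p).length) :
    pre k (p * q) = pre k p := by
  rw [pre_eq_iff, nf_mul H, nf_pre, List.take_append_of_le_length hk]

theorem pre_of_length_le {k : ℕ} {p : CoprodI M} (hk : (nf p).length ≤ k) : pre k p = p := by
  rw [pre_eq_iff, List.take_of_length_le hk]

theorem pre_mul_of_length_eq {k : ℕ} {p q : CoprodI M} (H : Compatible p q)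
    (hk : (nf p).length = k) : pre k (p * q) = p := by
  rw [pre_mul H hk.ge, pre_of_length_le hk.le]

theorem exists_pre_mul (k : ℕ) (g : CoprodI M) :
    ∃ q, pre k g * q = g ∧ Compatible (pre k g) q := by
  obtain ⟨p, q, hp, -, h, hc⟩ :=
    exists_mul_of_nf_eq_append (x := g) (List.take_append_drop k (nf g)).symm
  obtain rfl : pre k g = p := pre_eq_iff.2 hp.symm
  exact ⟨q, h, hc⟩

/-- The suffix of `g` with `k` syllables is the inverse of the prefix of `g⁻¹`. -/
theorem exists_mul_pre_inv (k : ℕ) (g : CoprodI M) :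
    ∃ r, r * (pre k g⁻¹)⁻¹ = g ∧ Compatible r (pre k g⁻¹)⁻¹ := by
  obtain ⟨q, hq, hc⟩ := exists_pre_mul k g⁻¹
  refine ⟨q⁻¹, ?_, hc.inv⟩
  rw [← mul_inv_rev, hq, inv_inv]

theorem length_nf_of_mul_pre_inv {k : ℕ} {g r : CoprodI M}
    (hr : r * (pre k g⁻¹)⁻¹ = g) (hc : Compatible r (pre k g⁻¹)⁻¹) (hk : 2 * k ≤ (nf g).length) :
    k ≤ (nf r).length := by
  have h1 := congrArg (fun x => (nf x).length) hr
  have h2 : (nf (pre k g⁻¹)⁻¹).length = k := by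
    rw [length_nf_inv, nf_pre, List.length_take, length_nf_inv]
    omega
  simp only [nf_mul hc, List.length_append, h2] at h1
  omega

theorem length_nf_pre {k : ℕ} {g : CoprodI M} (hk : k ≤ (nf g).length) :
    (nf (pre k g)).length = k := by
  rw [nf_pre, List.length_take, min_eq_left hk]

/-- The basic ping-pong step. -/
theorem pre_mul_of_pre_ne {k : ℕ} (hk : 1 ≤ k) {g x : CoprodI M} (hg : 2 * k ≤ (nf g).length)
    (hx : pre k x ≠ pre k g⁻¹) : pre k (g * x) = pre k g := by
  obtain ⟨r, hr, hc⟩ := exists_mul_pre_inv k g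
  have hkr := length_nf_of_mul_pre_inv hr hc hg
  have hlen : (nf (pre k g⁻¹)).length = k := length_nf_pre (by rw [length_nf_inv]; omega)
  have hnp : ¬ nf (pre k g⁻¹) <+: nf x := by
    intro h
    rw [List.prefix_iff_eq_take, hlen] at h
    exact hx (pre_eq_iff.2 h.symm)
  have hne : nf (pre k g⁻¹) ≠ [] := by
    rw [← List.length_pos_iff_ne_nil]
    omega
  have hc' := compatible_inv_mul hne hnp hc
  calc pre k (g * x) = pre k (r * ((pre k g⁻¹)⁻¹ * x)) := by rw [← mul_assoc, hr]
    _ = pre k r := pre_mul hc' hkr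
    _ = pre k (r * (pre k g⁻¹)⁻¹) := (pre_mul hc hkr).symm
    _ = pre k g := by rw [hr]

/-- The element `g` plays ping-pong with its prefixes of length `k`. -/
def IsPlayer (k : ℕ) (g : CoprodI M) : Prop :=
  2 * k ≤ (nf g).length ∧ pre k g ≠ pre k g⁻¹

/-- The prefixes of `g` and `g⁻¹` are different from those of `h` and `h⁻¹`. -/
def Separated (k : ℕ) (g h : CoprodI M) : Prop :=
  pre k g ≠ pre k h ∧ pre k g ≠ pre k h⁻¹ ∧ pre k g⁻¹ ≠ pre k h ∧ pre k g⁻¹ ≠ pre k h⁻¹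

theorem IsPlayer.pre_pow {k : ℕ} (hk : 1 ≤ k) {g : CoprodI M} (hg : IsPlayer k g) (n : ℕ) :
    pre k (g ^ (n + 1)) = pre k g := by
  induction n with
  | zero => simp
  | succ n ih =>
    rw [pow_succ']
    exact pre_mul_of_pre_ne hk hg.1 (ih ▸ hg.2)

theorem IsPlayer.zpow_ne_one {k : ℕ} (hk : 1 ≤ k) {g : CoprodI M} (hg : IsPlayer k g) {z : ℤ}
    (hz : z ≠ 0) : g ^ z ≠ 1 := by
  intro h
  have h1 : g ^ z.natAbs = 1 := by
    rcases Int.natAbs_eq z with hz' | hz'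
    · rwa [hz', zpow_natCast] at h
    · rwa [hz', zpow_neg, inv_eq_one, zpow_natCast] at h
  obtain ⟨n, hn⟩ := Nat.exists_eq_succ_of_ne_zero (Int.natAbs_ne_zero.2 hz)
  rw [hn] at h1
  have h2 := hg.pre_pow hk n
  rw [h1, pre_of_length_le (by simp)] at h2
  have h3 : (nf (pre k g)).length = k := length_nf_pre (by have := hg.1; omega)
  rw [← h2] at h3
  simp at h3
  omega

open scoped Pointwise in
theorem isFreeBasisTuple_of_separated {k n : ℕ} (hk : 1 ≤ k) {x : Fin n → CoprodI M}
    (hn : 1 ≤ n) (hx : ∀ i, IsPlayer k (x i)) (hs : ∀ i j, i ≠ j → Separated k (x i) (x j)) :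
    IsFreeBasisTuple x := by
  rcases hn.eq_or_lt with rfl | hn
  · refine (injective_iff_map_eq_one _).2 fun w hw => ?_
    have hw' : w ∈ Subgroup.zpowers (FreeGroup.of (0 : Fin 1)) := by
      have : Set.range (FreeGroup.of : Fin 1 → _) = {FreeGroup.of 0} := by
        ext; simp [Fin.exists_fin_one, eq_comm]
      rw [Subgroup.zpowers_eq_closure, ← this, FreeGroup.closure_range_of]
      trivial
    obtain ⟨z, rfl⟩ := Subgroup.mem_zpowers_iff.1 hw'
    rw [map_zpow, FreeGroup.lift_apply_of] at hw
    by_contra hz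
    exact (hx 0).zpow_ne_one hk (fun h => hz (by simp [h])) hw
  · have : Nontrivial (Fin n) := Fin.nontrivial_iff_two_le.2 hn
    have key : Function.Injective (FreeGroup.lift fun i : ULift (Fin n) => x i.down) := by
      refine FreeGroup.injective_lift_of_ping_pong (fun i : ULift (Fin n) => x i.down)
        (fun i => {y | pre k y = pre k (x i.down)}) (fun i => {y | pre k y = pre k (x i.down)⁻¹})
        (fun i => ⟨x i.down, rfl⟩) ?_ ?_ ?_ ?_ ?_
      · intro i j hij
        exact Set.disjoint_left.2 fun y hy hy' =>
          (hs i.down j.down (ULift.down_injective.ne hij)).1 (hy.symm.trans hy')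
      · intro i j hij
        exact Set.disjoint_left.2 fun y hy hy' =>
          (hs i.down j.down (ULift.down_injective.ne hij)).2.2.2 (hy.symm.trans hy')
      · intro i j
        refine Set.disjoint_left.2 fun y hy hy' => ?_
        rcases eq_or_ne i.down j.down with hij | hij
        · exact (hx i.down).2 (hy.symm.trans (hij ▸ hy'))
        · exact (hs i.down j.down hij).2.1 (hy.symm.trans hy')
      · rintro i _ ⟨y, hy, rfl⟩
        exact pre_mul_of_pre_ne hk (hx i.down).1 hy
      · rintro i _ ⟨y, hy, rfl⟩
        refine pre_mul_of_pre_ne hk (g := (x i.down)⁻¹) ?_ ?_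
        · rw [length_nf_inv]; exact (hx i.down).1
        · rwa [inv_inv]
    have hcomp : FreeGroup.lift x = (FreeGroup.lift fun i : ULift (Fin n) => x i.down).comp
        (FreeGroup.map ULift.up) := by
      ext i
      simp
    unfold IsFreeBasisTuple
    rw [hcomp, MonoidHom.coe_comp]
    exact key.comp (FreeGroup.map_injective ULift.up_injective)

theorem isFreeGroup_closure_range {G : Type*} [Group G] {n : ℕ} {x : Fin n → G}
    (hx : IsFreeBasisTuple x) : IsFreeGroup (Subgroup.closure (Set.range x)) := by
  rw [← FreeGroup.range_lift_eq_closure]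
  exact IsFreeGroup.ofMulEquiv (MonoidHom.ofInjective hx)

end NormalForm

section WordBall

variable {G : Type*} [Group G] {S : Set G}

theorem wordBall_mono {m n : ℕ} (h : m ≤ n) : wordBall S m ⊆ wordBall S n :=
  fun _ ⟨l, hl, hs, hp⟩ => ⟨l, hl.trans h, hs, hp⟩

theorem one_mem_wordBall (m : ℕ) : (1 : G) ∈ wordBall S m :=
  ⟨[], by simp, by simp, rfl⟩

theorem mul_mem_wordBall {m n : ℕ} {g h : G} (hg : g ∈ wordBall S m) (hh : h ∈ wordBall S n) :
    g * h ∈ wordBall S (m + n) := by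
  obtain ⟨l, hl, hs, rfl⟩ := hg
  obtain ⟨l', hl', hs', rfl⟩ := hh
  refine ⟨l ++ l', ?_, ?_, List.prod_append⟩
  · rw [List.length_append]
    omega
  · intro x hx
    rcases List.mem_append.1 hx with hx | hx
    exacts [hs x hx, hs' x hx]

theorem inv_mem_wordBall {m : ℕ} {g : G} (hg : g ∈ wordBall S m) : g⁻¹ ∈ wordBall S m := by
  obtain ⟨l, hl, hs, rfl⟩ := hg
  refine ⟨(l.map (·⁻¹)).reverse, by simpa using hl, ?_, (List.prod_inv_reverse l).symm⟩
  intro x hx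
  obtain ⟨y, hy, rfl⟩ := List.mem_map.1 (List.mem_reverse.1 hx)
  rw [inv_inv]
  exact (hs y hy).symm

theorem mem_wordBall_one {s : G} (hs : s ∈ S ∨ s⁻¹ ∈ S) : s ∈ wordBall S 1 :=
  ⟨[s], by simp, by simpa using hs, by simp⟩

theorem wordBall_succ_subset (m : ℕ) :
    wordBall S (m + 1) ⊆ Set.image2 (· * ·) (insert 1 (S ∪ S⁻¹)) (wordBall S m) := by
  rintro _ ⟨l, hl, hs, rfl⟩
  cases l with
  | nil => exact ⟨1, by simp, 1, one_mem_wordBall m, by simp⟩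
  | cons a l =>
    refine ⟨a, Or.inr (hs a (by simp)), l.prod, 
      ⟨l, by simpa using hl, fun x hx => hs x (by simp [hx]), rfl⟩, by simp⟩

theorem finite_wordBall (hS : S.Finite) (m : ℕ) : (wordBall S m).Finite := by
  induction m with
  | zero =>
    refine (Set.finite_singleton (1 : G)).subset ?_
    rintro _ ⟨l, hl, -, rfl⟩
    simp [List.length_eq_zero_iff.1 (Nat.le_zero.1 hl)]
  | succ m ih =>
    exact (Set.Finite.image2 _ ((hS.union hS.inv).insert 1) ih).subset (wordBall_succ_subset m)

theorem ncard_wordBall_pos (hS : S.Finite) (m : ℕ) : 0 < (wordBall S m).ncard :=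
  (Set.ncard_pos (finite_wordBall hS m)).2 ⟨1, one_mem_wordBall m⟩

theorem ncard_wordBall_mono (hS : S.Finite) {m n : ℕ} (h : m ≤ n) :
    (wordBall S m).ncard ≤ (wordBall S n).ncard :=
  Set.ncard_le_ncard (wordBall_mono h) (finite_wordBall hS n)

theorem ncard_wordBall_add_le (hS : S.Finite) (m n : ℕ) :
    (wordBall S (m + n)).ncard ≤ (wordBall S m).ncard * (wordBall S n).ncard := by
  have hsub : wordBall S (m + n) ⊆
      (fun z : G × G => z.1 * z.2) '' (wordBall S m ×ˢ wordBall S n) := by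
    rintro _ ⟨l, hl, hs, rfl⟩
    refine ⟨((l.take m).prod, (l.drop m).prod), ⟨⟨l.take m, ?_, ?_, rfl⟩, l.drop m, ?_, ?_, rfl⟩,
      List.prod_take_mul_prod_drop l m⟩
    · exact List.length_take_le m l
    · exact fun x hx => hs x (List.mem_of_mem_take hx)
    · rw [List.length_drop]
      omega
    · exact fun x hx => hs x (List.mem_of_mem_drop hx)
  have hfin := (finite_wordBall hS m).prod (finite_wordBall hS n)
  calc (wordBall S (m + n)).ncard ≤ _ := Set.ncard_le_ncard hsub (hfin.image _)
    _ ≤ (wordBall S m ×ˢ wordBall S n).ncard := Set.ncard_image_le hfin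
    _ = _ := Set.ncard_prod

theorem exists_mem_wordBall (hgen : Subgroup.closure S = ⊤) (g : G) :
    ∃ m, g ∈ wordBall S m := by
  have hg : g ∈ Subgroup.closure S := hgen ▸ Subgroup.mem_top g
  induction hg using Subgroup.closure_induction with
  | mem x hx => exact ⟨1, mem_wordBall_one (Or.inl hx)⟩
  | one => exact ⟨0, one_mem_wordBall 0⟩
  | mul x y _ _ hx hy =>
    obtain ⟨m, hm⟩ := hx
    obtain ⟨n, hn⟩ := hy
    exact ⟨m + n, mul_mem_wordBall hm hn⟩
  | inv x _ hx =>
    obtain ⟨m, hm⟩ := hx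
    exact ⟨m, inv_mem_wordBall hm⟩

/-- The word length of an element. -/
noncomputable def wordLength (S : Set G) (g : G) : ℕ :=
  sInf {m | g ∈ wordBall S m}

theorem mem_wordBall_wordLength (hgen : Subgroup.closure S = ⊤) (g : G) :
    g ∈ wordBall S (wordLength S g) :=
  Nat.sInf_mem (s := {m | g ∈ wordBall S m}) (exists_mem_wordBall hgen g)

theorem wordLength_le {g : G} {m : ℕ} (h : g ∈ wordBall S m) : wordLength S g ≤ m :=
  Nat.sInf_le h

theorem exists_subset_wordBall (hgen : Subgroup.closure S = ⊤) {T : Set G} (hT : T.Finite) :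
    ∃ c, T ⊆ wordBall S c := by
  obtain ⟨c, hc⟩ := (hT.image (wordLength S)).bddAbove
  exact ⟨c, fun t ht => wordBall_mono (hc ⟨t, ht, rfl⟩) (mem_wordBall_wordLength hgen t)⟩

/-- A path from outside a set to inside the set crosses its boundary. -/
theorem exists_crossing (P : G → Prop) (l : List G) (v : G) (h0 : ¬ P v) (h1 : P (v * l.prod)) :
    ∃ l₁ s l₂, l = l₁ ++ s :: l₂ ∧ ¬ P (v * l₁.prod) ∧ P (v * l₁.prod * s) := by
  induction l generalizing v with
  | nil => simp_all
  | cons a l ih =>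
    by_cases ha : P (v * a)
    · exact ⟨[], a, l, rfl, by simpa using h0, by simpa using ha⟩
    · obtain ⟨l₁, s, l₂, rfl, h2, h3⟩ := ih (v * a) ha (by simpa [mul_assoc] using h1)
      exact ⟨a :: l₁, s, l₂, rfl, by simpa [mul_assoc] using h2, by simpa [mul_assoc] using h3⟩

end WordBall

section Counting

variable {ι : Type*} {M : ι → Type*} [∀ i, Group (M i)] {S : Set (CoprodI M)}

/-- Word length is additive on reduced products, up to a bounded error. -/
theorem exists_almost_additive (hS : S.Finite) (hgen : Subgroup.closure S = ⊤) :
    ∃ C, ∀ (p q : CoprodI M) (m : ℕ), Compatible p q → p * q ∈ wordBall S m →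
      ∃ i j, i + j ≤ m + C ∧ p ∈ wordBall S i ∧ q ∈ wordBall S j := by
  have hT : (⋃ s ∈ S ∪ S⁻¹, (fun k => pre k s) '' Set.Iic (nf s).length).Finite :=
    (hS.union hS.inv).biUnion fun s _ => (Set.finite_Iic _).image _
  obtain ⟨c, hc⟩ := exists_subset_wordBall hgen hT
  refine ⟨2 * c, fun p q m hpq hm => ?_⟩
  by_cases hp : nf p = []
  · obtain rfl := nf_eq_nil.1 hp
    exact ⟨0, m, by omega, one_mem_wordBall 0, by simpa using hm⟩
  obtain ⟨l, hl, hls, hprod⟩ := hm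
  obtain ⟨l₁, s, l₂, rfl, hv, hvs⟩ := exists_crossing (fun v => nf p <+: nf v) l 1
    (by simpa using hp) (by simp [hprod, nf_mul hpq])
  rw [one_mul] at hv hvs
  set v := l₁.prod
  obtain ⟨t, ht⟩ := hvs
  obtain ⟨p', y, hp', -, hvy, hcy⟩ := exists_mul_of_nf_eq_append ht.symm
  obtain rfl := nf_injective hp'
  have hsS : s ∈ S ∨ s⁻¹ ∈ S := hls s (by simp)
  have hcomp : Compatible (v⁻¹ * p') y := by
    obtain ⟨a, ha, b, hb, hab⟩ := head_inv_mul_of_not_prefix hp hv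
    rw [show v⁻¹ * p' = (p'⁻¹ * v)⁻¹ by simp]
    intro x hx z hz
    simp only [nf_inv (p'⁻¹ * v), List.getLast?_reverse, List.head?_map, Option.mem_def,
      Option.map_eq_some_iff] at hx
    obtain ⟨a', ha', rfl⟩ := hx
    obtain rfl := Option.mem_unique ha ha'
    rw [show a.1 = b.1 from hab]
    exact hcy b hb z hz
  have hs : s = v⁻¹ * p' * y := by
    rw [mul_assoc, hvy, inv_mul_cancel_left]
  have hx : v⁻¹ * p' ∈ wordBall S c := by
    refine hc (Set.mem_biUnion (x := s) hsS ⟨(nf (v⁻¹ * p')).length, ?_, ?_⟩)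
    · rw [Set.mem_Iic, hs, nf_mul hcomp]
      simp
    · dsimp only
      rw [hs]
      exact pre_mul_of_length_eq hcomp rfl
  have hvm : v ∈ wordBall S l₁.length := ⟨l₁, le_rfl, fun x hx => hls x (by simp [hx]), rfl⟩
  have hl₂ : l₂.prod ∈ wordBall S l₂.length :=
    ⟨l₂, le_rfl, fun x hx => hls x (by simp [hx]), rfl⟩
  refine ⟨l₁.length + c, c + (1 + l₂.length), ?_, ?_, ?_⟩
  · simp only [List.length_append, List.length_cons] at hl
    omega
  · have := mul_mem_wordBall hvm hx
    rwa [mul_inv_cancel_left] at this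
  · have := mul_mem_wordBall (inv_mem_wordBall hx)
      (mul_mem_wordBall (mem_wordBall_one hsS) hl₂)
    convert this using 1
    rw [List.prod_append, List.prod_cons] at hprod
    rw [mul_inv_rev, inv_inv, mul_assoc, hprod, inv_mul_cancel_left]

theorem exists_padding [Finite ι] [Nontrivial ι] [∀ i, Nontrivial (M i)]
    (hgen : Subgroup.closure S = ⊤) :
    ∃ c, ∀ p : CoprodI M, ∃ y ∈ wordBall S c, ∀ h, Compatible p h ∨ Compatible p (y * h) := by
  choose σ hσ using fun i : ι => exists_ne i
  choose a ha using fun i : ι => exists_ne (1 : M i)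
  obtain ⟨c, hc⟩ := exists_subset_wordBall hgen
    (Set.finite_range fun i => (CoprodI.of (a (σ i)) : CoprodI M))
  refine ⟨c, fun p => ?_⟩
  rcases hp : (nf p).getLast? with _ | x
  · exact ⟨1, one_mem_wordBall c, fun h => Or.inl (by simp [Compatible, hp])⟩
  · refine ⟨_, hc ⟨x.1, rfl⟩, fun h => or_iff_not_imp_left.2 fun hnc => ?_⟩
    simp only [Compatible, hp, Option.mem_def, Option.some.injEq, forall_eq', not_forall,
      not_not, exists_prop] at hnc
    obtain ⟨z, hz, hxz⟩ := hnc
    have hcomp : Compatible (CoprodI.of (a (σ x.1))) h := by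
      simpa [Compatible, nf_of (ha _), hz, ← hxz] using hσ x.1
    simpa [Compatible, hp, nf_mul hcomp, nf_of (ha _)] using (hσ x.1).symm

theorem ncard_wordBall_le_two_mul (hS : S.Finite) {c m : ℕ} {p y : CoprodI M}
    (hy : y ∈ wordBall S c) (hpy : ∀ h, Compatible p h ∨ Compatible p (y * h)) :
    (wordBall S m).ncard ≤ 2 * {h ∈ wordBall S (m + c) | Compatible p h}.ncard := by
  set H := {h ∈ wordBall S (m + c) | Compatible p h}
  have hH : H.Finite := (finite_wordBall hS (m + c)).subset (Set.sep_subset _ _)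
  have hsub : wordBall S m ⊆ H ∪ (fun h => y⁻¹ * h) '' H := by
    intro h hh
    rcases hpy h with hc | hc
    · exact Or.inl ⟨wordBall_mono (by omega) hh, hc⟩
    · refine Or.inr ⟨y * h, ⟨?_, hc⟩, by simp⟩
      rw [add_comm]
      exact mul_mem_wordBall hy hh
  calc (wordBall S m).ncard ≤ _ := Set.ncard_le_ncard hsub (hH.union (hH.image _))
    _ ≤ H.ncard + ((fun h => y⁻¹ * h) '' H).ncard := Set.ncard_union_le _ _
    _ ≤ H.ncard + H.ncard := Nat.add_le_add_left (Set.ncard_image_le hH) _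
    _ = 2 * H.ncard := by ring

theorem sum_ncard_compatible_le (hS : S.Finite) (hgen : Subgroup.closure S = ⊤) {K m : ℕ}
    (P : Finset (CoprodI M)) (hP : ∀ p ∈ P, (nf p).length = K ∧ wordLength S p ≤ m) :
    ∑ p ∈ P, {h ∈ wordBall S (m - wordLength S p) | Compatible p h}.ncard ≤
      (wordBall S m).ncard := by
  have hH (p : CoprodI M) : {h ∈ wordBall S (m - wordLength S p) | Compatible p h}.Finite :=
    (finite_wordBall hS _).subset (Set.sep_subset _ _)
  simp only [Set.ncard_eq_toFinset_card _ (hH _),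
    Set.ncard_eq_toFinset_card _ (finite_wordBall hS m)]
  rw [← Finset.card_sigma]
  refine Finset.card_le_card_of_injOn (fun z => z.1 * z.2) ?_ ?_
  · rintro ⟨p, h⟩ hz
    simp only [Finset.coe_sigma, Set.mem_sigma_iff, Finset.mem_coe, Set.Finite.coe_toFinset] at hz
    rw [Finset.mem_coe, Set.Finite.mem_toFinset]
    have := mul_mem_wordBall (mem_wordBall_wordLength hgen p) hz.2.1
    rwa [Nat.add_sub_cancel' (hP p hz.1).2] at this
  · rintro ⟨p, h⟩ hz ⟨p', h'⟩ hz' heq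
    simp only [Finset.coe_sigma, Set.mem_sigma_iff, Finset.mem_coe,
      Set.Finite.coe_toFinset] at hz hz' heq
    have h1 := pre_mul_of_length_eq hz.2.2 (hP p hz.1).1
    have h2 := pre_mul_of_length_eq hz'.2.2 (hP p' hz'.1).1
    obtain rfl : p = p' := by rw [← h1, heq, h2]
    rw [mul_left_cancel heq]

/-- Coarse supermultiplicativity of the growth function: reduced products of distinct elements with
`K` syllables and arbitrary elements are essentially distinct. -/
theorem exists_sum_ncard_le [Finite ι] [Nontrivial ι] [∀ i, Nontrivial (M i)]
    (hS : S.Finite) (hgen : Subgroup.closure S = ⊤) :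
    ∃ c, ∀ (K m : ℕ) (P : Finset (CoprodI M)),
      (∀ p ∈ P, (nf p).length = K ∧ wordLength S p + c ≤ m) →
      ∑ p ∈ P, (wordBall S (m - (wordLength S p + c))).ncard ≤ 2 * (wordBall S m).ncard := by
  obtain ⟨c, hc⟩ := exists_padding (M := M) hgen
  refine ⟨c, fun K m P hP => ?_⟩
  calc ∑ p ∈ P, (wordBall S (m - (wordLength S p + c))).ncard
      ≤ ∑ p ∈ P, 2 * {h ∈ wordBall S (m - wordLength S p) | Compatible p h}.ncard := by
        refine Finset.sum_le_sum fun p hp => ?_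
        obtain ⟨y, hy, hpy⟩ := hc p
        have := ncard_wordBall_le_two_mul hS (m := m - (wordLength S p + c)) hy hpy
        rwa [show m - (wordLength S p + c) + c = m - wordLength S p by
          have := (hP p hp).2; omega] at this
    _ ≤ 2 * (wordBall S m).ncard := by
        rw [← Finset.mul_sum]
        gcongr
        exact sum_ncard_compatible_le hS hgen P fun p hp =>
          ⟨(hP p hp).1, by have := (hP p hp).2; omega⟩

/-- The free product has arbitrarily many elements with a common number of syllables. -/
theorem exists_finset_card_ge [Nontrivial ι] [∀ i, Nontrivial (M i)]
    {i : ι} (hi : 2 < Cardinal.mk (M i)) (N : ℕ) :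
    ∃ K, ∃ P : Finset (CoprodI M), N ≤ P.card ∧ ∀ p ∈ P, (nf p).length = K := by
  classical
  obtain ⟨j, hj⟩ := exists_ne i
  obtain ⟨b, hb⟩ := exists_ne (1 : M j)
  obtain ⟨a, ha⟩ := exists_ne (1 : M i)
  obtain ⟨a', ha'⟩ : ∃ a' : M i, a' ∉ ({1, a} : Finset (M i)) := by
    by_contra! h
    have h1 : Cardinal.mk (M i) ≤ 2 := by
      let : Fintype (M i) := ⟨{1, a}, h⟩
      rw [Cardinal.mk_fintype]
      have h2 : Fintype.card (M i) ≤ 2 := Finset.card_le_two (a := (1 : M i)) (b := a)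
      exact_mod_cast h2
    exact absurd hi h1.not_gt
  simp only [Finset.mem_insert, Finset.mem_singleton, not_or] at ha'
  suffices H : ∀ n : ℕ, ∃ P : Finset (CoprodI M), 2 ^ n ≤ P.card ∧
      ∀ p ∈ P, (nf p).length = 2 * n ∧ ∀ x ∈ (nf p).head?, x.1 = i by
    obtain ⟨P, hP, h⟩ := H N
    exact ⟨2 * N, P, Nat.lt_two_pow_self.le.trans hP, fun p hp => (h p hp).1⟩
  have key (x : M i) (hx : x ≠ 1) (p : CoprodI M) (hp : ∀ x ∈ (nf p).head?, x.1 = i) :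
      nf (CoprodI.of x * (CoprodI.of b * p)) = ⟨i, x⟩ :: ⟨j, b⟩ :: nf p := by
    have h1 : nf (CoprodI.of b * p) = ⟨j, b⟩ :: nf p := by
      rw [nf_mul, nf_of hb]
      · rfl
      · intro y hy z hz
        rw [nf_of hb] at hy
        simp only [List.getLast?_singleton, Option.mem_def, Option.some.injEq] at hy
        rw [hp z hz, ← hy]
        exact hj
    rw [nf_mul, nf_of hx, h1]
    · rfl
    · simpa [Compatible, nf_of hx, h1] using hj.symm
  intro n
  induction n with
  | zero => exact ⟨{1}, by simp, by simp⟩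
  | succ n ih =>
    obtain ⟨P, hP, h⟩ := ih
    have hinj (x : M i) :
        Function.Injective fun p : CoprodI M => CoprodI.of x * (CoprodI.of b * p) :=
      fun p q hpq => by simpa using hpq
    refine ⟨P.image (fun p => CoprodI.of a * (CoprodI.of b * p)) ∪
      P.image (fun p => CoprodI.of a' * (CoprodI.of b * p)), ?_, ?_⟩
    · rw [Finset.card_union_of_disjoint, Finset.card_image_of_injective _ (hinj a),
        Finset.card_image_of_injective _ (hinj a'), pow_succ]
      · omega
      · refine Finset.disjoint_left.2 fun g hg hg' => ?_
        obtain ⟨p, hp, rfl⟩ := Finset.mem_image.1 hg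
        obtain ⟨q, hq, hpq⟩ := Finset.mem_image.1 hg'
        have := congrArg nf hpq
        rw [key a ha p (h p hp).2, key a' ha'.1 q (h q hq).2] at this
        simp [ha'.2] at this
    · intro g hg
      rcases Finset.mem_union.1 hg with hg | hg <;>
      · obtain ⟨p, hp, rfl⟩ := Finset.mem_image.1 hg
        have := h p hp
        first
        | rw [key a ha p this.2]
        | rw [key a' ha'.1 p this.2]
        simp [this.1]
        ring

section Growth

variable [Finite ι] [Nontrivial ι] [∀ i, Nontrivial (M i)]

theorem exists_mul_ncard_le (hS : S.Finite) (hgen : Subgroup.closure S = ⊤)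
    {i : ι} (hi : 2 < Cardinal.mk (M i)) (N : ℕ) :
    ∃ d, ∀ m, d ≤ m → N * (wordBall S (m - d)).ncard ≤ (wordBall S m).ncard := by
  obtain ⟨c, hc⟩ := exists_sum_ncard_le hS hgen
  obtain ⟨K, P, hP, hK⟩ := exists_finset_card_ge hi (2 * N)
  refine ⟨P.sup (wordLength S) + c, fun m hm => ?_⟩
  have hle (p) (hp : p ∈ P) : wordLength S p ≤ P.sup (wordLength S) := Finset.le_sup hp
  have h1 := hc K m P fun p hp => ⟨hK p hp, by have := hle p hp; omega⟩
  have h2 : P.card • (wordBall S (m - (P.sup (wordLength S) + c))).ncard ≤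
      ∑ p ∈ P, (wordBall S (m - (wordLength S p + c))).ncard :=
    Finset.card_nsmul_le_sum _ _ _ fun p hp =>
      ncard_wordBall_mono hS (by have := hle p hp; omega)
  rw [smul_eq_mul] at h2
  have h3 := (Nat.mul_le_mul_right _ hP).trans (h2.trans h1)
  rw [mul_assoc] at h3
  omega

/-- Elements with a fixed number of syllables are negligible. -/
theorem eventually_ncard_length_eq_le (hS : S.Finite) (hgen : Subgroup.closure S = ⊤)
    {i : ι} (hi : 2 < Cardinal.mk (M i)) (K : ℕ) {ε : ℝ} (hε : 0 < ε) :
    ∀ᶠ m in atTop, ({g ∈ wordBall S m | (nf g).length = K}.ncard : ℝ) ≤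
      ε * (wordBall S m).ncard := by
  classical
  obtain ⟨c, hc⟩ := exists_sum_ncard_le hS hgen
  let b : ℕ → ℝ := fun m => (wordBall S m).ncard
  have hb (m) : 0 < b m := Nat.cast_pos.2 (ncard_wordBall_pos hS m)
  have hbmono {m n} (h : m ≤ n) : b m ≤ b n := Nat.cast_le.2 (ncard_wordBall_mono hS h)
  have hbadd (m n) : b (m + n) ≤ b m * b n := by
    simp only [b]
    exact_mod_cast ncard_wordBall_add_le hS m n
  let f : CoprodI M → ℝ := fun g => if (nf g).length = K then (b (wordLength S g + c))⁻¹ else 0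
  have hf0 (g) : 0 ≤ f g := by
    simp only [f]
    split_ifs
    exacts [(inv_pos.2 (hb _)).le, le_rfl]
  have hsum : Summable f := by
    refine summable_of_sum_le (c := 2) hf0 fun P => ?_
    simp only [f]
    rw [← Finset.sum_filter]
    set Q := P.filter fun g => (nf g).length = K
    set m := Q.sup fun g => wordLength S g + c
    have hm (p) (hp : p ∈ Q) : wordLength S p + c ≤ m :=
      Finset.le_sup (f := fun g => wordLength S g + c) hp
    have h1 : ∑ p ∈ Q, b (m - (wordLength S p + c)) ≤ 2 * b m := by
      have := hc K m Q fun p hp => ⟨(Finset.mem_filter.1 hp).2, hm p hp⟩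
      simp only [b]
      exact_mod_cast this
    have h2 : ∑ p ∈ Q, b m * (b (wordLength S p + c))⁻¹ ≤
        ∑ p ∈ Q, b (m - (wordLength S p + c)) := by
      refine Finset.sum_le_sum fun p hp => ?_
      rw [← div_eq_mul_inv, div_le_iff₀ (hb _)]
      have := hbadd (m - (wordLength S p + c)) (wordLength S p + c)
      rwa [Nat.sub_add_cancel (hm p hp)] at this
    rw [← Finset.mul_sum] at h2
    have h3 := h2.trans h1
    rw [mul_comm 2] at h3
    exact le_of_mul_le_mul_left h3 (hb m)
  obtain ⟨s, hs⟩ := summable_iff_vanishing_norm.1 hsum (ε / (2 * b c)) (by have := hb c; positivity)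
  obtain ⟨N, hN⟩ := exists_nat_ge (s.card / (ε / 2))
  obtain ⟨d, hd⟩ := exists_mul_ncard_le hS hgen hi N
  filter_upwards [eventually_ge_atTop d] with m hm
  have hfin : {g ∈ wordBall S m | (nf g).length = K}.Finite :=
    (finite_wordBall hS m).subset (Set.sep_subset _ _)
  rw [Set.ncard_eq_toFinset_card _ hfin]
  set L := hfin.toFinset
  have hL (g) (hg : g ∈ L) : g ∈ wordBall S m ∧ (nf g).length = K := by simpa [L] using hg
  have h1 : (L.card : ℝ) ≤ s.card + (L \ s).card := by
    have := Finset.card_le_card_sdiff_add_card (s := L) (t := s)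
    rw [add_comm]
    exact_mod_cast this
  have h2 : ((L \ s).card : ℝ) * (b (m + c))⁻¹ ≤ ε / (2 * b c) := by
    have h3 := hs (L \ s) Finset.sdiff_disjoint
    rw [Real.norm_of_nonneg (Finset.sum_nonneg fun g _ => hf0 g)] at h3
    refine le_trans ?_ h3.le
    rw [← nsmul_eq_mul]
    refine Finset.card_nsmul_le_sum _ _ _ fun g hg => ?_
    obtain ⟨hg1, hg2⟩ := hL g (Finset.mem_sdiff.1 hg).1
    simp only [f, if_pos hg2]
    exact inv_anti₀ (hb _) (hbmono (by have := wordLength_le hg1; omega))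
  have h3 : ((L \ s).card : ℝ) ≤ ε / 2 * b m := by
    rw [← div_eq_mul_inv, div_le_iff₀ (hb _)] at h2
    calc ((L \ s).card : ℝ) ≤ ε / (2 * b c) * b (m + c) := h2
      _ ≤ ε / (2 * b c) * (b m * b c) := by
        have := hb c
        exact mul_le_mul_of_nonneg_left (hbadd m c) (by positivity)
      _ = ε / 2 * b m := by
        have := (hb c).ne'
        field_simp
  have h4 : (s.card : ℝ) ≤ ε / 2 * b m := by
    have h5 : (N : ℝ) ≤ b m := by
      have h6 := hd m hm
      have h7 := ncard_wordBall_pos hS (m - d)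
      simp only [b]
      exact_mod_cast (Nat.le_mul_of_pos_right N h7).trans h6
    rw [mul_comm, ← div_le_iff₀ (by positivity)]
    exact hN.trans h5
  calc (L.card : ℝ) ≤ ε / 2 * b m + ε / 2 * b m := by linarith
    _ = ε * b m := by ring

theorem eventually_ncard_length_lt_le (hS : S.Finite) (hgen : Subgroup.closure S = ⊤)
    {i : ι} (hi : 2 < Cardinal.mk (M i)) (K : ℕ) {ε : ℝ} (hε : 0 < ε) :
    ∀ᶠ m in atTop, ({g ∈ wordBall S m | (nf g).length < K}.ncard : ℝ) ≤
      ε * (wordBall S m).ncard := by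
  induction K generalizing ε with
  | zero =>
    refine Eventually.of_forall fun m => ?_
    simp only [Nat.not_lt_zero, and_false, Set.ofPred_false, Set.ncard_empty, Nat.cast_zero]
    positivity
  | succ K ih =>
    filter_upwards [ih (half_pos hε), eventually_ncard_length_eq_le hS hgen hi K (half_pos hε)]
      with m h1 h2
    have hsub : {g ∈ wordBall S m | (nf g).length < K + 1} =
        {g ∈ wordBall S m | (nf g).length < K} ∪ {g ∈ wordBall S m | (nf g).length = K} := by
      ext g
      simp only [Set.mem_ofPred_eq, Set.mem_union, Nat.lt_succ_iff_lt_or_eq]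
      tauto
    have h3 : ({g ∈ wordBall S m | (nf g).length < K + 1}.ncard : ℝ) ≤
        {g ∈ wordBall S m | (nf g).length < K}.ncard +
          {g ∈ wordBall S m | (nf g).length = K}.ncard := by
      rw [hsub]
      exact_mod_cast Set.ncard_union_le _ _
    linarith

end Growth

/-- Cutting off a piece with sufficiently many syllables shortens words by a prescribed amount. -/
theorem exists_length_cut (hS : S.Finite) (hgen : Subgroup.closure S = ⊤) (d : ℕ) :
    ∃ k, 1 ≤ k ∧ ∀ (m : ℕ) (p q : CoprodI M), Compatible p q → p * q ∈ wordBall S m →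
      (k ≤ (nf p).length → q ∈ wordBall S (m - d)) ∧
      (k ≤ (nf q).length → p ∈ wordBall S (m - d)) := by
  obtain ⟨C, hC⟩ := exists_almost_additive hS hgen
  obtain ⟨k, hk⟩ := ((finite_wordBall hS (C + d)).image fun g => (nf g).length).bddAbove
  have hlong {g : CoprodI M} {i : ℕ} (hg : g ∈ wordBall S i) (hkg : k + 1 ≤ (nf g).length) :
      C + d ≤ i := by
    by_contra! h
    have := hk ⟨g, wordBall_mono h.le hg, rfl⟩
    dsimp at this
    omega
  refine ⟨k + 1, by omega, fun m p q hpq hm => ?_⟩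
  obtain ⟨i, j, hij, hp, hq⟩ := hC p q m hpq hm
  exact ⟨fun h => wordBall_mono (by have := hlong hp h; omega) hq,
    fun h => wordBall_mono (by have := hlong hq h; omega) hp⟩

section Prefixes

variable {k d m : ℕ}

theorem ncard_pre_eq_le (hS : S.Finite)
    (hcut : ∀ p q : CoprodI M, Compatible p q → p * q ∈ wordBall S m →
      k ≤ (nf p).length → q ∈ wordBall S (m - d)) (u : CoprodI M) :
    {g ∈ wordBall S m | 2 * k ≤ (nf g).length ∧ pre k g = u}.ncard ≤
      (wordBall S (m - d)).ncard := by
  refine Set.ncard_le_ncard_of_injOn (fun g => u⁻¹ * g) ?_ ?_ (finite_wordBall hS _)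
  · rintro g ⟨hg, hk, rfl⟩
    obtain ⟨q, hq, hc⟩ := exists_pre_mul k g
    have : (pre k g)⁻¹ * g = q := inv_mul_eq_iff_eq_mul.2 hq.symm
    rw [this]
    refine hcut _ _ hc ?_ (length_nf_pre (by omega)).ge
    rwa [hq]
  · exact (mul_right_injective _).injOn

theorem ncard_pre_inv_eq_le (hS : S.Finite)
    (hcut : ∀ p q : CoprodI M, Compatible p q → p * q ∈ wordBall S m →
      k ≤ (nf p).length → q ∈ wordBall S (m - d)) (u : CoprodI M) :
    {g ∈ wordBall S m | 2 * k ≤ (nf g).length ∧ pre k g⁻¹ = u}.ncard ≤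
      (wordBall S (m - d)).ncard := by
  refine le_trans ?_ (ncard_pre_eq_le hS hcut u)
  refine Set.ncard_le_ncard_of_injOn (fun g => g⁻¹) ?_ inv_injective.injOn
    ((finite_wordBall hS _).subset (Set.sep_subset _ _))
  rintro g ⟨hg, hk, hu⟩
  exact ⟨inv_mem_wordBall hg, by rwa [length_nf_inv], hu⟩

theorem ncard_pre_eq_pre_inv_le (hS : S.Finite)
    (hcut : ∀ p q : CoprodI M, Compatible p q → p * q ∈ wordBall S m →
      k ≤ (nf q).length → p ∈ wordBall S (m - d)) :
    {g ∈ wordBall S m | 2 * k ≤ (nf g).length ∧ pre k g = pre k g⁻¹}.ncard ≤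
      (wordBall S (m - d)).ncard := by
  have key (g : CoprodI M) (hg : 2 * k ≤ (nf g).length) (h : pre k g = pre k g⁻¹) :
      ∃ r, r = g * pre k g ∧ r * (pre k g⁻¹)⁻¹ = g ∧ Compatible r (pre k g⁻¹)⁻¹ ∧
        pre k r = pre k g := by
    obtain ⟨r, hr, hc⟩ := exists_mul_pre_inv k g
    refine ⟨r, ?_, hr, hc, ?_⟩
    · rw [h]
      exact eq_mul_of_mul_inv_eq hr
    · rw [← pre_mul hc (length_nf_of_mul_pre_inv hr hc hg), hr]
  refine Set.ncard_le_ncard_of_injOn (fun g => g * pre k g) ?_ ?_ (finite_wordBall hS _)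
  · rintro g ⟨hg, hk, h⟩
    obtain ⟨r, hr, hrg, hc, -⟩ := key g hk h
    rw [← hr]
    refine hcut _ _ hc (hrg.symm ▸ hg) ?_
    have hlen : (nf (pre k g⁻¹)).length = k := length_nf_pre (by rw [length_nf_inv g]; omega)
    exact ((length_nf_inv (pre k g⁻¹)).trans hlen).ge
  · rintro g ⟨hg, hk, h⟩ g' ⟨hg', hk', h'⟩ heq
    obtain ⟨r, hr, -, -, hpre⟩ := key g hk h
    obtain ⟨r', hr', -, -, hpre'⟩ := key g' hk' h'
    have hrr : r = r' := by rw [hr, hr']; exact heq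
    have : pre k g = pre k g' := by rw [← hpre, ← hpre', hrr]
    simp only [this] at heq
    exact mul_right_cancel heq

theorem ncard_not_separated_le (hS : S.Finite)
    (hcut : ∀ p q : CoprodI M, Compatible p q → p * q ∈ wordBall S m →
      k ≤ (nf p).length → q ∈ wordBall S (m - d)) (h : CoprodI M) :
    {g ∈ wordBall S m | 2 * k ≤ (nf g).length ∧ ¬ Separated k g h}.ncard ≤
      4 * (wordBall S (m - d)).ncard := by
  set F : CoprodI M → Set (CoprodI M) := fun u =>
    {g ∈ wordBall S m | 2 * k ≤ (nf g).length ∧ pre k g = u}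
  set F' : CoprodI M → Set (CoprodI M) := fun u =>
    {g ∈ wordBall S m | 2 * k ≤ (nf g).length ∧ pre k g⁻¹ = u}
  have hF (u) : (F u).ncard ≤ _ := ncard_pre_eq_le hS hcut u
  have hF' (u) : (F' u).ncard ≤ _ := ncard_pre_inv_eq_le hS hcut u
  have hfin (u) : (F u).Finite := (finite_wordBall hS m).subset (Set.sep_subset _ _)
  have hfin' (u) : (F' u).Finite := (finite_wordBall hS m).subset (Set.sep_subset _ _)
  have hsub : {g ∈ wordBall S m | 2 * k ≤ (nf g).length ∧ ¬ Separated k g h} ⊆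
      (F (pre k h) ∪ F (pre k h⁻¹)) ∪ (F' (pre k h) ∪ F' (pre k h⁻¹)) := by
    rintro g ⟨hg, hk, hs⟩
    simp only [Separated, ne_eq] at hs
    simp only [F, F', Set.mem_union, Set.mem_ofPred_eq]
    tauto
  have h1 := Set.ncard_le_ncard hsub
    (((hfin _).union (hfin _)).union ((hfin' _).union (hfin' _)))
  have h2 := Set.ncard_union_le (F (pre k h) ∪ F (pre k h⁻¹)) (F' (pre k h) ∪ F' (pre k h⁻¹))
  have h3 := Set.ncard_union_le (F (pre k h)) (F (pre k h⁻¹))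
  have h4 := Set.ncard_union_le (F' (pre k h)) (F' (pre k h⁻¹))
  have := hF (pre k h)
  have := hF (pre k h⁻¹)
  have := hF' (pre k h)
  have := hF' (pre k h⁻¹)
  omega

/-- The entries `g` that are not allowed in a tuple whose other entries are `z`. -/
def forbidden (k : ℕ) {n : ℕ} (z : Fin n → CoprodI M) : Set (CoprodI M) :=
  {g | (nf g).length < 2 * k ∨ (2 * k ≤ (nf g).length ∧ pre k g = pre k g⁻¹) ∨
    ∃ j, 2 * k ≤ (nf g).length ∧ ¬ Separated k g (z j)}

theorem ncard_forbidden_le (hS : S.Finite)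
    (hcut : ∀ p q : CoprodI M, Compatible p q → p * q ∈ wordBall S m →
      (k ≤ (nf p).length → q ∈ wordBall S (m - d)) ∧
      (k ≤ (nf q).length → p ∈ wordBall S (m - d))) {n : ℕ} (z : Fin n → CoprodI M) :
    (wordBall S m ∩ forbidden k z).ncard ≤
      {g ∈ wordBall S m | (nf g).length < 2 * k}.ncard +
        (4 * n + 1) * (wordBall S (m - d)).ncard := by
  have hB := finite_wordBall hS m
  set T : Fin n → Set (CoprodI M) := fun j =>
    {g ∈ wordBall S m | 2 * k ≤ (nf g).length ∧ ¬ Separated k g (z j)}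
  set L := {g ∈ wordBall S m | (nf g).length < 2 * k}
  set R := {g ∈ wordBall S m | 2 * k ≤ (nf g).length ∧ pre k g = pre k g⁻¹}
  have hsub : wordBall S m ∩ forbidden k z ⊆ L ∪ (R ∪ ⋃ j, T j) := by
    rintro g ⟨hg, h | h | ⟨j, h⟩⟩
    · exact Or.inl ⟨hg, h⟩
    · exact Or.inr (Or.inl ⟨hg, h⟩)
    · exact Or.inr (Or.inr (Set.mem_iUnion.2 ⟨j, hg, h⟩))
  have hfin : (L ∪ (R ∪ ⋃ j, T j)).Finite :=
    (hB.subset (Set.sep_subset _ _)).union ((hB.subset (Set.sep_subset _ _)).union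
      (Set.finite_iUnion fun j => hB.subset (Set.sep_subset _ _)))
  have hR : R.ncard ≤ _ := ncard_pre_eq_pre_inv_le hS fun p q hc hm => (hcut p q hc hm).2
  have hT : (⋃ j, T j).ncard ≤ n * (4 * (wordBall S (m - d)).ncard) := by
    calc (⋃ j, T j).ncard ≤ ∑ j, (T j).ncard := Set.ncard_iUnion_le_of_fintype _
      _ ≤ ∑ _j : Fin n, 4 * (wordBall S (m - d)).ncard := Finset.sum_le_sum fun j _ =>
          ncard_not_separated_le hS (fun p q hc hm => (hcut p q hc hm).1) (z j)
      _ = _ := by simp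
  calc _ ≤ _ := Set.ncard_le_ncard hsub hfin
    _ ≤ L.ncard + (R ∪ ⋃ j, T j).ncard := Set.ncard_union_le _ _
    _ ≤ L.ncard + (R.ncard + (⋃ j, T j).ncard) := Nat.add_le_add_left (Set.ncard_union_le _ _) _
    _ ≤ L.ncard + ((wordBall S (m - d)).ncard + n * (4 * (wordBall S (m - d)).ncard)) :=
        Nat.add_le_add_left (add_le_add hR hT) _
    _ = _ := by ring

theorem isFreeBasisTuple_of_notMem_forbidden (hk : 1 ≤ k) {n : ℕ}
    {x : Fin (n + 1) → CoprodI M} (hx : ∀ i, x i ∉ forbidden k (i.removeNth x)) :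
    IsFreeBasisTuple x := by
  simp only [forbidden, Set.mem_ofPred_eq, not_or, not_lt, not_and, not_exists, not_not] at hx
  refine isFreeBasisTuple_of_separated hk (by omega) (fun i => ⟨(hx i).1, (hx i).2.1 (hx i).1⟩)
    fun i j hij => ?_
  obtain ⟨l, rfl⟩ := Fin.exists_succAbove_eq hij.symm
  exact (hx i).2.2 l (hx i).1

end Prefixes

end Counting

section Tuples

variable {α : Type*} {B : Set α}

theorem ncard_tuples (hB : B.Finite) (n : ℕ) :
    {x : Fin n → α | ∀ i, x i ∈ B}.ncard = B.ncard ^ n ∧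
      {x : Fin n → α | ∀ i, x i ∈ B}.Finite := by
  classical
  have h : {x : Fin n → α | ∀ i, x i ∈ B} = ↑(Fintype.piFinset fun _ : Fin n => hB.toFinset) := by
    ext
    simp
  rw [h]
  refine ⟨?_, Finset.finite_toSet _⟩
  rw [Set.ncard_coe_finset, Fintype.card_piFinset_const, Set.ncard_eq_toFinset_card _ hB]

theorem ncard_tuples_mem_le (hB : B.Finite) {n D : ℕ} (F : (Fin n → α) → Set α)
    (hF : ∀ z, (B ∩ F z).ncard ≤ D) (i : Fin (n + 1)) :
    {x : Fin (n + 1) → α | (∀ j, x j ∈ B) ∧ x i ∈ F (i.removeNth x)}.ncard ≤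
      D * B.ncard ^ n := by
  classical
  have hfin : {x : Fin (n + 1) → α | (∀ j, x j ∈ B) ∧ x i ∈ F (i.removeNth x)}.Finite :=
    (ncard_tuples hB (n + 1)).2.subset fun x hx => hx.1
  rw [← (ncard_tuples hB n).1, Set.ncard_eq_toFinset_card _ hfin,
    Set.ncard_eq_toFinset_card _ (ncard_tuples hB n).2]
  refine Finset.card_le_mul_card_image_of_maps_to (f := fun x => i.removeNth x) ?_ D ?_
  · intro x hx
    simp only [Set.Finite.mem_toFinset, Set.mem_ofPred_eq] at hx ⊢
    exact fun j => hx.1 _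
  · intro z _
    refine le_trans ?_ (hF z)
    have hBF : (B ∩ F z).Finite := hB.subset Set.inter_subset_left
    rw [Set.ncard_eq_toFinset_card _ hBF]
    refine Finset.card_le_card_of_injOn (fun x => x i) ?_ ?_
    · intro x hx
      simp only [Finset.coe_filter, Set.Finite.mem_toFinset, Set.mem_ofPred_eq] at hx
      simp only [Set.Finite.coe_toFinset, Set.mem_inter_iff]
      exact ⟨hx.1.1 i, hx.2 ▸ hx.1.2⟩
    · intro x hx y hy hxy
      simp only [Finset.coe_filter, Set.mem_ofPred_eq] at hx hy
      rw [← Fin.insertNth_self_removeNth i x, ← Fin.insertNth_self_removeNth i y, hx.2, hy.2]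
      exact congrArg (fun a => i.insertNth (α := fun _ => α) a z) hxy

end Tuples

section Main

variable {ι : Type*} {M : ι → Type*} [∀ i, Group (M i)] {S : Set (CoprodI M)}

theorem strongGenericFreeGroupProperty_coprodI [Finite ι] [Nontrivial ι] [∀ i, Nontrivial (M i)]
    {i : ι} (hi : 2 < Cardinal.mk (M i)) (hS : S.Finite) (hgen : Subgroup.closure S = ⊤) :
    StrongGenericFreeGroupProperty S := by
  intro n hn
  obtain ⟨n, rfl⟩ := Nat.exists_eq_add_of_le' hn
  have hb (m) : (0 : ℝ) < (wordBall S m).ncard := Nat.cast_pos.2 (ncard_wordBall_pos hS m)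
  have hall (m) := ncard_tuples (finite_wordBall hS m) (n + 1)
  have hupper (m) : ({x : Fin (n + 1) → CoprodI M | (∀ i, x i ∈ wordBall S m) ∧
      IsFreeBasisTuple x}.ncard : ℝ) / ((wordBall S m).ncard : ℝ) ^ (n + 1) ≤ 1 := by
    have := hb m
    rw [div_le_one (by positivity)]
    have h := Set.ncard_le_ncard (s := {x : Fin (n + 1) → CoprodI M |
      (∀ i, x i ∈ wordBall S m) ∧ IsFreeBasisTuple x}) (t := {x | ∀ i, x i ∈ wordBall S m})
      (fun x hx => hx.1) (hall m).2
    rw [(hall m).1] at h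
    exact_mod_cast h
  rw [Metric.tendsto_atTop']
  intro ε hε
  obtain ⟨N, hN⟩ := exists_nat_gt ((n + 1) * (4 * n + 1) / (ε / 2) : ℝ)
  have hN0 : (0 : ℝ) < N := lt_of_le_of_lt (by positivity) hN
  obtain ⟨d, hd⟩ := exists_mul_ncard_le hS hgen hi N
  obtain ⟨k, hk, hcut⟩ := exists_length_cut hS hgen d
  have hshort := eventually_ncard_length_lt_le hS hgen hi (2 * k)
    (ε := ε / (2 * (n + 1))) (by positivity)
  obtain ⟨m₀, hm₀⟩ := eventually_atTop.1 (hshort.and (eventually_ge_atTop d))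
  refine ⟨m₀, fun m hm => ?_⟩
  obtain ⟨hL, hdm⟩ := hm₀ m hm.le
  have hgrowth : (N : ℝ) * (wordBall S (m - d)).ncard ≤ (wordBall S m).ncard := by
    exact_mod_cast hd m hdm
  set b := ((wordBall S m).ncard : ℝ)
  set G : Set (Fin (n + 1) → CoprodI M) := {x | (∀ i, x i ∈ wordBall S m) ∧ IsFreeBasisTuple x}
  set T : Fin (n + 1) → Set (Fin (n + 1) → CoprodI M) := fun i =>
    {x | (∀ j, x j ∈ wordBall S m) ∧ x i ∈ forbidden k (i.removeNth x)}
  set D := {g ∈ wordBall S m | (nf g).length < 2 * k}.ncard +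
    (4 * n + 1) * (wordBall S (m - d)).ncard with hD
  have hT (i) : (T i).ncard ≤ D * (wordBall S m).ncard ^ n :=
    ncard_tuples_mem_le (finite_wordBall hS m) _ (ncard_forbidden_le hS (hcut m)) i
  have hsub : {x : Fin (n + 1) → CoprodI M | ∀ i, x i ∈ wordBall S m} ⊆ G ∪ ⋃ i, T i := by
    intro x hx
    by_cases h : ∃ i, x i ∈ forbidden k (i.removeNth x)
    · obtain ⟨i, hi⟩ := h
      exact Or.inr (Set.mem_iUnion.2 ⟨i, hx, hi⟩)
    · exact Or.inl ⟨hx, isFreeBasisTuple_of_notMem_forbidden hk (not_exists.1 h)⟩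
  have hcount : (wordBall S m).ncard ^ (n + 1) ≤
      G.ncard + (n + 1) * (D * (wordBall S m).ncard ^ n) := by
    rw [← (hall m).1]
    calc _ ≤ _ := Set.ncard_le_ncard hsub (((hall m).2.subset fun x hx => hx.1).union
          (Set.finite_iUnion fun i => (hall m).2.subset fun x hx => hx.1))
      _ ≤ G.ncard + (⋃ i, T i).ncard := Set.ncard_union_le _ _
      _ ≤ G.ncard + ∑ i, (T i).ncard :=
          Nat.add_le_add_left (Set.ncard_iUnion_le_of_fintype _) _
      _ ≤ G.ncard + ∑ _i : Fin (n + 1), D * (wordBall S m).ncard ^ n :=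
          Nat.add_le_add_left (Finset.sum_le_sum fun i _ => hT i) _
      _ = _ := by simp
  have hcount' : b ^ (n + 1) ≤ G.ncard + (n + 1) * (D * b ^ n) := by
    simp only [b]
    exact_mod_cast hcount
  have hDlt : (n + 1) * (D : ℝ) < ε * b := by
    have h1 : (n + 1) * (4 * n + 1) < ε / 2 * (N : ℝ) := by
      rwa [div_lt_iff₀ (by positivity), mul_comm (N : ℝ)] at hN
    have h2 : (0 : ℝ) < (wordBall S (m - d)).ncard := hb (m - d)
    have h3 : ((n : ℝ) + 1) * (ε / (2 * (n + 1)) * b) = ε / 2 * b := by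
      field_simp
    have h4 := mul_le_mul_of_nonneg_left hL (by positivity : (0 : ℝ) ≤ n + 1)
    have h5 := mul_lt_mul_of_pos_right h1 h2
    have h6 := mul_le_mul_of_nonneg_left hgrowth (by positivity : (0 : ℝ) ≤ ε / 2)
    rw [h3] at h4
    rw [hD]
    push_cast
    linarith
  have hbm : 0 < b := hb m
  rw [Real.dist_eq, abs_sub_comm, abs_of_nonneg (sub_nonneg.2 (hupper m)), sub_lt_comm,
    lt_div_iff₀ (by positivity)]
  have := mul_lt_mul_of_pos_right hDlt (pow_pos hbm n)
  rw [pow_succ] at hcount' ⊢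
  linarith

end Main

section Transfer

theorem StrongGenericFreeGroupProperty.generic {G : Type*} [Group G] {S : Set G} (hS : S.Finite)
    (h : StrongGenericFreeGroupProperty S) : GenericFreeGroupProperty S := by
  intro n hn
  have hb (m) : (0 : ℝ) < (wordBall S m).ncard := Nat.cast_pos.2 (ncard_wordBall_pos hS m)
  have hall (m) := ncard_tuples (finite_wordBall hS m) n
  refine tendsto_of_tendsto_of_tendsto_of_le_of_le (h n hn) tendsto_const_nhds
    (fun m => ?_) fun m => ?_
  · have hle := Set.ncard_le_ncard
      (s := {x : Fin n → G | (∀ i, x i ∈ wordBall S m) ∧ IsFreeBasisTuple x})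
      (t := {x : Fin n → G | (∀ i, x i ∈ wordBall S m) ∧
        IsFreeGroup (Subgroup.closure (Set.range x))})
      (fun x hx => ⟨hx.1, isFreeGroup_closure_range hx.2⟩) ((hall m).2.subset fun x hx => hx.1)
    dsimp only
    gcongr
  · have := hb m
    dsimp only
    rw [div_le_one (by positivity)]
    have hle := Set.ncard_le_ncard (s := {x : Fin n → G | (∀ i, x i ∈ wordBall S m) ∧
        IsFreeGroup (Subgroup.closure (Set.range x))}) (t := {x | ∀ i, x i ∈ wordBall S m})
      (fun x hx => hx.1) (hall m).2
    rw [(hall m).1] at hle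
    exact_mod_cast hle

theorem mem_wordBall_image_iff {G H : Type*} [Group G] [Group H] (e : G ≃* H) {S : Set G} {m : ℕ}
    {g : G} : e g ∈ wordBall (e '' S) m ↔ g ∈ wordBall S m := by
  constructor
  · rintro ⟨l, hl, hs, hg⟩
    refine ⟨l.map e.symm, by simpa using hl, ?_, ?_⟩
    · intro x hx
      obtain ⟨y, hy, rfl⟩ := List.mem_map.1 hx
      refine (hs y hy).imp ?_ ?_
      · rintro ⟨z, hz, rfl⟩
        simpa using hz
      · rintro ⟨z, hz, hzy⟩
        rwa [← map_inv, ← hzy, e.symm_apply_apply]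
    · rw [← map_list_prod, hg, e.symm_apply_apply]
  · rintro ⟨l, hl, hs, rfl⟩
    refine ⟨l.map e, by simpa using hl, ?_, (map_list_prod e l).symm⟩
    intro x hx
    obtain ⟨y, hy, rfl⟩ := List.mem_map.1 hx
    exact (hs y hy).imp (fun h => ⟨y, h, rfl⟩) fun h => ⟨y⁻¹, h, map_inv e y⟩

theorem isFreeBasisTuple_comp_iff {G H : Type*} [Group G] [Group H] (e : G ≃* H) {n : ℕ}
    {x : Fin n → G} : IsFreeBasisTuple (fun i => e (x i)) ↔ IsFreeBasisTuple x := by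
  have : FreeGroup.lift (fun i => e (x i)) = e.toMonoidHom.comp (FreeGroup.lift x) := by
    ext
    simp
  unfold IsFreeBasisTuple
  rw [this, MonoidHom.coe_comp]
  exact e.injective.of_comp_iff _

theorem StrongGenericFreeGroupProperty.of_mulEquiv {G H : Type*} [Group G] [Group H] (e : G ≃* H)
    {S : Set G} (h : StrongGenericFreeGroupProperty (e '' S)) :
    StrongGenericFreeGroupProperty S := by
  intro n hn
  have hball (m) : wordBall (e '' S) m = e '' wordBall S m := by
    ext g
    obtain ⟨g, rfl⟩ := e.surjective g
    rw [mem_wordBall_image_iff, e.injective.mem_set_image]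
  have hinj : Function.Injective (fun (x : Fin n → G) i => e (x i)) := e.injective.comp_left
  have hsurj : Function.Surjective (fun (x : Fin n → G) i => e (x i)) := e.surjective.comp_left
  have htuples (m) : {x : Fin n → H | (∀ i, x i ∈ wordBall (e '' S) m) ∧ IsFreeBasisTuple x} =
      (fun (x : Fin n → G) i => e (x i)) ''
        {x : Fin n → G | (∀ i, x i ∈ wordBall S m) ∧ IsFreeBasisTuple x} := by
    ext x
    constructor
    · rintro ⟨hx, hx'⟩
      obtain ⟨x, rfl⟩ := hsurj x
      refine ⟨x, ⟨fun i => ?_, (isFreeBasisTuple_comp_iff e).1 hx'⟩, rfl⟩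
      exact (mem_wordBall_image_iff e).1 (hx i)
    · rintro ⟨x, ⟨hx, hx'⟩, rfl⟩
      exact ⟨fun i => (mem_wordBall_image_iff e).2 (hx i), (isFreeBasisTuple_comp_iff e).2 hx'⟩
  have := h n hn
  simp only [htuples, Set.ncard_image_of_injective _ hinj] at this
  simp only [hball, Set.ncard_image_of_injective _ e.injective] at this
  exact this

universe u v

/-- The two factors of a binary free product as a family of types. -/
def Factor (A : Type u) (B : Type v) : Bool → Type (max u v)
  | true => ULift.{v} A
  | false => ULift.{u} B

instance (A : Type u) (B : Type v) [Group A] [Group B] : ∀ i, Group (Factor A B i)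
  | true => inferInstanceAs (Group (ULift.{v} A))
  | false => inferInstanceAs (Group (ULift.{u} B))

instance (A : Type u) (B : Type v) [Nontrivial A] [Nontrivial B] : ∀ i, Nontrivial (Factor A B i)
  | true => inferInstanceAs (Nontrivial (ULift.{v} A))
  | false => inferInstanceAs (Nontrivial (ULift.{u} B))

/-- The inclusion of the left factor. -/
def Factor.inl (A : Type u) (B : Type v) [Group A] [Group B] : A ≃* Factor A B true :=
  MulEquiv.ulift.symm

/-- The inclusion of the right factor. -/
def Factor.inr (A : Type u) (B : Type v) [Group A] [Group B] : B ≃* Factor A B false :=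
  MulEquiv.ulift.symm

/-- Binary free products as indexed free products. -/
def coprodEquiv (A : Type u) (B : Type v) [Group A] [Group B] :
    Coprod A B ≃* CoprodI (Factor A B) :=
  MonoidHom.toMulEquiv
    (Coprod.lift (CoprodI.of.comp (Factor.inl A B).toMonoidHom)
      (CoprodI.of.comp (Factor.inr A B).toMonoidHom))
    (CoprodI.lift fun i => match i with
      | true => Coprod.inl.comp (Factor.inl A B).symm.toMonoidHom
      | false => Coprod.inr.comp (Factor.inr A B).symm.toMonoidHom)
    (by ext <;> simp)
    (by
      refine CoprodI.ext_hom _ _ fun i => ?_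
      cases i <;> ext <;> simp)

end Transfer

end FreeProductGeneric

/-- Let `G = A ∗ B` be a nontrivial free product of finitely generated groups. If at least
one of the factors has order greater than `2`, then `G` satisfies the generic free group
property with respect to every finite generating set. -/
theorem freeProduct_genericFreeGroupProperty (A B : Type*) [Group A] [Group B]
    [Group.FG A] [Group.FG B] [Nontrivial A] [Nontrivial B]
    (h : 2 < Cardinal.mk A ∨ 2 < Cardinal.mk B) :
    ∀ S : Set (Monoid.Coprod A B), S.Finite → Subgroup.closure S = ⊤ →
      GenericFreeGroupProperty S := by
  intro S hS hgen
  obtain ⟨e⟩ : Nonempty (Monoid.Coprod A B ≃* Monoid.CoprodI (FreeProductGeneric.Factor A B)) :=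
    ⟨FreeProductGeneric.coprodEquiv A B⟩
  refine FreeProductGeneric.StrongGenericFreeGroupProperty.generic hS
    (FreeProductGeneric.StrongGenericFreeGroupProperty.of_mulEquiv e ?_)
  have hgen' : Subgroup.closure (e '' S) = ⊤ := by
    have := MonoidHom.map_closure e.toMonoidHom S
    rw [hgen, Subgroup.map_top_of_surjective e.toMonoidHom e.surjective] at this
    exact this.symm
  rcases h with h | h
  · refine FreeProductGeneric.strongGenericFreeGroupProperty_coprodI (i := true) ?_
      (hS.image e) hgen'
    change 2 < Cardinal.mk (ULift A)
    rw [Cardinal.mk_uLift]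
    simpa using h
  · refine FreeProductGeneric.strongGenericFreeGroupProperty_coprodI (i := false) ?_
      (hS.image e) hgen'
    change 2 < Cardinal.mk (ULift B)
    rw [Cardinal.mk_uLift]
    simpa using h
end

section
/- Every finitely generated nonabelian free group (i.e., a free group of finite rank r ≥ 2) satisfies the strong generic free group property with respect to a free basis as generating set: for every n ≥ 1, the proportion of n-tuples in the ball of radius m whose entries form a free basis of the subgroup they generate tends to 1 as m → ∞. -/
open Filter Set

namespace FreeGroup

section Cancellation

variable {α : Type*}

/-- A product of two reduced words is computed by cancelling a suffix of the first word
against a prefix of the second. -/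
theorem IsReduced.exists_cancel {L₁ L₂ : List (α × Bool)} (h₁ : IsReduced L₁)
    (h₂ : IsReduced L₂) :
    ∃ A C D, L₁ = A ++ C ∧ L₂ = invRev C ++ D ∧ IsReduced (A ++ D) := by
  induction L₁ using List.reverseRecOn generalizing L₂ with
  | nil => exact ⟨[], [], L₂, by simp, by simp, by simpa⟩
  | append_singleton L x ih =>
    by_cases h : IsReduced (L ++ [x] ++ L₂)
    · exact ⟨L ++ [x], [], L₂, by simp, by simp, h⟩
    · cases L₂ with
      | nil => simp [h₁] at h
      | cons y L₂ =>
        obtain ⟨hxy, hxy'⟩ : x.1 = y.1 ∧ x.2 ≠ y.2 := by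
          by_contra hxy
          refine h (List.isChain_append.2 ⟨h₁, h₂, ?_⟩)
          simpa using hxy
        have hy : y = (x.1, !x.2) := Prod.ext hxy.symm (by grind)
        obtain ⟨A, C, D, hL, hL₂, hr⟩ := ih (h₁.infix ⟨[], [x], by simp⟩)
          (h₂.infix (L₁ := L₂) ⟨[y], [], by simp⟩)
        exact ⟨A, C ++ [x], D, by simp [hL], by simp [hL₂, hy, invRev], hr⟩

theorem injective_lift_of_ne_one {x : Fin 1 → FreeGroup α} (hx : x 0 ≠ 1) :
    Function.Injective (FreeGroup.lift x) := by
  rw [injective_iff_map_eq_one]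
  intro w hw
  obtain ⟨z, rfl⟩ : ∃ z : ℤ, of 0 ^ z = w := by
    have h : w ∈ Subgroup.closure (Set.range (of : Fin 1 → FreeGroup (Fin 1))) := by
      simp [closure_range_of]
    rwa [Set.range_unique, ← Subgroup.zpowers_eq_closure] at h
  rw [map_zpow, lift_apply_of] at hw
  by_cases hz : z = 0
  · simp [hz]
  · exact absurd ((zpow_left_inj hz).1 (hw.trans (one_zpow z).symm)) hx

variable [DecidableEq α]

/-- The prefix of length `k` of the reduced word of `g`. -/
def wordPrefix (k : ℕ) (g : FreeGroup α) : List (α × Bool) :=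
  g.toWord.take k

theorem wordPrefix_mul {k : ℕ} {g h : FreeGroup α} (hg : 2 * k ≤ g.norm)
    (hh : wordPrefix k h ≠ wordPrefix k g⁻¹) : wordPrefix k (g * h) = wordPrefix k g := by
  obtain ⟨A, C, D, hA, hC, hr⟩ :=
    (isReduced_toWord (x := g)).exists_cancel (isReduced_toWord (x := h))
  have hmul : (g * h).toWord = A ++ D := by
    rw [← hr.reduce_eq, ← toWord_mk, ← mk_toWord (x := g), ← mk_toWord (x := h), hA, hC,
      ← mul_mk, ← mul_mk, ← mul_mk, ← inv_mk]
    group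
  have hlen : A.length + C.length = g.norm := by simp [norm, hA]
  have hCk : C.length < k := by
    by_contra! hk
    refine hh ?_
    simp only [wordPrefix, toWord_inv, hA, hC, invRev_append]
    rw [List.take_append_of_le_length (by simpa), List.take_append_of_le_length (by simpa)]
  simp only [wordPrefix, hmul, hA]
  rw [List.take_append_of_le_length (by omega), List.take_append_of_le_length (by omega)]

/-- If the entries of a tuple are long and the prefixes of the entries and of their inverses are
pairwise different, then the tuple is a free basis tuple. -/
theorem isFreeBasisTuple_of_wordPrefix_ne {α : Type} [DecidableEq α] {N k : ℕ} {x : Fin (N + 1) → FreeGroup α}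
    (hlen : ∀ i, 2 * k ≤ (x i).norm)
    (hself : ∀ i, wordPrefix k (x i) ≠ wordPrefix k (x i)⁻¹)
    (hpos : ∀ i j, i ≠ j → wordPrefix k (x i) ≠ wordPrefix k (x j))
    (hneg : ∀ i j, i ≠ j → wordPrefix k (x i)⁻¹ ≠ wordPrefix k (x j)⁻¹)
    (hmix : ∀ i j, i ≠ j → wordPrefix k (x i) ≠ wordPrefix k (x j)⁻¹) :
    IsFreeBasisTuple x := by
  cases N with
  | zero => exact injective_lift_of_ne_one fun h ↦ hself 0 (by simp [h])
  | succ N =>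
    refine injective_lift_of_ping_pong x
      (fun i ↦ {h | wordPrefix k h = wordPrefix k (x i)})
      (fun i ↦ {h | wordPrefix k h = wordPrefix k (x i)⁻¹}) (fun i ↦ ⟨x i, rfl⟩) ?_ ?_ ?_ ?_ ?_
    · exact fun i j hij ↦ Set.disjoint_left.2 fun h h₁ h₂ ↦ hpos i j hij (h₁.symm.trans h₂)
    · exact fun i j hij ↦ Set.disjoint_left.2 fun h h₁ h₂ ↦ hneg i j hij (h₁.symm.trans h₂)
    · refine fun i j ↦ Set.disjoint_left.2 fun h h₁ h₂ ↦ ?_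
      obtain rfl | hij := eq_or_ne i j
      · exact hself i (h₁.symm.trans h₂)
      · exact hmix i j hij (h₁.symm.trans h₂)
    · rintro i _ ⟨h, hh, rfl⟩
      exact wordPrefix_mul (hlen i) hh
    · rintro i _ ⟨h, hh, rfl⟩
      exact wordPrefix_mul (by simpa using hlen i) (by simpa using hh)

end Cancellation

section Counting

variable {α : Type*} [DecidableEq α] [Fintype α]

/-- The reduced words of length `n + 1` whose first letter is `a`. -/
def reducedWordsFrom : ℕ → α × Bool → Finset (List (α × Bool))
  | 0, a => {[a]}
  | n + 1, a =>
    ((Finset.univ.erase (a.1, !a.2)).biUnion (reducedWordsFrom n)).image (List.cons a)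

theorem mem_reducedWordsFrom {n : ℕ} {a : α × Bool} {L : List (α × Bool)} :
    L ∈ reducedWordsFrom n a ↔ IsReduced L ∧ L.head? = some a ∧ L.length = n + 1 := by
  induction n generalizing a L with
  | zero =>
    rcases L with _ | ⟨b, _ | ⟨c, L⟩⟩ <;> simp [reducedWordsFrom]
  | succ n ih =>
    rcases L with _ | ⟨b, _ | ⟨c, L⟩⟩
    · simp [reducedWordsFrom]
    · simp [reducedWordsFrom, ih]
    · have hc : c ≠ (a.1, !a.2) ↔ (a.1 = c.1 → a.2 = c.2) := by
        rcases a with ⟨a, s⟩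
        rcases c with ⟨c, t⟩
        cases s <;> cases t <;> simp [eq_comm]
      simp only [reducedWordsFrom, Finset.mem_image, Finset.mem_biUnion, Finset.mem_erase, ih,
        isReduced_cons_cons]
      constructor
      · rintro ⟨L', ⟨d, ⟨hd, -⟩, hL', hd', hl⟩, h⟩
        obtain ⟨rfl, rfl⟩ := List.cons.inj h
        obtain rfl : c = d := by simpa using hd'
        simpa [hL', hl] using hc.1 hd
      · rintro ⟨⟨h, hr⟩, hb, hl⟩
        obtain rfl : b = a := by simpa using hb
        exact ⟨c :: L, ⟨c, ⟨hc.2 h, Finset.mem_univ _⟩, hr, rfl, by simpa using hl⟩, rfl⟩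

theorem pairwiseDisjoint_reducedWordsFrom (n : ℕ) (s : Set (α × Bool)) :
    s.PairwiseDisjoint (reducedWordsFrom n) := by
  intro a _ b _ hab
  refine Finset.disjoint_left.2 fun L h₁ h₂ ↦ hab ?_
  rw [mem_reducedWordsFrom] at h₁ h₂
  simpa [h₁.2.1] using h₂.2.1

theorem card_reducedWordsFrom (n : ℕ) (a : α × Bool) :
    (reducedWordsFrom n a).card = (2 * Fintype.card α - 1) ^ n := by
  induction n generalizing a with
  | zero => simp [reducedWordsFrom]
  | succ n ih =>
    rw [reducedWordsFrom, Finset.card_image_of_injective _ (List.cons_injective),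
      Finset.card_biUnion (pairwiseDisjoint_reducedWordsFrom n _)]
    simp [ih, Finset.card_erase_of_mem, pow_succ', mul_comm]

/-- The reduced words of length at most `m`. -/
def reducedWords : ℕ → Finset (List (α × Bool))
  | 0 => {[]}
  | m + 1 => reducedWords m ∪ Finset.univ.biUnion (reducedWordsFrom m)

theorem mem_reducedWords {m : ℕ} {L : List (α × Bool)} :
    L ∈ reducedWords m ↔ IsReduced L ∧ L.length ≤ m := by
  induction m with
  | zero => cases L <;> simp [reducedWords]
  | succ m ih =>
    rw [reducedWords, Finset.mem_union, ih]
    cases L <;> simp [mem_reducedWordsFrom, ← and_or_left]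
    omega

theorem card_reducedWords_succ (m : ℕ) :
    (reducedWords (α := α) (m + 1)).card =
      (reducedWords (α := α) m).card +
        2 * Fintype.card α * (2 * Fintype.card α - 1) ^ m := by
  rw [reducedWords, Finset.card_union_of_disjoint,
    Finset.card_biUnion (pairwiseDisjoint_reducedWordsFrom m _)]
  · simp [card_reducedWordsFrom, mul_comm]
  · refine Finset.disjoint_left.2 fun L h₁ h₂ ↦ ?_
    simp only [mem_reducedWords, Finset.mem_biUnion, mem_reducedWordsFrom] at h₁ h₂
    obtain ⟨a, -, -, -, h⟩ := h₂
    omega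

/-- The elements of word length at most `m` of a free group of finite rank. -/
def normBall (α : Type*) [DecidableEq α] [Fintype α] (m : ℕ) : Finset (FreeGroup α) :=
  (reducedWords m).image mk

theorem mem_normBall {m : ℕ} {g : FreeGroup α} : g ∈ normBall α m ↔ g.norm ≤ m := by
  simp only [normBall, Finset.mem_image, mem_reducedWords]
  constructor
  · rintro ⟨L, ⟨-, hL⟩, rfl⟩
    exact norm_mk_le.trans hL
  · exact fun h ↦ ⟨g.toWord, ⟨isReduced_toWord, h⟩, mk_toWord⟩

theorem card_normBall (m : ℕ) : (normBall α m).card = (reducedWords (α := α) m).card := by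
  refine Finset.card_image_of_injOn fun L₁ h₁ L₂ h₂ h ↦ ?_
  rw [Finset.mem_coe, mem_reducedWords] at h₁ h₂
  rw [← h₁.1.reduce_eq, ← h₂.1.reduce_eq]
  exact reduce.sound h

theorem pow_le_card_normBall (m : ℕ) :
    (2 * Fintype.card α - 1) ^ m ≤ (normBall α m).card := by
  rw [card_normBall]
  cases m with
  | zero => simp [reducedWords]
  | succ m =>
    rw [card_reducedWords_succ, pow_succ']
    exact le_add_left (Nat.mul_le_mul_right _ (Nat.sub_le _ _))

theorem card_normBall_le (hα : 2 ≤ Fintype.card α) (m : ℕ) :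
    (normBall α m).card ≤ 2 * (2 * Fintype.card α - 1) ^ m := by
  rw [card_normBall]
  induction m with
  | zero => simp [reducedWords]
  | succ m ih =>
    rw [card_reducedWords_succ, pow_succ']
    obtain ⟨q, hq⟩ : ∃ q, 2 * Fintype.card α = q + 3 + 1 :=
      ⟨2 * Fintype.card α - 4, by omega⟩
    rw [hq, Nat.add_sub_cancel] at ih ⊢
    nlinarith [Nat.zero_le (q * (q + 3) ^ m)]

end Counting

section BadCompletions

variable {α : Type*} [DecidableEq α]

theorem exists_eq_wordPrefix_mul (k : ℕ) (g : FreeGroup α) :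
    ∃ s : FreeGroup α, s.norm ≤ g.norm - k ∧ mk (wordPrefix k g) * s = g :=
  ⟨mk (g.toWord.drop k), norm_mk_le.trans (by simp [norm]),
    by rw [wordPrefix, mul_mk, List.take_append_drop, mk_toWord]⟩

theorem exists_eq_conj_of_wordPrefix_eq {k : ℕ} {g : FreeGroup α} (hk : 2 * k ≤ g.norm)
    (hg : wordPrefix k g = wordPrefix k g⁻¹) :
    ∃ p s : FreeGroup α, p.norm ≤ k ∧ s.norm ≤ g.norm - 2 * k ∧ p * s * p⁻¹ = g := by
  obtain ⟨A, B, C, hL, hA, hC⟩ :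
      ∃ A B C, g.toWord = A ++ B ++ C ∧ A.length = k ∧ C.length = k := by
    have hk' : 2 * k ≤ g.toWord.length := hk
    refine ⟨g.toWord.take k, (g.toWord.drop k).take (g.norm - 2 * k),
      (g.toWord.drop k).drop (g.norm - 2 * k), ?_, ?_, ?_⟩
    · rw [List.append_assoc, List.take_append_drop, List.take_append_drop]
    · simp; omega
    · simp [norm]; omega
  have hB : B.length = g.norm - 2 * k := by simp [norm, hL]; omega
  have hCA : A = invRev C := by
    simp only [wordPrefix, toWord_inv, hL, invRev_append, List.append_assoc] at hg
    rwa [List.take_left' hA, List.take_left' (by simpa)] at hg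
  refine ⟨mk A, mk B, norm_mk_le.trans hA.le, norm_mk_le.trans hB.le, ?_⟩
  rw [inv_mk, mul_mk, mul_mk, ← mk_toWord (x := g), hL, hCA, invRev_invRev]

variable [Fintype α]

/-- The elements of word length at most `m` that start with the word `p` of length `k`, or whose
inverses do, together with some further elements. -/
def prefixCone (k m : ℕ) (p : List (α × Bool)) : Finset (FreeGroup α) :=
  (normBall α (m - k)).image (mk p * ·) ∪ (normBall α (m - k)).image (fun s ↦ (mk p * s)⁻¹)

theorem card_prefixCone_le (k m : ℕ) (p : List (α × Bool)) :
    (prefixCone k m p).card ≤ 2 * (normBall α (m - k)).card := by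
  rw [two_mul]
  exact (Finset.card_union_le _ _).trans
    (add_le_add Finset.card_image_le Finset.card_image_le)

theorem mem_prefixCone {k m : ℕ} {g : FreeGroup α} (hg : g.norm ≤ m) :
    g ∈ prefixCone k m (wordPrefix k g) := by
  obtain ⟨s, hs, h⟩ := exists_eq_wordPrefix_mul k g
  exact Finset.mem_union_left _
    (Finset.mem_image.2 ⟨s, mem_normBall.2 (hs.trans (Nat.sub_le_sub_right hg k)), h⟩)

theorem mem_prefixCone_inv {k m : ℕ} {g : FreeGroup α} (hg : g.norm ≤ m) :
    g ∈ prefixCone k m (wordPrefix k g⁻¹) := by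
  obtain ⟨s, hs, h⟩ := exists_eq_wordPrefix_mul k g⁻¹
  rw [norm_inv_eq] at hs
  exact Finset.mem_union_right _ (Finset.mem_image.2
    ⟨s, mem_normBall.2 (hs.trans (Nat.sub_le_sub_right hg k)), by rw [h, inv_inv]⟩)

/-- A set containing every element of word length at most `m` whose insertion into the tuple `y`
violates the hypotheses of `FreeGroup.isFreeBasisTuple_of_wordPrefix_ne`. -/
def badCompletions (k m : ℕ) {N : ℕ} (y : Fin N → FreeGroup α) : Finset (FreeGroup α) :=
  normBall α (2 * k) ∪
    Finset.image₂ (fun p s ↦ p * s * p⁻¹) (normBall α k) (normBall α (m - 2 * k)) ∪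
    Finset.univ.biUnion fun j ↦
      prefixCone k m (wordPrefix k (y j)) ∪ prefixCone k m (wordPrefix k (y j)⁻¹)

theorem card_badCompletions_le (hα : 2 ≤ Fintype.card α) {k m N : ℕ} (hm : 3 * k ≤ m)
    (y : Fin N → FreeGroup α) :
    (badCompletions k m y).card ≤ (6 + 8 * N) * (2 * Fintype.card α - 1) ^ (m - k) := by
  set q := 2 * Fintype.card α - 1 with hq
  have hball (l : ℕ) : (normBall α l).card ≤ 2 * q ^ l := card_normBall_le hα l
  have h₁ : (normBall α (2 * k)).card ≤ 2 * q ^ (m - k) :=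
    (hball _).trans (Nat.mul_le_mul_left _ (Nat.pow_le_pow_right (by omega) (by omega)))
  have h₂ : (Finset.image₂ (fun p s ↦ p * s * p⁻¹) (normBall α k)
      (normBall α (m - 2 * k))).card ≤ 4 * q ^ (m - k) := by
    refine (Finset.card_image₂_le _ _ _).trans ((Nat.mul_le_mul (hball _) (hball _)).trans_eq ?_)
    rw [show m - k = k + (m - 2 * k) by omega, pow_add]
    ring
  have h₃ : (Finset.univ.biUnion fun j ↦ prefixCone k m (wordPrefix k (y j)) ∪
      prefixCone k m (wordPrefix k (y j)⁻¹)).card ≤ N * (8 * q ^ (m - k)) := by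
    refine (Finset.card_biUnion_le_card_mul _ _ (8 * q ^ (m - k)) fun j _ ↦ ?_).trans_eq (by simp)
    have h (p : List (α × Bool)) := card_prefixCone_le k m p
    have := Finset.card_union_le (prefixCone k m (wordPrefix k (y j)))
      (prefixCone k m (wordPrefix k (y j)⁻¹))
    linarith [h (wordPrefix k (y j)), h (wordPrefix k (y j)⁻¹), hball (m - k)]
  calc (badCompletions k m y).card
      ≤ 2 * q ^ (m - k) + 4 * q ^ (m - k) + N * (8 * q ^ (m - k)) :=
        (Finset.card_union_le _ _).trans
          (add_le_add ((Finset.card_union_le _ _).trans (add_le_add h₁ h₂)) h₃)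
    _ = (6 + 8 * N) * q ^ (m - k) := by ring

theorem isFreeBasisTuple_of_notMem_badCompletions {α : Type} [DecidableEq α] [Fintype α]
    {k m N : ℕ} {x : Fin (N + 1) → FreeGroup α} (hx : ∀ i, (x i).norm ≤ m)
    (hbad : ∀ i, x i ∉ badCompletions k m (i.removeNth x)) : IsFreeBasisTuple x := by
  simp only [badCompletions, Finset.mem_union, not_or, Finset.mem_biUnion, Finset.mem_univ,
    true_and, not_exists, mem_normBall, not_le] at hbad
  have hcone (i j : Fin (N + 1)) (hij : i ≠ j) :
      x i ∉ prefixCone k m (wordPrefix k (x j)) ∧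
        x i ∉ prefixCone k m (wordPrefix k (x j)⁻¹) := by
    obtain ⟨l, rfl⟩ := Fin.exists_succAbove_eq hij.symm
    exact (hbad i).2 l
  refine isFreeBasisTuple_of_wordPrefix_ne (fun i ↦ (hbad i).1.1.le) (fun i h ↦ ?_)
    (fun i j hij h ↦ (hcone i j hij).1 (h ▸ mem_prefixCone (hx i)))
    (fun i j hij h ↦ (hcone i j hij).2 (h ▸ mem_prefixCone_inv (hx i)))
    (fun i j hij h ↦ (hcone i j hij).2 (h ▸ mem_prefixCone (hx i)))
  obtain ⟨p, s, hp, hs, hg⟩ := exists_eq_conj_of_wordPrefix_eq (hbad i).1.1.le h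
  exact (hbad i).1.2 (Finset.mem_image₂.2 ⟨p, mem_normBall.2 hp, s,
    mem_normBall.2 (hs.trans (Nat.sub_le_sub_right (hx i) _)), hg⟩)

end BadCompletions

end FreeGroup

/-- If every `N`-tuple has at most `K` completions in `T` at the coordinate `i`, then at most
`K * B.card ^ N` tuples in `B` arise from such a completion. -/
theorem Finset.card_filter_piFinset_removeNth_le {β : Type*} [DecidableEq β] {N K : ℕ}
    (B : Finset β) (i : Fin (N + 1)) (T : (Fin N → β) → Finset β) (hT : ∀ y, (T y).card ≤ K) :
    ((Fintype.piFinset fun _ : Fin (N + 1) ↦ B).filter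
      fun x ↦ x i ∈ T (i.removeNth (α := fun _ ↦ β) x)).card ≤ K * B.card ^ N := by
  refine (Finset.card_le_mul_card_image_of_maps_to (f := i.removeNth (α := fun _ ↦ β))
    (t := Fintype.piFinset fun _ : Fin N ↦ B) ?_ K fun y _ ↦ ?_).trans_eq (by simp)
  · intro x hx
    simp only [Finset.mem_filter, Fintype.mem_piFinset] at hx ⊢
    exact fun j ↦ hx.1 _
  · refine (Finset.card_le_card_of_injOn (fun x ↦ x i) ?_ ?_).trans (hT y)
    · intro x hx
      simp only [Finset.coe_filter, Finset.mem_filter, Set.mem_ofPred_eq] at hx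
      exact hx.2 ▸ hx.1.2
    · intro x hx x' hx' h
      simp only [Finset.coe_filter, Finset.mem_filter, Set.mem_ofPred_eq] at hx hx'
      rw [← Fin.insertNth_self_removeNth i x, ← Fin.insertNth_self_removeNth i x', hx.2, hx'.2]
      exact congrArg (fun a ↦ i.insertNth (α := fun _ ↦ β) a y) h

namespace FreeGroup

open Classical in
theorem card_filter_not_isFreeBasisTuple_le {α : Type} [DecidableEq α] [Fintype α]
    (hα : 2 ≤ Fintype.card α) {k m N : ℕ} (hm : 3 * k ≤ m) :
    ((Fintype.piFinset fun _ : Fin (N + 1) ↦ normBall α m).filter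
        fun x ↦ ¬ IsFreeBasisTuple x).card ≤
      (N + 1) * ((6 + 8 * N) * (2 * Fintype.card α - 1) ^ (m - k) *
        (normBall α m).card ^ N) := by
  have hsub : ((Fintype.piFinset fun _ : Fin (N + 1) ↦ normBall α m).filter
        fun x ↦ ¬ IsFreeBasisTuple x) ⊆
      Finset.univ.biUnion fun i ↦ (Fintype.piFinset fun _ : Fin (N + 1) ↦ normBall α m).filter
        fun x ↦ x i ∈ badCompletions k m (i.removeNth x) := by
    intro x hx
    simp only [Finset.mem_filter, Finset.mem_biUnion, Finset.mem_univ, true_and] at hx ⊢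
    by_contra! h
    refine hx.2 (isFreeBasisTuple_of_notMem_badCompletions (k := k) (m := m)
      (fun i ↦ mem_normBall.1 (Fintype.mem_piFinset.1 hx.1 i)) fun i ↦ h i hx.1)
  refine (Finset.card_le_card hsub).trans
    ((Finset.card_biUnion_le_card_mul _ _
      ((6 + 8 * N) * (2 * Fintype.card α - 1) ^ (m - k) * (normBall α m).card ^ N) fun i _ ↦
      Finset.card_filter_piFinset_removeNth_le _ i _
        fun y ↦ card_badCompletions_le hα hm y).trans_eq (by simp))

open Classical in
theorem one_sub_le_card_filter_isFreeBasisTuple_div {α : Type} [DecidableEq α] [Fintype α]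
    (hα : 2 ≤ Fintype.card α) {k m N : ℕ} (hm : 3 * k ≤ m) :
    1 - (N + 1) * (6 + 8 * N) * ((2 * Fintype.card α - 1 : ℕ) : ℝ)⁻¹ ^ k ≤
      (((Fintype.piFinset fun _ : Fin (N + 1) ↦ normBall α m).filter
        IsFreeBasisTuple).card : ℝ) / ((normBall α m).card : ℝ) ^ (N + 1) := by
  have hbad := card_filter_not_isFreeBasisTuple_le (N := N) hα hm
  have hsum := Finset.card_filter_add_card_filter_not
    (s := Fintype.piFinset fun _ : Fin (N + 1) ↦ normBall α m) IsFreeBasisTuple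
  have hb := pow_le_card_normBall (α := α) m
  rw [Fintype.card_piFinset_const] at hsum
  have hq₀ : 0 < 2 * Fintype.card α - 1 := by omega
  generalize 2 * Fintype.card α - 1 = q at *
  generalize (normBall α m).card = B at *
  have hB : 0 < B := (pow_pos hq₀ m).trans_le hb
  have hq : (0 : ℝ) < q := by exact_mod_cast hq₀
  rify at hbad hsum hb hB
  rw [le_div_iff₀ (by positivity), sub_mul, one_mul, sub_le_iff_le_add]
  refine hsum.ge.trans (add_le_add_right (hbad.trans ?_) _)
  calc ((N : ℝ) + 1) * ((6 + 8 * N) * q ^ (m - k) * B ^ N)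
      = (N + 1) * (6 + 8 * N) * (q : ℝ)⁻¹ ^ k * (q ^ m * B ^ N) := by
        rw [pow_sub₀ _ hq.ne' (by omega), inv_pow]
        ring
    _ ≤ (N + 1) * (6 + 8 * N) * (q : ℝ)⁻¹ ^ k * (B ^ (N + 1)) := by
        rw [pow_succ']
        gcongr

theorem wordBall_range_eq {α F : Type*} [DecidableEq α] [Group F] (b : FreeGroupBasis α F)
    (m : ℕ) : wordBall (Set.range b) m = {g | (b.repr g).norm ≤ m} := by
  ext g
  constructor
  · rintro ⟨l, hl, hmem, rfl⟩
    refine le_trans ?_ hl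
    clear hl
    induction l with
    | nil => simp
    | cons x l ih =>
      rw [List.prod_cons, _root_.map_mul, List.length_cons, add_comm]
      refine (norm_mul_le _ _).trans (add_le_add ?_ (ih fun y hy ↦ hmem y (by simp [hy])))
      obtain ⟨i, hi⟩ | ⟨i, hi⟩ := hmem x (by simp)
      · simp [← hi]
      · rw [← norm_inv_eq, ← _root_.map_inv, ← hi]
        simp
  · intro hg
    refine ⟨(b.repr g).toWord.map fun p ↦ cond p.2 (b p.1) (b p.1)⁻¹, ?_, ?_, ?_⟩
    · simpa [norm] using hg
    · intro x hx
      obtain ⟨⟨i, s⟩, -, rfl⟩ := List.mem_map.1 hx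
      cases s <;> simp
    · rw [← lift_mk, mk_toWord]
      refine b.repr.injective ?_
      have : (b.repr : F →* FreeGroup α).comp (lift b) = MonoidHom.id _ := by ext; simp
      exact DFunLike.congr_fun this (b.repr g)

end FreeGroup

theorem isFreeBasisTuple_comp_mulEquiv_iff {G H : Type*} [Group G] [Group H] {n : ℕ} (e : G ≃* H)
    (x : Fin n → G) : IsFreeBasisTuple (e ∘ x) ↔ IsFreeBasisTuple x := by
  have h : FreeGroup.lift (e ∘ x) = (e : G →* H).comp (FreeGroup.lift x) := by ext; simp
  rw [IsFreeBasisTuple, h, MonoidHom.coe_comp]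
  exact e.injective.of_comp_iff _

/-- Every finitely generated nonabelian free group (a free group of finite rank `r ≥ 2`)
satisfies the strong generic free group property with respect to a free basis as
generating set. -/
theorem freeGroup_strongGenericFreeGroupProperty
    {F : Type*} [Group F] (r : ℕ) (hr : 2 ≤ r) (b : FreeGroupBasis (Fin r) F) :
    StrongGenericFreeGroupProperty (Set.range b) := by
  classical
  intro n hn
  obtain ⟨N, rfl⟩ : ∃ N, n = N + 1 := ⟨n - 1, by omega⟩
  have hcard : 2 ≤ Fintype.card (Fin r) := by simpa
  have hball (m : ℕ) :
      (wordBall (Set.range b) m).ncard = (FreeGroup.normBall (Fin r) m).card := by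
    rw [FreeGroup.wordBall_range_eq, ← Set.ncard_image_of_injective _ b.repr.injective,
      ← Set.ncard_coe_finset]
    congr 1
    ext g
    simp only [Set.mem_image, Set.mem_ofPred_eq, Finset.mem_coe, FreeGroup.mem_normBall]
    exact ⟨fun ⟨x, hx, h⟩ ↦ h ▸ hx, fun h ↦ ⟨b.repr.symm g, by simpa, by simp⟩⟩
  have hgood (m : ℕ) : {x : Fin (N + 1) → F |
      (∀ i, x i ∈ wordBall (Set.range b) m) ∧ IsFreeBasisTuple x}.ncard =
      ((Fintype.piFinset fun _ : Fin (N + 1) ↦ FreeGroup.normBall (Fin r) m).filter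
        IsFreeBasisTuple).card := by
    rw [FreeGroup.wordBall_range_eq,
      ← Set.ncard_image_of_injective _ (b.repr.injective.comp_left (α := Fin (N + 1))),
      ← Set.ncard_coe_finset]
    congr 1
    ext x
    simp only [Set.mem_image, Set.mem_ofPred_eq, Finset.mem_coe, FreeGroup.mem_normBall,
      Finset.mem_filter, Fintype.mem_piFinset]
    constructor
    · rintro ⟨x, ⟨hx, hfree⟩, rfl⟩
      exact ⟨hx, (isFreeBasisTuple_comp_mulEquiv_iff b.repr x).2 hfree⟩
    · rintro ⟨hx, hfree⟩
      have hx' : b.repr ∘ b.repr.symm ∘ x = x := by ext; simp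
      refine ⟨b.repr.symm ∘ x, ⟨by simpa using hx, ?_⟩, hx'⟩
      rwa [← isFreeBasisTuple_comp_mulEquiv_iff b.repr, hx']
  simp only [hball, hgood]
  refine tendsto_of_tendsto_of_tendsto_of_le_of_le (g := fun m : ℕ ↦ 1 - (N + 1) * (6 + 8 * N) *
    ((2 * Fintype.card (Fin r) - 1 : ℕ) : ℝ)⁻¹ ^ (m / 3)) ?_ tendsto_const_nhds
    (fun m ↦ FreeGroup.one_sub_le_card_filter_isFreeBasisTuple_div hcard (by omega))
    (fun m ↦ div_le_one_of_le₀ ?_ (by positivity))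
  · have hq : (1 : ℝ) < (2 * Fintype.card (Fin r) - 1 : ℕ) := by
      exact_mod_cast (by omega : 1 < 2 * Fintype.card (Fin r) - 1)
    have h := (tendsto_pow_atTop_nhds_zero_of_lt_one (by positivity) (inv_lt_one_of_one_lt₀ hq)).comp
      (Nat.tendsto_div_const_atTop (n := 3) (by norm_num))
    simpa using (h.const_mul ((N + 1) * (6 + 8 * N) : ℝ)).const_sub 1
  · rw [← Nat.cast_pow, ← Fintype.card_piFinset_const]
    exact Nat.cast_le.2 (Finset.card_filter_le _ _)
end
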